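/- arXiv:math/0003062 — 2 statements merged into one kernel-verified Lean document; each statement's English description precedes it below -/
import Mathlib

section
/- Let K be a number field and F ∈ K[x₀,x₁,x₂,x₃] a cubic form whose zero locus X ⊂ P³ is a smooth surface (over an algebraic closure, F and its four partial derivatives have no common nonzero solution), and let H be a nonzero linear form over K such that the plane cubic curve D = X ∩ {H = 0} is smooth. Then there exist a finite extension K' of K and a finite set S of maximal ideals of O_{K'} such that, with R = O_{K',S}, the set of points (a₀ : a₁ : a₂ : a₃) ∈ P³(K') admitting representatives a₀,…,a₃ ∈ R with a₀R + a₁R + a₂R + a₃R = R, F(a₀,…,a₃) = 0 and H(a₀,…,a₃) ∈ R^× is Zariski dense in X, i.e., for every homogeneous polynomial G over K' not vanishing identically on X there is such a point at which G ≠ 0. -/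
open MvPolynomial IsDedekindDomain NumberField

namespace CubicLine

/-- The trilinear expression with coefficients `T`. -/
def tri {A : Type*} [CommRing A] (T : Fin 4 → Fin 4 → Fin 4 → A) (x y z : Fin 4 → A) : A :=
  ∑ i, ∑ j, ∑ l, T i j l * (x i * y j * z l)

section
variable {A : Type*} [CommRing A] (T : Fin 4 → Fin 4 → Fin 4 → A)

lemma tri_add1 (x x' y z : Fin 4 → A) : tri T (x + x') y z = tri T x y z + tri T x' y z := by
  simp only [tri, ← Finset.sum_add_distrib, Pi.add_apply]
  refine Finset.sum_congr rfl fun i _ => Finset.sum_congr rfl fun j _ =>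
    Finset.sum_congr rfl fun l _ => by ring
lemma tri_add2 (x y y' z : Fin 4 → A) : tri T x (y + y') z = tri T x y z + tri T x y' z := by
  simp only [tri, ← Finset.sum_add_distrib, Pi.add_apply]
  refine Finset.sum_congr rfl fun i _ => Finset.sum_congr rfl fun j _ =>
    Finset.sum_congr rfl fun l _ => by ring
lemma tri_add3 (x y z z' : Fin 4 → A) : tri T x y (z + z') = tri T x y z + tri T x y z' := by
  simp only [tri, ← Finset.sum_add_distrib, Pi.add_apply]
  refine Finset.sum_congr rfl fun i _ => Finset.sum_congr rfl fun j _ =>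
    Finset.sum_congr rfl fun l _ => by ring
lemma tri_smul1 (c : A) (x y z : Fin 4 → A) : tri T (c • x) y z = c * tri T x y z := by
  simp only [tri, Finset.mul_sum, Pi.smul_apply, smul_eq_mul]
  refine Finset.sum_congr rfl fun i _ => Finset.sum_congr rfl fun j _ =>
    Finset.sum_congr rfl fun l _ => by ring
lemma tri_smul2 (c : A) (x y z : Fin 4 → A) : tri T x (c • y) z = c * tri T x y z := by
  simp only [tri, Finset.mul_sum, Pi.smul_apply, smul_eq_mul]
  refine Finset.sum_congr rfl fun i _ => Finset.sum_congr rfl fun j _ =>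
    Finset.sum_congr rfl fun l _ => by ring
lemma tri_smul3 (c : A) (x y z : Fin 4 → A) : tri T x y (c • z) = c * tri T x y z := by
  simp only [tri, Finset.mul_sum, Pi.smul_apply, smul_eq_mul]
  refine Finset.sum_congr rfl fun i _ => Finset.sum_congr rfl fun j _ =>
    Finset.sum_congr rfl fun l _ => by ring

lemma tri_map {B : Type*} [CommRing B] (φ : A →+* B) (x y z : Fin 4 → A) :
    φ (tri T x y z) = tri (fun i j l => φ (T i j l)) (fun i => φ (x i)) (fun i => φ (y i))
      (fun i => φ (z i)) := by
  simp [tri, map_sum, map_mul]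
end

/-- A cubic form is given by a trilinear expression. -/
lemma exists_tri {k : Type*} [Field k] (F : MvPolynomial (Fin 4) k) (hF : F.IsHomogeneous 3) :
    ∃ T : Fin 4 → Fin 4 → Fin 4 → k, F = ∑ i, ∑ j, ∑ l, C (T i j l) * (X i * X j * X l) := by
  classical
  have key : ∀ d : Fin 4 →₀ ℕ, d.degree = 3 → ∃ i j l : Fin 4,
      d = Finsupp.single i 1 + Finsupp.single j 1 + Finsupp.single l 1 := by
    have step : ∀ (n : ℕ) (d : Fin 4 →₀ ℕ), d.degree = n + 1 →
        ∃ (i : Fin 4) (d' : Fin 4 →₀ ℕ), d = d' + Finsupp.single i 1 ∧ d'.degree = n := by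
      intro n d hd
      have hne : d ≠ 0 := by rintro rfl; simp at hd
      obtain ⟨i, hi⟩ := Finsupp.ne_iff.mp hne
      have hle : Finsupp.single i 1 ≤ d := by
        rw [Finsupp.single_le_iff]
        simp at hi; omega
      refine ⟨i, d - Finsupp.single i 1, (tsub_add_cancel_of_le hle).symm, ?_⟩
      have : (d - Finsupp.single i 1 + Finsupp.single i 1).degree = n + 1 := by
        rw [tsub_add_cancel_of_le hle, hd]
      simpa using this
    intro d hd
    obtain ⟨l, d1, rfl, h1⟩ := step 2 d hd
    obtain ⟨j, d2, rfl, h2⟩ := step 1 d1 h1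
    obtain ⟨i, d3, rfl, h3⟩ := step 0 d2 h2
    have : d3 = 0 := by simpa [Finsupp.degree_eq_zero_iff] using h3
    subst this
    exact ⟨i, j, l, by simp⟩
  rw [F.as_sum]
  have hd : ∀ d ∈ F.support, d.degree = 3 := by
    intro d hd
    by_contra h
    exact (mem_support_iff.mp hd) (hF.coeff_eq_zero h)
  revert hd
  generalize F.support = s
  induction s using Finset.induction_on with
  | empty => intro _; exact ⟨fun _ _ _ => 0, by simp⟩
  | insert d s hds ih =>
    intro hd
    obtain ⟨T, hT⟩ := ih fun d hd' => hd d (Finset.mem_insert_of_mem hd')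
    obtain ⟨i, j, l, rfl⟩ := key d (hd d (Finset.mem_insert_self _ _))
    rw [Finset.sum_insert hds, hT]
    refine ⟨fun i' j' l' => (if i' = i then if j' = j then if l' = l then
      F.coeff (Finsupp.single i 1 + Finsupp.single j 1 + Finsupp.single l 1) else 0 else 0 else 0)
        + T i' j' l', ?_⟩
    simp only [C_add, add_mul, Finset.sum_add_distrib]
    congr 1
    rw [Finset.sum_eq_single i (by intro b _ hb; simp [hb]) (by simp)]
    rw [Finset.sum_eq_single j (by intro b _ hb; simp [hb]) (by simp)]
    rw [Finset.sum_eq_single l (by intro b _ hb; simp [hb]) (by simp)]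
    simp only [if_true, X, C_mul_monomial, monomial_mul, mul_one]

lemma eval_triPoly {k A : Type*} [Field k] [CommRing A] [Algebra k A]
    (T : Fin 4 → Fin 4 → Fin 4 → k) (x : Fin 4 → A) :
    aeval x (∑ i, ∑ j, ∑ l, C (T i j l) * (X i * X j * X l) : MvPolynomial (Fin 4) k)
      = tri (fun i j l => algebraMap k A (T i j l)) x x x := by
  simp [tri]

lemma eval_pderiv_triPoly {k A : Type*} [Field k] [CommRing A] [Algebra k A]
    (T : Fin 4 → Fin 4 → Fin 4 → k) (x v : Fin 4 → A) :
    ∑ n, v n * aeval x (pderiv n (∑ i, ∑ j, ∑ l, C (T i j l) * (X i * X j * X l) :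
      MvPolynomial (Fin 4) k))
      = tri (fun i j l => algebraMap k A (T i j l)) v x x +
        tri (fun i j l => algebraMap k A (T i j l)) x v x +
        tri (fun i j l => algebraMap k A (T i j l)) x x v := by
  classical
  have h : ∀ i : Fin 4, ∑ n, v n * aeval x (pderiv n (X i : MvPolynomial (Fin 4) k)) = v i := by
    intro i
    simp [pderiv_X, Pi.single_apply, apply_ite]
  simp only [tri, map_sum, ← Finset.sum_add_distrib, Finset.mul_sum]
  rw [Finset.sum_comm]; refine Finset.sum_congr rfl fun i _ => ?_
  rw [Finset.sum_comm]; refine Finset.sum_congr rfl fun j _ => ?_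
  rw [Finset.sum_comm]; refine Finset.sum_congr rfl fun l _ => ?_
  have hi := h i
  have hj := h j
  have hl := h l
  calc _ = ∑ n, (algebraMap k A (T i j l) * (x j * x l) * (v n * aeval x (pderiv n (X i : MvPolynomial (Fin 4) k)))
      + algebraMap k A (T i j l) * (x i * x l) * (v n * aeval x (pderiv n (X j : MvPolynomial (Fin 4) k)))
      + algebraMap k A (T i j l) * (x i * x j) * (v n * aeval x (pderiv n (X l : MvPolynomial (Fin 4) k)))) := by
        refine Finset.sum_congr rfl fun n _ => ?_
        simp only [Derivation.leibniz, pderiv_C, smul_eq_mul, map_add, map_mul, aeval_C, aeval_X,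
          mul_zero, add_zero]
        ring
    _ = _ := by
        rw [Finset.sum_add_distrib, Finset.sum_add_distrib, ← Finset.mul_sum, ← Finset.mul_sum,
          ← Finset.mul_sum, hi, hj, hl]
        ring

end CubicLine
namespace CubicLine

lemma aeval_smul_homog {k A σ : Type*} [CommRing k] [CommRing A] [Algebra k A]
    {Q : MvPolynomial σ k} {n : ℕ} (hQ : Q.IsHomogeneous n) (c : A) (x : σ → A) :
    aeval (fun i => c * x i) Q = c ^ n * aeval x Q := by
  rw [aeval_def, aeval_def, eval₂_eq, eval₂_eq, Finset.mul_sum]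
  refine Finset.sum_congr rfl fun d hd => ?_
  have hdeg : d.degree = n := by
    by_contra h
    exact (mem_support_iff.mp hd) (hQ.coeff_eq_zero h)
  simp only [mul_pow, Finset.prod_mul_distrib, Finset.prod_pow_eq_pow_sum]
  rw [← hdeg, Finsupp.degree_apply]
  ring

/-- `u` and the `u A_i + g_i(A)` are algebraically independent. -/
lemma alg_indep {k : Type*} [Field k] [Infinite k] (g : Fin 4 → MvPolynomial (Fin 4) k)
    (M : Type*) [Field M] [Algebra k M] [Algebra (Polynomial (MvPolynomial (Fin 4) k)) M]
    [IsScalarTower k (Polynomial (MvPolynomial (Fin 4) k)) M]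
    (hinj : Function.Injective (algebraMap (Polynomial (MvPolynomial (Fin 4) k)) M))
    (u : M) (hu : u * algebraMap (Polynomial (MvPolynomial (Fin 4) k)) M Polynomial.X = 1)
    (Q : MvPolynomial (Option (Fin 4)) k)
    (hQ : aeval (fun o : Option (Fin 4) => o.elim u (fun i =>
      u * algebraMap (Polynomial (MvPolynomial (Fin 4) k)) M (Polynomial.C (X i) + Polynomial.X * Polynomial.C (g i)))) Q = 0) :
    Q = 0 := by
  by_contra hne
  set N := Q.totalDegree with hN
  set v : Polynomial (MvPolynomial (Fin 4) k) := Polynomial.X with hv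
  set y : Option (Fin 4) → Polynomial (MvPolynomial (Fin 4) k) := fun o =>
    o.elim 1 (fun i => Polynomial.C (X i) + v * Polynomial.C (g i)) with hy
  have h1 : (fun o : Option (Fin 4) => o.elim u (fun i =>
      u * algebraMap (Polynomial (MvPolynomial (Fin 4) k)) M (Polynomial.C (X i) + Polynomial.X * Polynomial.C (g i)))) =
      fun o => u * algebraMap (Polynomial (MvPolynomial (Fin 4) k)) M (y o) := by
    funext o; cases o <;> simp [hy, hv]
  rw [h1, ← sum_homogeneousComponent Q, map_sum] at hQ
  have h2 : ∑ j ∈ Finset.range (N + 1), v ^ (N - j) * aeval y (homogeneousComponent j Q) = 0 := by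
    apply hinj
    rw [map_zero, ← mul_zero ((algebraMap (Polynomial (MvPolynomial (Fin 4) k)) M v) ^ N), ← hQ, Finset.mul_sum, map_sum]
    refine Finset.sum_congr rfl fun j hj => ?_
    have hjN : j ≤ N := by simpa [Nat.lt_succ_iff] using hj
    rw [aeval_smul_homog (homogeneousComponent_isHomogeneous j Q), map_mul, map_pow]
    have : aeval (fun o => algebraMap (Polynomial (MvPolynomial (Fin 4) k)) M (y o)) (homogeneousComponent j Q)
        = algebraMap (Polynomial (MvPolynomial (Fin 4) k)) M (aeval y (homogeneousComponent j Q)) := by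
      exact aeval_algebraMap_apply M y (homogeneousComponent j Q)
    rw [this, ← mul_assoc]
    congr 1
    obtain ⟨e, he⟩ := Nat.exists_eq_add_of_le hjN
    rw [he, Nat.add_sub_cancel_left, pow_add, mul_assoc, mul_comm (_ ^ e), ← mul_assoc, ← mul_pow,
      mul_comm _ u, hu, one_pow, one_mul]
  have h3 : aeval (fun o : Option (Fin 4) => o.elim (1 : MvPolynomial (Fin 4) k) X)
      (homogeneousComponent N Q) = 0 := by
    have := congrArg (Polynomial.aeval (R := MvPolynomial (Fin 4) k) (0 : MvPolynomial (Fin 4) k)) h2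
    rw [map_sum, Finset.sum_eq_single N] at this
    · simp only [Nat.sub_self, pow_zero, one_mul, map_zero] at this
      rw [← this]
      have e2 : ((Polynomial.aeval (R := MvPolynomial (Fin 4) k)
          (0 : MvPolynomial (Fin 4) k)).restrictScalars k) (aeval y (homogeneousComponent N Q)) =
          aeval (fun o => (Polynomial.aeval (R := MvPolynomial (Fin 4) k)
          (0 : MvPolynomial (Fin 4) k)) (y o)) (homogeneousComponent N Q) := by
        rw [← AlgHom.comp_apply, comp_aeval]; rfl
      rw [AlgHom.restrictScalars_apply] at e2
      rw [e2]
      congr 2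
      funext o; cases o <;> simp [hy, hv]
    · intro j hj hjN
      have hlt : j < N := by
        have := Finset.mem_range.mp hj; omega
      rw [map_mul, map_pow, hv, Polynomial.aeval_X, zero_pow (by omega), zero_mul]
    · simp
  have h4 : X none * homogeneousComponent N Q = 0 := by
    apply MvPolynomial.funext
    intro x
    rw [map_mul, eval_X, map_zero]
    by_cases hx : x none = 0
    · rw [hx, zero_mul]
    · have h5 := congrArg (eval (fun i => (x none)⁻¹ * x (some i))) h3
      have h6 : eval (fun i => (x none)⁻¹ * x (some i))
          (aeval (fun o : Option (Fin 4) => o.elim (1 : MvPolynomial (Fin 4) k) X)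
            (homogeneousComponent N Q)) = aeval (fun o => (x none)⁻¹ * x o)
            (homogeneousComponent N Q) := by
        rw [← coe_aeval_eq_eval]
        change (aeval _) _ = _
        rw [← AlgHom.comp_apply, comp_aeval]
        congr 2
        funext o; cases o <;> simp [hx]
      rw [h6, aeval_smul_homog (homogeneousComponent_isHomogeneous N Q), map_zero] at h5
      have h7 := (mul_eq_zero.mp h5).resolve_left (pow_ne_zero _ (inv_ne_zero hx))
      rw [aeval_eq_eval] at h7
      have h8 : eval x (homogeneousComponent N Q) = 0 := h7
      rw [h8, mul_zero]
  have h5 : homogeneousComponent N Q = 0 := (mul_eq_zero.mp h4).resolve_left (X_ne_zero _)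
  obtain ⟨d, hd, hdN⟩ : ∃ d ∈ Q.support, d.degree = N := by
    have hsn : Q.support.Nonempty := by simpa using hne
    obtain ⟨d, hd, h⟩ := Finset.exists_mem_eq_sup Q.support hsn (fun s => s.sum fun _ e => e)
    exact ⟨d, hd, by rw [hN, totalDegree, h]; rfl⟩
  have := congrArg (coeff d) h5
  rw [coeff_homogeneousComponent, if_pos hdN, coeff_zero] at this
  exact (mem_support_iff.mp hd) this

end CubicLine
namespace CubicLine

lemma descend {k κ σ : Type*} [Field k] [IsAlgClosed k] [Field κ] [Algebra k κ] [Finite σ]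
    (x : σ → κ) : ∃ y : σ → k, ∀ Q : MvPolynomial σ k, aeval x Q = 0 → eval y Q = 0 := by
  have hne : RingHom.ker (aeval (R := k) x) ≠ ⊤ := RingHom.ker_ne_top _
  obtain ⟨m, hm, hle⟩ := Ideal.exists_le_maximal _ hne
  obtain ⟨y, hy⟩ := (isMaximal_iff_eq_vanishingIdeal_singleton (K := k)).mp hm
  refine ⟨y, fun Q hQ => ?_⟩
  have : Q ∈ m := hle hQ
  rw [hy] at this
  have := (mem_vanishingIdeal_iff.mp this) y (by simp)
  simpa [aeval_eq_eval] using this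

/-- Every cubic surface over an algebraically closed field contains a line. -/
theorem exists_line {k : Type*} [Field k] [IsAlgClosed k] (T : Fin 4 → Fin 4 → Fin 4 → k) :
    ∃ (p q : Fin 4 → k) (i j : Fin 4), p i = 1 ∧ p j = 0 ∧ q i = 0 ∧ q j = 1 ∧
      ∀ a b : k, tri T (a • p + b • q) (a • p + b • q) (a • p + b • q) = 0 := by
  classical
  let P := MvPolynomial (Fin 4) k
  let R := Polynomial P
  let M := FractionRing R
  haveI : Infinite k := IsAlgClosed.instInfinite
  let ι : P →+* M := (algebraMap R M).comp Polynomial.C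
  let TP : Fin 4 → Fin 4 → Fin 4 → P := fun i j l => C (T i j l)
  let pP : Fin 4 → P := ![1, 0, X 2, X 0]
  let qP : Fin 4 → P := ![0, 1, X 3, X 1]
  let g : Fin 4 → P := ![tri TP pP pP pP, tri TP pP pP qP + tri TP pP qP pP + tri TP qP pP pP,
    tri TP pP qP qP + tri TP qP pP qP + tri TP qP qP pP, tri TP qP qP qP]
  let v : M := algebraMap R M Polynomial.X
  have hv : v ≠ 0 := by
    intro h
    have : (Polynomial.X : R) = 0 :=
      (IsFractionRing.injective R M) (by rw [map_zero]; exact h)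
    exact Polynomial.X_ne_zero this
  let u : M := v⁻¹
  have huv : u * v = 1 := inv_mul_cancel₀ hv
  let s : Option (Fin 4) → M := fun o : Option (Fin 4) => o.elim u (fun i =>
      u * algebraMap R M (Polynomial.C (X i) + Polynomial.X * Polynomial.C (g i)))
  have hs : ∀ i : Fin 4, s (some i) = u * ι (X i) + ι (g i) := by
    intro i
    have : s (some i) = u * (ι (X i) + v * ι (g i)) := by
      change u * algebraMap R M _ = _
      rw [map_add, map_mul]; rfl
    rw [this, mul_add, ← mul_assoc, huv, one_mul]
  let φ : MvPolynomial (Option (Fin 4)) k →ₐ[k] M := aeval s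
  have hφ : ∀ Q, φ Q = 0 → Q = 0 := fun Q hQ =>
    alg_indep g M (IsFractionRing.injective R M) u huv Q hQ
  let I : Ideal φ.toRingHom.range :=
    Ideal.map φ.toRingHom.rangeRestrict (RingHom.ker (eval (fun _ : Option (Fin 4) => (0 : k))))
  have hI : I ≠ ⊤ := by
    intro h
    rw [Ideal.eq_top_iff_one,
      Ideal.mem_map_iff_of_surjective _ φ.toRingHom.rangeRestrict_surjective] at h
    obtain ⟨Q, hQ, h1⟩ := h
    have h2 : φ Q = 1 := congrArg Subtype.val h1
    have h3 : Q - 1 = 0 := hφ _ (by rw [map_sub, h2, map_one, sub_self])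
    rw [sub_eq_zero] at h3
    subst h3
    simp [RingHom.mem_ker] at hQ
  obtain ⟨V, hAV, hIV⟩ := Ideal.image_subset_nonunits_valuationSubring I hI
  have hVk : ∀ c : k, algebraMap k M c ∈ V := fun c =>
    hAV ⟨C c, by simp [φ]⟩
  have hsn : ∀ o, s o ∈ V.nonunits := fun o => by
    apply hIV
    refine ⟨φ.toRingHom.rangeRestrict (X o), Ideal.mem_map_of_mem _ ?_, ?_⟩
    · simp [RingHom.mem_ker]
    · exact aeval_X _ _
  have hsV : ∀ o, s o ∈ V := fun o => V.nonunits_subset (hsn o)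
  -- the perturbed cubic
  let κ := IsLocalRing.ResidueField V
  let ρ : V →+* κ := IsLocalRing.residue V
  let kV : k →+* V := (algebraMap k M).codRestrict V.toSubring hVk
  letI : Algebra k κ := (ρ.comp kV).toAlgebra
  let sV : Option (Fin 4) → V := fun o => ⟨s o, hsV o⟩
  have hρs : ∀ o, ρ (sV o) = 0 := fun o => by
    rw [IsLocalRing.residue_eq_zero_iff]
    exact ValuationSubring.coe_mem_nonunits_iff.mp (hsn o)
  let E : Fin 4 → Fin 4 → Fin 4 → Option (Option (Fin 4) × Bool) := fun i j l =>
    if (i, j, l) = (2, 1, 1) then some (none, true)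
    else if (i, j, l) = (3, 0, 0) then some (none, true)
    else if (i, j, l) = (0, 0, 0) then some (some 0, false)
    else if (i, j, l) = (0, 0, 1) then some (some 1, false)
    else if (i, j, l) = (0, 1, 1) then some (some 2, false)
    else if (i, j, l) = (1, 1, 1) then some (some 3, false) else none
  let EV : Fin 4 → Fin 4 → Fin 4 → V := fun i j l =>
    (E i j l).elim 0 (fun o => if o.2 then sV o.1 else - sV o.1)
  let TV : Fin 4 → Fin 4 → Fin 4 → V := fun i j l => kV (T i j l) + EV i j l
  have hTV : ∀ i j l, ρ (TV i j l) = algebraMap k κ (T i j l) := by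
    intro i j l
    have : ρ (EV i j l) = 0 := by
      simp only [EV]
      cases E i j l with
      | none => simp
      | some o =>
        simp only [Option.elim]
        split_ifs <;> simp [hρs]
    simp only [TV, map_add, this, add_zero]
    rfl
  let TM : Fin 4 → Fin 4 → Fin 4 → M := fun i j l => (TV i j l : M)
  let p0 : Fin 4 → M := fun i => ι (pP i)
  let q0 : Fin 4 → M := fun i => ι (qP i)
  have hE : ∀ x : Fin 4 → M, tri TM x x x = tri (fun i j l => ι (TP i j l)) x x x
      + (s none * (x 2 * x 1 * x 1) + s none * (x 3 * x 0 * x 0) - s (some 0) * (x 0 * x 0 * x 0)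
      - s (some 1) * (x 0 * x 0 * x 1) - s (some 2) * (x 0 * x 1 * x 1)
      - s (some 3) * (x 1 * x 1 * x 1)) := by
    intro x
    have h1 : tri TM x x x = tri (fun i j l => ι (TP i j l)) x x x
      + tri (fun i j l => (EV i j l : M)) x x x := by
      simp only [tri, ← Finset.sum_add_distrib, ← add_mul]
      rfl
    rw [h1]
    congr 1
    simp [tri, Fin.sum_univ_four, EV, E, sV]
    ring
  have hline : ∀ a b : M, tri TM (a • p0 + b • q0) (a • p0 + b • q0) (a • p0 + b • q0) = 0 := by
    intro a b
    rw [hE]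
    have hg0 : ι (g 0) = tri (fun i j l => ι (TP i j l)) p0 p0 p0 := by
      simp only [g, Matrix.cons_val]; rw [tri_map]
    have hg1 : ι (g 1) = tri (fun i j l => ι (TP i j l)) p0 p0 q0 +
        tri (fun i j l => ι (TP i j l)) p0 q0 p0 + tri (fun i j l => ι (TP i j l)) q0 p0 p0 := by
      simp only [g, Matrix.cons_val]; rw [map_add, map_add, tri_map, tri_map, tri_map]
    have hg2 : ι (g 2) = tri (fun i j l => ι (TP i j l)) p0 q0 q0 +
        tri (fun i j l => ι (TP i j l)) q0 p0 q0 + tri (fun i j l => ι (TP i j l)) q0 q0 p0 := by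
      simp only [g, Matrix.cons_val]; rw [map_add, map_add, tri_map, tri_map, tri_map]
    have hg3 : ι (g 3) = tri (fun i j l => ι (TP i j l)) q0 q0 q0 := by
      simp only [g, Matrix.cons_val]; rw [tri_map]
    have x0 : (a • p0 + b • q0) 0 = a := by simp [p0, q0, pP, qP]
    have x1 : (a • p0 + b • q0) 1 = b := by simp [p0, q0, pP, qP]
    have x2 : (a • p0 + b • q0) 2 = a * ι (X 2) + b * ι (X 3) := by simp [p0, q0, pP, qP]
    have x3 : (a • p0 + b • q0) 3 = a * ι (X 0) + b * ι (X 1) := by simp [p0, q0, pP, qP]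
    have hsn : s none = u := rfl
    rw [x0, x1, x2, x3, hs, hs, hs, hs, hg0, hg1, hg2, hg3, hsn]
    simp only [tri_add1, tri_add2, tri_add3, tri_smul1, tri_smul2, tri_smul3]
    ring
  -- normalise the line
  let μ : Fin 4 × Fin 4 → M := fun c => p0 c.1 * q0 c.2 - p0 c.2 * q0 c.1
  obtain ⟨⟨i, j⟩, -, hmax⟩ := Finset.exists_max_image (Finset.univ : Finset (Fin 4 × Fin 4))
    (fun c => V.valuation (μ c)) Finset.univ_nonempty
  have hμ0 : μ (i, j) ≠ 0 := by
    intro h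
    have h1 := hmax (0, 1) (Finset.mem_univ _)
    have h2 : μ (0, 1) = 1 := by simp [μ, p0, q0, pP, qP]
    rw [h2, h, map_one, map_zero] at h1
    exact absurd h1 (by simp)
  have hdiv : ∀ c, μ c / μ (i, j) ∈ V := by
    intro c
    rw [← V.valuation_le_one_iff, map_div₀]
    exact div_le_one_of_le₀ (hmax c (Finset.mem_univ _)) zero_le
  let pV : Fin 4 → V := fun l => ⟨μ (l, j) / μ (i, j), hdiv _⟩
  let qV : Fin 4 → V := fun l => ⟨μ (i, l) / μ (i, j), hdiv _⟩
  have hμ0' : p0 i * q0 j - p0 j * q0 i ≠ 0 := hμ0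
  have hlineV : ∀ a b : V, tri TV (a • pV + b • qV) (a • pV + b • qV) (a • pV + b • qV) = 0 := by
    intro a b
    apply Subtype.val_injective
    have h1 := tri_map TV V.subtype (a • pV + b • qV) (a • pV + b • qV) (a • pV + b • qV)
    have h2 : (fun l => V.subtype ((a • pV + b • qV) l)) =
        ((a * q0 j - b * q0 i) / μ (i, j)) • p0 + ((b * p0 i - a * p0 j) / μ (i, j)) • q0 := by
      funext l
      have e1 : V.subtype ((a • pV + b • qV) l) =
        (a : M) * (μ (l, j) / μ (i, j)) + b * (μ (i, l) / μ (i, j)) := rfl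
      rw [e1]
      simp only [Pi.add_apply, Pi.smul_apply, smul_eq_mul, div_eq_mul_inv]
      generalize (μ (i, j))⁻¹ = t
      simp only [μ]
      ring
    rw [h2] at h1
    exact h1.trans (hline _ _)
  let pκ : Fin 4 → κ := fun l => ρ (pV l)
  let qκ : Fin 4 → κ := fun l => ρ (qV l)
  have hlineκ : ∀ a b : k, tri (fun i j l => algebraMap k κ (T i j l))
      (algebraMap k κ a • pκ + algebraMap k κ b • qκ) (algebraMap k κ a • pκ + algebraMap k κ b • qκ)
      (algebraMap k κ a • pκ + algebraMap k κ b • qκ) = 0 := by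
    intro a b
    have h1 := congrArg ρ (hlineV (kV a) (kV b))
    rw [tri_map, map_zero] at h1
    simp only [hTV] at h1
    rw [← h1]
    have : (fun l => ρ ((kV a • pV + kV b • qV) l)) =
        algebraMap k κ a • pκ + algebraMap k κ b • qκ := by
      funext l
      simp only [Pi.add_apply, Pi.smul_apply, smul_eq_mul, map_add, map_mul]
      rfl
    rw [this]
  have one_of : ∀ w : V, (w : M) = 1 → ρ w = 1 := fun w hw => by
    rw [show w = 1 from Subtype.ext hw, map_one]
  have zero_of : ∀ w : V, (w : M) = 0 → ρ w = 0 := fun w hw => by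
    rw [show w = 0 from Subtype.ext hw, map_zero]
  have hpi : pκ i = 1 := one_of _ (div_self hμ0)
  have hqj : qκ j = 1 := one_of _ (div_self hμ0)
  have hpj : pκ j = 0 := zero_of _ (by
    change (p0 j * q0 j - p0 j * q0 j) / _ = (0 : M); rw [sub_self, zero_div])
  have hqi : qκ i = 0 := zero_of _ (by
    change (p0 i * q0 i - p0 i * q0 i) / _ = (0 : M); rw [sub_self, zero_div])
  obtain ⟨y, hy⟩ := descend (k := k) (Sum.elim pκ qκ)
  refine ⟨fun l => y (Sum.inl l), fun l => y (Sum.inr l), i, j, ?_, ?_, ?_, ?_, ?_⟩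
  · have := hy (X (Sum.inl i) - 1) (by simp [hpi])
    simpa [sub_eq_zero] using this
  · have := hy (X (Sum.inl j)) (by simp [hpj])
    simpa [sub_eq_zero] using this
  · have := hy (X (Sum.inr i)) (by simp [hqi])
    simpa [sub_eq_zero] using this
  · have := hy (X (Sum.inr j) - 1) (by simp [hqj])
    simpa [sub_eq_zero] using this
  · intro a b
    let Q : Fin 4 → MvPolynomial (Fin 4 ⊕ Fin 4) k := fun l =>
      C a * X (Sum.inl l) + C b * X (Sum.inr l)
    have := hy (tri (fun i j l => C (T i j l)) Q Q Q) (by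
      have h1 := tri_map (fun i j l => C (T i j l)) (aeval (R := k) (Sum.elim pκ qκ)).toRingHom Q Q Q
      refine Eq.trans h1 ?_
      rw [← hlineκ a b]
      have e : (fun l => (aeval (R := k) (Sum.elim pκ qκ)).toRingHom (Q l)) =
        algebraMap k κ a • pκ + algebraMap k κ b • qκ := by
        funext l; simp [Q, Algebra.smul_def]
      rw [e]
      congr 1
      funext i j l; simp)
    rw [tri_map] at this
    rw [← this]
    have e : (fun l => eval y (Q l)) = (a • fun l => y (Sum.inl l)) + b • fun l => y (Sum.inr l) := by
      funext l; simp [Q]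
    rw [e]
    congr 1
    funext i j l; simp

end CubicLine
namespace CubicLine

/-- A unit of infinite order on which the involution acts by inversion. -/
lemma exists_quad_unit {E : Type*} [Field E] [NumberField E] (σ : E →+* E)
    (hσ : ∀ x, σ (σ x) = x) (I s : E) (hI : I ^ 2 = -1) (hσI : σ I = I) (hs : s ≠ 0)
    (hσs : σ s = -s) :
    ∃ ε : (𝓞 E)ˣ, σ (ε : E) * (ε : E) = 1 ∧ ¬ IsOfFinOrder ε := by
  obtain ⟨φ⟩ : Nonempty (E →+* ℂ) := inferInstance
  let w := InfinitePlace.mk φ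
  have hw : w.comap σ ≠ w := by
    intro h
    rw [InfinitePlace.comap_mk, InfinitePlace.mk_eq_iff] at h
    rcases h with h | h
    · have h1 : φ (σ s) = φ s := RingHom.congr_fun h s
      rw [hσs, map_neg] at h1
      have : φ s = 0 := by linear_combination (-1/2 : ℂ) * h1
      exact hs ((map_eq_zero φ).mp this)
    · have h1 : starRingEnd ℂ (φ (σ I)) = φ I := RingHom.congr_fun h I
      rw [hσI] at h1
      have h2 : φ I ^ 2 = -1 := by rw [← map_pow, hI, map_neg, map_one]
      have h3 := congrArg Complex.im h1
      have h4 := congrArg Complex.re h2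
      have h5 : (φ I).im = 0 := by simp at h3; linarith
      rw [sq, Complex.mul_re, h5] at h4
      simp at h4
      nlinarith [sq_nonneg (φ I).re]
  obtain ⟨u, hu⟩ := Units.dirichletUnitTheorem.exists_unit E w
  let σO : 𝓞 E →+* 𝓞 E := RingOfIntegers.mapRingHom σ
  have hσO : ∀ x : 𝓞 E, ((σO x : 𝓞 E) : E) = σ (x : E) := fun x => rfl
  let u' : (𝓞 E)ˣ := Units.map σO.toMonoidHom u
  have hu' : ((u' : 𝓞 E) : E) = σ (u : E) := rfl
  have hune : ((u : 𝓞 E) : E) ≠ 0 := by simp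
  have hσune : σ ((u : 𝓞 E) : E) ≠ 0 := by simp
  have hεc : (((u * u'⁻¹ : (𝓞 E)ˣ) : 𝓞 E) : E) = (u : E) * (σ (u : E))⁻¹ := by
    rw [← hu']; simp
  refine ⟨u * u'⁻¹, ?_, ?_⟩
  · have hεc' : algebraMap (𝓞 E) E ((u * u'⁻¹ : (𝓞 E)ˣ) : 𝓞 E) = (u : E) * (σ (u : E))⁻¹ := hεc
    rw [hεc', map_mul, map_inv₀, hσ]
    field_simp
  · intro hfin
    obtain ⟨n, hn, h1⟩ := isOfFinOrder_iff_pow_eq_one.mp hfin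
    have h2 : ((u : E) * (σ (u : E))⁻¹) ^ n = 1 := by
      rw [← hεc]
      have := congrArg (fun x : (𝓞 E)ˣ => ((x : 𝓞 E) : E)) h1
      simpa using this
    have h3 : w ((u : E) * (σ (u : E))⁻¹) = 1 := by
      have := congrArg w h2
      rw [map_pow, map_one] at this
      exact (pow_eq_one_iff_of_nonneg (apply_nonneg _ _) hn.ne').mp this
    rw [map_mul, map_inv₀] at h3
    have h4 : w (σ (u : E)) ≠ 0 := by simp
    have h5 : w (u : E) = w (σ (u : E)) := by field_simp at h3; exact h3
    have h6 := hu _ hw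
    rw [InfinitePlace.comap_apply, ← h5] at h6
    have h7 := Units.sum_mult_mul_log u
    have h8 : ∑ w : InfinitePlace E, (w.mult : ℝ) * Real.log (w u) < 0 := by
      apply Finset.sum_neg
      · intro v _
        have hm : (0 : ℝ) < v.mult := by exact_mod_cast v.mult_pos
        refine mul_neg_of_pos_of_neg hm ?_
        by_cases hv : v = w
        · rw [hv]; exact h6
        · exact hu v hv
      · exact ⟨w, Finset.mem_univ _⟩
    rw [h7] at h8
    exact lt_irrefl _ h8

lemma pell_units {A : Type*} [CommRing A] [IsDomain A] [CharZero A] (s : A)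
    (hfin : Finite (A ⧸ Ideal.span {2 * s ^ 2})) (ε : Aˣ) (hε : ¬ IsOfFinOrder ε) :
    {q : A | ∃ (p : A) (n : ℕ), 2 * p = (ε ^ n : Aˣ) + ((ε⁻¹) ^ n : Aˣ) ∧
      2 * s * q = (ε ^ n : Aˣ) - ((ε⁻¹) ^ n : Aˣ)}.Infinite := by
  let π := Ideal.Quotient.mk (Ideal.span {2 * s ^ 2})
  obtain ⟨N, hN, hN1⟩ := isOfFinOrder_iff_pow_eq_one.mp
    (isOfFinOrder_of_finite (Units.map π.toMonoidHom ε))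
  have hdvd : ∀ v : Aˣ, Units.map π.toMonoidHom v = 1 → ∃ η : A, (v : A) = 1 + 2 * s ^ 2 * η := by
    intro v hv
    have h1 : π (v : A) = π 1 := by rw [map_one]; exact congrArg Units.val hv
    rw [Ideal.Quotient.eq, Ideal.mem_span_singleton] at h1
    obtain ⟨η, h⟩ := h1
    exact ⟨η, by linear_combination h⟩
  have key : ∀ j : ℕ, ∃ q p : A, 2 * p = (ε ^ (N * j) : Aˣ) + ((ε⁻¹) ^ (N * j) : Aˣ) ∧
      2 * s * q = (ε ^ (N * j) : Aˣ) - ((ε⁻¹) ^ (N * j) : Aˣ) := by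
    intro j
    obtain ⟨η, h⟩ := hdvd (ε ^ (N * j)) (by rw [map_pow, pow_mul, hN1, one_pow])
    obtain ⟨η', h'⟩ := hdvd ((ε⁻¹) ^ (N * j)) (by
      rw [map_pow, map_inv, pow_mul, inv_pow, hN1, inv_one, one_pow])
    refine ⟨s * (η - η'), 1 + s ^ 2 * (η + η'), ?_, ?_⟩
    · rw [h, h']; ring
    · rw [h, h']; ring
  choose q p hp hq using key
  refine Set.infinite_of_injective_forall_mem (f := fun j => q (j + 1)) ?_
    (fun j => ⟨p (j + 1), N * (j + 1), hp _, hq _⟩)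
  intro i j hij
  simp only at hij
  have h1 := hq (i + 1)
  rw [hij, hq (j + 1)] at h1
  have hinj : Function.Injective (fun n : ℕ => ε ^ n) := injective_pow_iff_not_isOfFinOrder.mpr hε
  set a : A := ((ε ^ (N * (i + 1)) : Aˣ) : A) with ha
  set b : A := ((ε ^ (N * (j + 1)) : Aˣ) : A) with hb
  set a' : A := (((ε⁻¹) ^ (N * (i + 1)) : Aˣ) : A) with ha'
  set b' : A := (((ε⁻¹) ^ (N * (j + 1)) : Aˣ) : A) with hb'
  have haa : a * a' = 1 := by rw [ha, ha', ← Units.val_mul, inv_pow, mul_inv_cancel, Units.val_one]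
  have hbb : b * b' = 1 := by rw [hb, hb', ← Units.val_mul, inv_pow, mul_inv_cancel, Units.val_one]
  have h2 : (a - b) * (a * b + 1) = 0 := by
    linear_combination (-a * b) * h1 + b * haa - a * hbb
  rcases mul_eq_zero.mp h2 with h3 | h3
  · have h4 : ε ^ (N * (i + 1)) = ε ^ (N * (j + 1)) := Units.ext (sub_eq_zero.mp h3)
    have h5 := hinj h4
    have := Nat.eq_of_mul_eq_mul_left hN h5
    omega
  · exfalso
    have h4 : ε ^ (2 * (N * (i + 1) + N * (j + 1))) = 1 := by
      apply Units.ext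
      rw [mul_comm 2, pow_mul, pow_add]
      push_cast
      push_cast at ha hb
      rw [← ha, ← hb]
      linear_combination (a * b - 1) * h3
    exact hε (isOfFinOrder_iff_pow_eq_one.mpr ⟨_, by positivity, h4⟩)

lemma finite_quot {E : Type*} [Field E] [NumberField E] (x : 𝓞 E) (hx : x ≠ 0) :
    Finite (𝓞 E ⧸ Ideal.span {x}) :=
  Ring.HasFiniteQuotients.finiteQuotient (by simpa using hx)

lemma quad_exists {k : Type} [Field k] [NumberField k] (d : k) (hsq : ¬ ∃ s : k, s ^ 2 = d) :
    ∃ (E : Type) (_ : Field E) (_ : NumberField E) (_ : Algebra k E) (σ : E →+* E) (s0 : E),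
      (∀ x, σ (σ x) = x) ∧ (∀ x : k, σ (algebraMap k E x) = algebraMap k E x) ∧
      (∀ x : E, σ x = x → ∃ y : k, x = algebraMap k E y) ∧ s0 ^ 2 = algebraMap k E d ∧
      σ s0 = -s0 ∧ s0 ≠ 0 := by
  have hfact : Fact (∀ r : k, r ^ 2 ≠ d + 0 * r) :=
    ⟨fun r hr => hsq ⟨r, by simpa using hr⟩⟩
  have : CharZero (QuadraticAlgebra k d 0) :=
    charZero_of_injective_algebraMap (algebraMap k (QuadraticAlgebra k d 0)).injective
  have : FiniteDimensional ℚ (QuadraticAlgebra k d 0) :=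
    FiniteDimensional.trans ℚ k (QuadraticAlgebra k d 0)
  have : NumberField (QuadraticAlgebra k d 0) := ⟨⟩
  refine ⟨QuadraticAlgebra k d 0, inferInstance, inferInstance, inferInstance,
    starRingEnd (QuadraticAlgebra k d 0), ⟨0, 1⟩, fun x => star_star x, fun x => ?_, fun x hx => ?_,
    ?_, ?_, ?_⟩
  · change star _ = _
    rw [QuadraticAlgebra.algebraMap_eq, QuadraticAlgebra.star_mk]; simp
  · have h1 := congrArg QuadraticAlgebra.im hx
    have h2 : -x.im = x.im := (QuadraticAlgebra.im_star x).symm.trans h1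
    have h3 : x.im = 0 := by linear_combination (-1/2 : k) * h2
    exact ⟨x.re, QuadraticAlgebra.ext (by simp) (by simp [h3])⟩
  · rw [sq, QuadraticAlgebra.algebraMap_eq]
    ext <;> simp
  · change star (_ : QuadraticAlgebra k d 0) = _
    ext <;> simp
  · intro h; simpa using congrArg QuadraticAlgebra.im h

theorem pell_infinite {k : Type} [Field k] [NumberField k] (I r2 : k) (hI : I ^ 2 = -1)
    (h2 : r2 ^ 2 = 2) (δ : 𝓞 k) : {q : 𝓞 k | ∃ p : 𝓞 k, p ^ 2 - δ * q ^ 2 = 1}.Infinite := by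
  by_cases hδ : δ = 0
  · have : {q : 𝓞 k | ∃ p : 𝓞 k, p ^ 2 - δ * q ^ 2 = 1} = Set.univ := by
      ext q; simp only [hδ, Set.mem_ofPred_eq, Set.mem_univ, iff_true]
      exact ⟨1, by simp⟩
    rw [this]
    exact Set.infinite_univ
  by_cases hsq : ∃ s : k, s ^ 2 = (δ : k)
  · obtain ⟨s0, hs0⟩ := hsq
    let s : 𝓞 k := ⟨s0, IsIntegral.of_pow (n := 2) (by norm_num) (by rw [hs0]; exact δ.2)⟩
    have hs : s ^ 2 = δ := RingOfIntegers.ext hs0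
    let r : 𝓞 k := ⟨r2, IsIntegral.of_pow (n := 2) (by norm_num) (by
      rw [h2]; rw [← map_ofNat (algebraMap ℤ k)]; exact isIntegral_algebraMap)⟩
    have hr : r ^ 2 = 2 := RingOfIntegers.ext h2
    let ε : (𝓞 k)ˣ := ⟨r + 1, r - 1, by linear_combination hr, by linear_combination hr⟩
    have hε : ¬ IsOfFinOrder ε := by
      intro hfin
      obtain ⟨n, hn, h1⟩ := isOfFinOrder_iff_pow_eq_one.mp hfin
      have h1' : (r + 1) ^ n = 1 := congrArg Units.val h1
      have h1'' : (r - 1) ^ n = 1 := by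
        have : ε⁻¹ ^ n = 1 := by rw [inv_pow, h1, inv_one]
        exact congrArg Units.val this
      obtain ⟨φ⟩ : Nonempty (k →+* ℂ) := inferInstance
      let ψ : 𝓞 k →+* ℂ := φ.comp (algebraMap (𝓞 k) k)
      have hψ : ψ r ^ 2 = 2 := by rw [← map_pow, hr, map_ofNat]
      have e1 : ‖ψ r + 1‖ = 1 := by
        have : (ψ r + 1) ^ n = 1 := by rw [← map_one ψ, ← map_add, ← map_pow, h1']
        exact (isOfFinOrder_iff_pow_eq_one.mpr ⟨n, hn, this⟩).norm_eq_one
      have e2 : ‖ψ r - 1‖ = 1 := by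
        have : (ψ r - 1) ^ n = 1 := by rw [← map_one ψ, ← map_sub, ← map_pow, h1'']
        exact (isOfFinOrder_iff_pow_eq_one.mpr ⟨n, hn, this⟩).norm_eq_one
      have e3 := parallelogram_law_with_norm ℝ (ψ r) 1
      have e4 : ‖ψ r‖ ^ 2 = 2 := by rw [← norm_pow, hψ]; simp
      rw [e1, e2] at e3
      simp at e3
      nlinarith
    have hsne : s ≠ 0 := by rintro h; rw [h] at hs; apply hδ; rw [← hs]; simp
    refine (pell_units s (finite_quot _ (by simpa using hsne)) ε hε).mono ?_
    rintro q ⟨p, n, hp, hq⟩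
    refine ⟨p, ?_⟩
    have e : ((ε ^ n : (𝓞 k)ˣ) : 𝓞 k) * ((ε⁻¹ ^ n : (𝓞 k)ˣ) : 𝓞 k) = 1 := by
      rw [← Units.val_mul, inv_pow, mul_inv_cancel, Units.val_one]
    have h4 : (4 : 𝓞 k) * (p ^ 2 - δ * q ^ 2) = 4 * 1 := by
      rw [← hs]
      linear_combination (2 * p + (ε ^ n : (𝓞 k)ˣ) + (ε⁻¹ ^ n : (𝓞 k)ˣ)) * hp
        - (2 * s * q + (ε ^ n : (𝓞 k)ˣ) - (ε⁻¹ ^ n : (𝓞 k)ˣ)) * hq + 4 * e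
    exact mul_left_cancel₀ (by norm_num) h4
  · obtain ⟨E, iF, iN, iA, σ, s0, hσ, hσk, hfix, hs0, hσs0, hs0ne⟩ := quad_exists (δ : k) hsq
    obtain ⟨ε, hε1, hε⟩ := exists_quad_unit σ hσ (algebraMap k E I) s0
      (by rw [← map_pow, hI, map_neg, map_one]) (hσk I) hs0ne hσs0
    have hδint : IsIntegral ℤ (algebraMap k E (δ : k)) := δ.2.algebraMap
    let s : 𝓞 E := ⟨s0, IsIntegral.of_pow (n := 2) (by norm_num) (by rw [hs0]; exact hδint)⟩
    have hsne : s ≠ 0 := fun h => hs0ne (congrArg Subtype.val h)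
    have hinf := pell_units s (finite_quot _ (by simpa using hsne)) ε hε
    have hσinv : σ (ε : E) = ((ε⁻¹ : (𝓞 E)ˣ) : E) := by
      have : ((ε⁻¹ : (𝓞 E)ˣ) : E) * (ε : E) = 1 := by
        rw [← map_mul, ← Units.val_mul, inv_mul_cancel, Units.val_one, map_one]
      exact mul_right_cancel₀ (fun h : (ε : E) = 0 => by rw [h, mul_zero] at hε1; exact zero_ne_one hε1) (hε1.trans this.symm)
    have hσinv' : σ ((ε⁻¹ : (𝓞 E)ˣ) : E) = (ε : E) := by rw [← hσinv, hσ]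
    have hinteg : ∀ y : k, IsIntegral ℤ (algebraMap k E y) → IsIntegral ℤ y := fun y hy =>
      (isIntegral_algebraMap_iff (algebraMap k E).injective).mp hy
    refine Set.Infinite.of_image (fun q : 𝓞 k => algebraMap k E (q : k)) ?_
    refine (hinf.image (f := fun x : 𝓞 E => (x : E)) (RingOfIntegers.coe_injective.injOn)).mono ?_
    rintro _ ⟨q, ⟨p, n, hp, hq⟩, rfl⟩
    have hp' : 2 * (p : E) = (ε : E) ^ n + ((ε⁻¹ : (𝓞 E)ˣ) : E) ^ n := by
      have := congrArg (algebraMap (𝓞 E) E) hp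
      rwa [map_mul, map_add, Units.val_pow_eq_pow_val, Units.val_pow_eq_pow_val, map_pow, map_pow,
        map_ofNat] at this
    have hq' : 2 * s0 * (q : E) = (ε : E) ^ n - ((ε⁻¹ : (𝓞 E)ˣ) : E) ^ n := by
      have := congrArg (algebraMap (𝓞 E) E) hq
      rwa [map_mul, map_mul, map_sub, Units.val_pow_eq_pow_val, Units.val_pow_eq_pow_val, map_pow,
        map_pow, map_ofNat] at this
    have hσp : σ (p : E) = p := by
      have := congrArg σ hp'
      rw [map_mul, map_add, map_pow, map_pow, hσinv, hσinv', map_ofNat, add_comm, ← hp'] at this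
      exact mul_left_cancel₀ two_ne_zero this
    have hσq : σ (q : E) = q := by
      have := congrArg σ hq'
      rw [map_mul, map_mul, map_sub, map_pow, map_pow, hσinv, hσinv', map_ofNat, hσs0] at this
      refine mul_left_cancel₀ (mul_ne_zero two_ne_zero hs0ne) ?_
      linear_combination -this - hq'
    obtain ⟨p1, hp1⟩ := hfix _ hσp
    obtain ⟨q1, hq1⟩ := hfix _ hσq
    let pO : 𝓞 k := ⟨p1, hinteg _ (by rw [← hp1]; exact p.2)⟩
    let qO : 𝓞 k := ⟨q1, hinteg _ (by rw [← hq1]; exact q.2)⟩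
    refine ⟨qO, ⟨pO, ?_⟩, hq1.symm⟩
    apply RingOfIntegers.ext
    apply (algebraMap k E).injective
    have e : (ε : E) ^ n * ((ε⁻¹ : (𝓞 E)ˣ) : E) ^ n = 1 := by
      rw [← mul_pow, ← map_mul, ← Units.val_mul, mul_inv_cancel, Units.val_one, map_one, one_pow]
    have h4 : (4 : E) * ((p : E) ^ 2 - s0 ^ 2 * (q : E) ^ 2) = 4 * 1 := by
      linear_combination (2 * (p : E) + (ε : E) ^ n + ((ε⁻¹ : (𝓞 E)ˣ) : E) ^ n) * hp'
        - (2 * s0 * (q : E) + (ε : E) ^ n - ((ε⁻¹ : (𝓞 E)ˣ) : E) ^ n) * hq' + 4 * e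
    have h5 := mul_left_cancel₀ (by norm_num) h4
    rw [hs0, hp1, hq1] at h5
    rw [← map_pow, ← map_pow, ← map_mul, ← map_sub] at h5
    exact h5.trans (map_one _).symm

end CubicLine
namespace CubicLine

lemma fin_quartic {A : Type*} [CommRing A] [IsDomain A] (u0 u1 u2 u4 : A)
    (h : ¬ (u0 = 0 ∧ u1 = 0 ∧ u2 = 0)) :
    {t : A | u0 + u1 * t + u2 * t ^ 2 + u4 * t ^ 4 = 0}.Finite := by
  let P : Polynomial A := Polynomial.C u0 + Polynomial.C u1 * Polynomial.X
    + Polynomial.C u2 * Polynomial.X ^ 2 + Polynomial.C u4 * Polynomial.X ^ 4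
  have hP : P ≠ 0 := by
    intro h0
    apply h
    have c0 := congrArg (fun Q => Polynomial.coeff Q 0) h0
    have c1 := congrArg (fun Q => Polynomial.coeff Q 1) h0
    have c2 := congrArg (fun Q => Polynomial.coeff Q 2) h0
    simp [P, Polynomial.coeff_X, Polynomial.coeff_C, Polynomial.coeff_X_pow] at c0 c1 c2
    exact ⟨c0, c1, c2⟩
  refine (Polynomial.finite_setOfPred_isRoot hP).subset fun t ht => ?_
  simpa [P, Polynomial.IsRoot.def] using ht

lemma fin_quad {A : Type*} [CommRing A] [IsDomain A] (u0 u1 u2 : A)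
    (h : ¬ (u0 = 0 ∧ u1 = 0 ∧ u2 = 0)) :
    {t : A | u0 + u1 * t + u2 * t ^ 2 = 0}.Finite := by
  simpa using fin_quartic u0 u1 u2 0 h

/-- The normal form of a cubic containing the line `z = w = 0`. -/
def nf {A : Type*} [CommRing A] (a b c d : Fin 3 → A) (e : Fin 4 → A) (h y z w : A) : A :=
  z * (a 0 * h ^ 2 + a 1 * h * y + a 2 * y ^ 2) + w * (b 0 * h ^ 2 + b 1 * h * y + b 2 * y ^ 2)
  + h * (c 0 * z ^ 2 + c 1 * z * w + c 2 * w ^ 2) + y * (d 0 * z ^ 2 + d 1 * z * w + d 2 * w ^ 2)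
  + (e 0 * z ^ 3 + e 1 * z ^ 2 * w + e 2 * z * w ^ 2 + e 3 * w ^ 3)

lemma core1 {A : Type*} [CommRing A] [IsDomain A] [CharZero A]
    (hpell : ∀ δ : A, {q : A | ∃ p : A, p ^ 2 - δ * q ^ 2 = 1}.Infinite)
    (a b c d : Fin 3 → A) (e : Fin 4 → A) (t m n : A)
    (hm : m = b 0 + b 1 * t + b 2 * t ^ 2) (hn : n = -(a 0 + a 1 * t + a 2 * t ^ 2))
    (hd : 2 * (a 2 * m + b 2 * n) * t + a 1 * m + b 1 * n ≠ 0) :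
    {r : A | ∃ y : A, nf a b c d e 1 y (m * r) (n * r) = 0}.Infinite := by
  set α := a 2 * m + b 2 * n with hα
  set β := d 0 * m ^ 2 + d 1 * m * n + d 2 * n ^ 2 with hβ
  set γ := e 0 * m ^ 3 + e 1 * m ^ 2 * n + e 2 * m * n ^ 2 + e 3 * n ^ 3 with hγ
  set d' := 2 * α * t + a 1 * m + b 1 * n with hd'
  set e' := c 0 * m ^ 2 + c 1 * m * n + c 2 * n ^ 2 + t * β with he'
  set δ := β ^ 2 - 4 * α * γ with hδ
  have hpt : ∀ Y r, nf a b c d e 1 (t + Y) (m * r) (n * r)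
      = r * (α * Y ^ 2 + β * Y * r + γ * r ^ 2 + d' * Y + e' * r) := by
    intro Y r
    have h0 : m * (a 0 + a 1 * t + a 2 * t ^ 2) + n * (b 0 + b 1 * t + b 2 * t ^ 2) = 0 := by
      rw [hm, hn]; ring
    rw [he', hd', hγ, hβ, hα]
    simp only [nf]
    linear_combination r * h0
  intro hfin
  apply hpell δ
  set κ := β * d' - 2 * α * e' with hκ
  have hfin2 : ∀ ρ : A, {q : A | (-ρ ^ 2) + 0 * q + (4 * d' ^ 2 + 4 * ρ * κ) * q ^ 2 +
      (4 * d' ^ 2 * δ - 4 * κ ^ 2) * q ^ 4 = 0}.Finite := fun ρ => by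
    apply fin_quartic
    rintro ⟨h1, -, h2⟩
    have hρ : ρ = 0 := by simpa using h1
    rw [hρ] at h2
    apply hd
    simpa using h2
  refine (hfin.biUnion (fun ρ _ => hfin2 ρ)).subset ?_
  rintro q ⟨p, hp⟩
  have hmem : 2 * q * (d' * p + κ * q) ∈
      {r : A | ∃ y : A, nf a b c d e 1 y (m * r) (n * r) = 0} := by
    refine ⟨t + -2 * q * ((p - β * q) * e' + 2 * γ * q * d'), ?_⟩
    rw [hpt]
    rw [mul_eq_zero]; right
    rw [hκ]
    rw [hδ] at hp
    linear_combination (4 * q ^ 2 * (α * e' ^ 2 - β * d' * e' + γ * d' ^ 2)) * hp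
  refine Set.mem_biUnion hmem ?_
  change _ = (0 : A)
  linear_combination (-4 * d' ^ 2 * q ^ 2) * hp

theorem core2 {k : Type*} {A : Type*} [CommRing A] [IsDomain A] [CharZero A] [Field k] [Algebra A k]
    (hinj : Function.Injective (algebraMap A k))
    (hpell : ∀ δ : A, {q : A | ∃ p : A, p ^ 2 - δ * q ^ 2 = 1}.Infinite)
    (a b c d : Fin 3 → A) (e : Fin 4 → A)
    (hind : ¬ (a 0 * b 1 = a 1 * b 0 ∧ a 0 * b 2 = a 2 * b 0 ∧ a 1 * b 2 = a 2 * b 1)) :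
    {s : k | {z : k | ∃ y z' w' : A, algebraMap A k z' = z ∧ algebraMap A k w' = s * z ∧
      nf a b c d e 1 y z' w' = 0}.Infinite}.Infinite := by
  let bt : A → A := fun t => b 0 + b 1 * t + b 2 * t ^ 2
  let at' : A → A := fun t => a 0 + a 1 * t + a 2 * t ^ 2
  have hfb : {t : A | bt t = 0}.Finite := fin_quad _ _ _ (by
    rintro ⟨h0, h1, h2⟩; apply hind; simp [h0, h1, h2])
  have hfd : {t : A | (a 1 * b 0 - a 0 * b 1) + (2 * (a 2 * b 0 - a 0 * b 2)) * t
      + (a 2 * b 1 - a 1 * b 2) * t ^ 2 = 0}.Finite := fin_quad _ _ _ (by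
    rintro ⟨h0, h1, h2⟩; apply hind
    have h1' := (mul_eq_zero.mp h1).resolve_left two_ne_zero
    exact ⟨by linear_combination -h0, by linear_combination -h1', by linear_combination -h2⟩)
  have hk : Function.Injective (algebraMap A k) := hinj
  have hfs : ∀ s : k, {t : A | algebraMap A k (at' t) + s * algebraMap A k (bt t) = 0}.Finite := by
    intro s
    have := fin_quad (algebraMap A k (a 0) + s * algebraMap A k (b 0))
      (algebraMap A k (a 1) + s * algebraMap A k (b 1))
      (algebraMap A k (a 2) + s * algebraMap A k (b 2)) (by
        rintro ⟨h0, h1, h2⟩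
        apply hind
        refine ⟨hk ?_, hk ?_, hk ?_⟩ <;> simp only [map_mul]
        · linear_combination algebraMap A k (b 1) * h0 - algebraMap A k (b 0) * h1
        · linear_combination algebraMap A k (b 2) * h0 - algebraMap A k (b 0) * h2
        · linear_combination algebraMap A k (b 2) * h1 - algebraMap A k (b 1) * h2)
    refine (this.preimage (f := algebraMap A k) hk.injOn).subset ?_
    intro t ht
    change algebraMap A k (at' t) + s * algebraMap A k (bt t) = 0 at ht
    change _ = (0 : k)
    rw [← ht]
    simp only [at', bt, map_add, map_mul, map_pow]
    ring
  intro hfin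
  apply Set.infinite_univ (α := A)
  refine ((hfb.union hfd).union (hfin.biUnion (fun s _ => hfs s))).subset ?_
  intro t _
  by_cases hb : bt t = 0
  · exact Or.inl (Or.inl hb)
  by_cases hd : (a 1 * b 0 - a 0 * b 1) + (2 * (a 2 * b 0 - a 0 * b 2)) * t
      + (a 2 * b 1 - a 1 * b 2) * t ^ 2 = 0
  · exact Or.inl (Or.inr hd)
  right
  have hbk : algebraMap A k (bt t) ≠ 0 := fun h => hb (hk (by rw [h, map_zero]))
  refine Set.mem_biUnion (x := - algebraMap A k (at' t) / algebraMap A k (bt t)) ?_ ?_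
  · have h1 := core1 hpell a b c d e t (bt t) (-at' t) rfl rfl (by
      intro h; apply hd; rw [← h]; simp only [bt, at']; ring)
    refine (h1.image (f := fun r => algebraMap A k (bt t * r)) ?_).mono ?_
    · intro r _ r' _ h
      exact mul_left_cancel₀ hb (hk h)
    · rintro _ ⟨r, ⟨y, hy⟩, rfl⟩
      refine ⟨y, bt t * r, -at' t * r, rfl, ?_, hy⟩
      simp only [map_mul, map_neg]
      field_simp
  · change _ + _ * _ = (0 : k)
    field_simp
    ring

end CubicLine
namespace CubicLine

lemma lin_form {k : Type*} [Field k] (H : MvPolynomial (Fin 4) k) (hH : H.IsHomogeneous 1) :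
    ∃ c : Fin 4 → k, H = ∑ i, C (c i) * X i := by
  have : H ∈ MvPolynomial.homogeneousSubmodule (Fin 4) k 1 := hH
  rw [homogeneousSubmodule_one_eq_span_X, Submodule.mem_span_range_iff_exists_fun] at this
  obtain ⟨c, hc⟩ := this
  exact ⟨c, by rw [← hc]; simp [MvPolynomial.smul_eq_C_mul]⟩

lemma polyEval_aeval {k Ω σ : Type*} [Field k] [Field Ω] [Algebra k Ω] (x : Ω)
    (y : σ → Polynomial Ω) (Q : MvPolynomial σ k) :
    Polynomial.eval x (aeval y Q) = aeval (fun i => Polynomial.eval x (y i)) Q := by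
  have h : ((Polynomial.aeval (R := Ω) x).restrictScalars k) (aeval y Q) =
      aeval (fun i => (Polynomial.aeval (R := Ω) x) (y i)) Q := by
    rw [← AlgHom.comp_apply, comp_aeval]; rfl
  simpa using h

lemma hom_zero {k Ω σ : Type*} [Field k] [Field Ω] [IsAlgClosed Ω] [Algebra k Ω]
    {Q : MvPolynomial σ k} {n : ℕ} (hQ : Q.IsHomogeneous n) (hn : n ≠ 0) (u v : σ → Ω) :
    ∃ a b : Ω, (a ≠ 0 ∨ b ≠ 0) ∧ aeval (fun i => a * u i + b * v i) Q = 0 := by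
  let f : Polynomial Ω := aeval (fun i => Polynomial.X * Polynomial.C (u i) + Polynomial.C (v i)) Q
  have hf : ∀ x, Polynomial.eval x f = aeval (fun i => x * u i + v i) Q := fun x => by
    rw [polyEval_aeval]; congr 2; funext i; simp; try ring
  by_cases hdeg : f.degree = 0
  · rw [Polynomial.eq_C_of_degree_eq_zero hdeg] at hf
    set c := f.coeff 0
    let g : Polynomial Ω := aeval (fun i => Polynomial.C (u i) + Polynomial.X * Polynomial.C (v i)) Q
    have hg : ∀ x, Polynomial.eval x g = aeval (fun i => u i + x * v i) Q := fun x => by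
      rw [polyEval_aeval]; congr 2; funext i; simp; try ring
    have : Infinite Ω := IsAlgClosed.instInfinite
    have hz : g - Polynomial.C c * Polynomial.X ^ n = 0 := by
      apply Polynomial.eq_zero_of_infinite_isRoot
      refine ((Set.finite_singleton (0 : Ω)).infinite_compl).mono ?_
      intro x hx
      have hx0 : x ≠ 0 := hx
      change Polynomial.IsRoot _ x
      rw [Polynomial.IsRoot.def]
      simp only [Polynomial.eval_sub, Polynomial.eval_mul, Polynomial.eval_C, Polynomial.eval_pow,
        Polynomial.eval_X]
      rw [hg]
      have h1 := aeval_smul_homog hQ x (fun i => x⁻¹ * u i + v i)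
      rw [← hf, Polynomial.eval_C] at h1
      have h2 : (fun i => x * (x⁻¹ * u i + v i)) = fun i => u i + x * v i := by
        funext i; field_simp
      rw [h2] at h1
      rw [h1]; ring
    refine ⟨1, 0, Or.inl one_ne_zero, ?_⟩
    have := congrArg (Polynomial.eval 0) hz
    simp only [Polynomial.eval_sub, Polynomial.eval_mul, Polynomial.eval_C, Polynomial.eval_pow,
        Polynomial.eval_X, zero_pow hn, mul_zero, sub_zero, Polynomial.eval_zero, hg] at this
    simpa using this
  · obtain ⟨x, hx⟩ := IsAlgClosed.exists_root f hdeg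
    rw [Polynomial.IsRoot.def, hf] at hx
    exact ⟨x, 1, Or.inr one_ne_zero, by simpa using hx⟩

/-- Top homogeneous components of a factorisation of a homogeneous polynomial. -/
lemma top_comp {k σ : Type*} [Field k] {F P Q : MvPolynomial σ k} {n : ℕ}
    (hF : F.IsHomogeneous n) (hPQ : F = P * Q) (hF0 : F ≠ 0) :
    P.totalDegree + Q.totalDegree = n ∧
    F = homogeneousComponent P.totalDegree P * homogeneousComponent Q.totalDegree Q := by
  have hP0 : P ≠ 0 := by rintro rfl; simp at hPQ; exact hF0 hPQ
  have hQ0 : Q ≠ 0 := by rintro rfl; simp at hPQ; exact hF0 hPQ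
  have hdeg : P.totalDegree + Q.totalDegree = n := by
    rw [← totalDegree_mul_of_isDomain hP0 hQ0, ← hPQ, hF.totalDegree hF0]
  refine ⟨hdeg, ?_⟩
  let ψ : MvPolynomial σ k →ₐ[k] Polynomial (MvPolynomial σ k) :=
    aeval (fun i => Polynomial.X * Polynomial.C (X i))
  have hC : ∀ G : MvPolynomial σ k, aeval (fun i => Polynomial.C (X i : MvPolynomial σ k)) G
      = Polynomial.C G := by
    intro G
    have := aeval_algebraMap_apply (Polynomial (MvPolynomial σ k)) (X : σ → MvPolynomial σ k) G
    rw [aeval_X_left_apply] at this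
    exact this
  have hψ : ∀ (G : MvPolynomial σ k) (m : ℕ), G.IsHomogeneous m →
      ψ G = Polynomial.X ^ m * Polynomial.C G := by
    intro G m hG
    have := aeval_smul_homog hG Polynomial.X (fun i => Polynomial.C (X i : MvPolynomial σ k))
    rw [hC] at this
    exact this
  have hψ2 : ∀ G : MvPolynomial σ k, (ψ G).natDegree ≤ G.totalDegree ∧
      (ψ G).coeff G.totalDegree = homogeneousComponent G.totalDegree G := by
    intro G
    have h1 : ψ G = ∑ j ∈ Finset.range (G.totalDegree + 1),
        Polynomial.C (homogeneousComponent j G) * Polynomial.X ^ j := by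
      conv_lhs => rw [← sum_homogeneousComponent G]
      rw [map_sum]
      refine Finset.sum_congr rfl fun j _ => ?_
      rw [hψ _ _ (homogeneousComponent_isHomogeneous j G), mul_comm]
    rw [h1]
    constructor
    · apply Polynomial.natDegree_sum_le_of_forall_le
      intro j hj
      refine (Polynomial.natDegree_C_mul_X_pow_le _ _).trans ?_
      have := Finset.mem_range.mp hj; omega
    · simp [Polynomial.coeff_C_mul, Polynomial.coeff_X_pow]
  have h1 := congrArg (fun p => Polynomial.coeff (ψ p) (P.totalDegree + Q.totalDegree)) hPQ
  rw [map_mul, Polynomial.coeff_mul_add_eq_of_natDegree_le (hψ2 P).1 (hψ2 Q).1, (hψ2 P).2, (hψ2 Q).2,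
    hψ F n hF, hdeg, mul_comm, Polynomial.coeff_C_mul, Polynomial.coeff_X_pow, if_pos rfl,
    mul_one] at h1
  exact h1

lemma no_lin_quad {k Ω : Type*} [Field k] [Field Ω] [IsAlgClosed Ω] [Algebra k Ω]
    {F P Q : MvPolynomial (Fin 4) k} (hP : P.IsHomogeneous 1) (hQ : Q.IsHomogeneous 2)
    (hF : F = P * Q)
    (hsm : ∀ a : Fin 4 → Ω, a ≠ 0 → ¬ (aeval a F = 0 ∧ ∀ i : Fin 4, aeval a (pderiv i F) = 0)) :
    False := by
  obtain ⟨c, hc⟩ := lin_form P hP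
  have hlin : ∀ x : Fin 4 → Ω, aeval x P = ∑ i, algebraMap k Ω (c i) * x i := fun x => by
    rw [hc]; simp
  obtain ⟨a, b, hab, h1⟩ := hom_zero (Ω := Ω) hP one_ne_zero ![1, 0, 0, 0] ![0, 1, 0, 0]
  obtain ⟨a', b', hab', h2⟩ := hom_zero (Ω := Ω) hP one_ne_zero ![0, 0, 1, 0] ![0, 0, 0, 1]
  obtain ⟨l, m, hlm, h3⟩ := hom_zero (Ω := Ω) hQ two_ne_zero ![a, b, 0, 0] ![0, 0, a', b']
  rw [hlin] at h1 h2
  simp [Fin.sum_univ_four] at h1 h2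
  set x : Fin 4 → Ω := fun i => l * (![a, b, 0, 0] : Fin 4 → Ω) i + m * (![0, 0, a', b'] : Fin 4 → Ω) i
    with hx
  have hPx : aeval x P = 0 := by
    rw [hlin]
    simp [Fin.sum_univ_four, hx]
    linear_combination l * h1 + m * h2
  refine hsm x ?_ ⟨by rw [hF, map_mul, hPx, zero_mul], fun i => ?_⟩
  · intro h0
    have e0 := congrFun h0 0
    have e1 := congrFun h0 1
    have e2 := congrFun h0 2
    have e3 := congrFun h0 3
    simp [hx] at e0 e1 e2 e3
    grind
  · rw [hF, Derivation.leibniz, map_add, smul_eq_mul, smul_eq_mul, map_mul, map_mul, hPx, h3]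
    simp

theorem irred {k Ω : Type*} [Field k] [Field Ω] [IsAlgClosed Ω] [Algebra k Ω]
    {F : MvPolynomial (Fin 4) k} (hF : F.IsHomogeneous 3)
    (hsm : ∀ a : Fin 4 → Ω, a ≠ 0 → ¬ (aeval a F = 0 ∧ ∀ i : Fin 4, aeval a (pderiv i F) = 0)) :
    Irreducible F := by
  have hF0 : F ≠ 0 := by
    rintro rfl
    exact hsm (fun _ => 1) (fun h => one_ne_zero (congrFun h 0)) (by simp)
  have hunit : ∀ P : MvPolynomial (Fin 4) k, P ≠ 0 → P.totalDegree = 0 → IsUnit P := by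
    intro P h0 h
    rw [totalDegree_eq_zero_iff_eq_C] at h
    rw [h]
    refine (isUnit_iff_ne_zero.mpr ?_).map C
    intro hc; rw [hc] at h; simp at h; exact h0 h
  constructor
  · intro hu
    have := MvPolynomial.isUnit_iff_totalDegree_of_isReduced.mp hu
    rw [hF.totalDegree hF0] at this
    simp at this
  · intro P Q hPQ
    by_contra hcon
    push Not at hcon
    obtain ⟨hdeg, htop⟩ := top_comp hF hPQ hF0
    have hP0 : P ≠ 0 := by rintro rfl; simp at hPQ; exact hF0 hPQ
    have hQ0 : Q ≠ 0 := by rintro rfl; simp at hPQ; exact hF0 hPQ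
    have h1 : P.totalDegree ≠ 0 := fun h => hcon.1 (hunit P hP0 h)
    have h2 : Q.totalDegree ≠ 0 := fun h => hcon.2 (hunit Q hQ0 h)
    have hP := homogeneousComponent_isHomogeneous P.totalDegree P
    have hQ := homogeneousComponent_isHomogeneous Q.totalDegree Q
    obtain h | h : (P.totalDegree = 1 ∧ Q.totalDegree = 2) ∨
        (P.totalDegree = 2 ∧ Q.totalDegree = 1) := by omega
    · rw [h.1, h.2] at htop; rw [h.1] at hP; rw [h.2] at hQ
      exact no_lin_quad hP hQ htop hsm
    · rw [h.1, h.2] at htop; rw [h.1] at hP; rw [h.2] at hQ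
      exact no_lin_quad hQ hP (htop.trans (mul_comm _ _)) hsm

end CubicLine
namespace CubicLine

lemma elim_poly {R : Type*} [CommRing R] [IsDomain R] (F G : Polynomial R) (hF : Prime F)
    (hFG : ¬ F ∣ G) : ∃ (c : R) (A B : Polynomial R), c ≠ 0 ∧ Polynomial.C c = A * F + B * G := by
  have : IsDomain (AdjoinRoot F) := AdjoinRoot.isDomain_of_prime hF
  have halg : IsAlgebraic R (AdjoinRoot.root F) := ⟨F, hF.ne_zero, by simp⟩
  have hall : ∀ p : Polynomial R, IsAlgebraic R (AdjoinRoot.mk F p) := by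
    intro p
    induction p using Polynomial.induction_on' with
    | add p q hp hq => rw [map_add]; exact hp.add hq
    | monomial n a =>
      rw [← Polynomial.C_mul_X_pow_eq_monomial, map_mul, map_pow, AdjoinRoot.mk_X, AdjoinRoot.mk_C]
      exact (isAlgebraic_algebraMap a).mul (halg.pow n)
  have hne : AdjoinRoot.mk F G ≠ 0 := by rwa [Ne, AdjoinRoot.mk_eq_zero]
  obtain ⟨c, hc, b, hb⟩ := (hall G).exists_nonzero_dvd (mem_nonZeroDivisors_of_ne_zero hne)
  obtain ⟨B, rfl⟩ := AdjoinRoot.mk_surjective b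
  have h1 : AdjoinRoot.mk F (Polynomial.C c - B * G) = 0 := by
    rw [map_sub, map_mul, mul_comm, ← hb, AdjoinRoot.mk_C]
    exact sub_self _
  rw [AdjoinRoot.mk_eq_zero] at h1
  obtain ⟨A, hA⟩ := h1
  exact ⟨c, A, B, hc, by linear_combination hA⟩

lemma density {k : Type*} [Field k] [Infinite k] (F G : MvPolynomial (Fin 4) k) (hF : Prime F)
    (hFG : ¬ F ∣ G) {m n : ℕ} (hFh : F.IsHomogeneous m) (hGh : G.IsHomogeneous n)
    (hS : {s : k | {z : k | ∃ y : k, eval ![y, 1, z, s * z] F = 0 ∧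
      eval ![y, 1, z, s * z] G = 0}.Infinite}.Infinite) : False := by
  let e := MvPolynomial.finSuccEquiv k 3
  obtain ⟨c, A, B, hc, hcAB⟩ := elim_poly (e F) (e G) ((MulEquiv.prime_iff e).mpr hF)
    (by rwa [map_dvd_iff])
  have h1 : ∀ (y : k) (x : Fin 3 → k), eval (Fin.cons y x : Fin 4 → k) F = 0 →
      eval (Fin.cons y x : Fin 4 → k) G = 0 → eval x c = 0 := by
    intro y x hFx hGx
    rw [eval_eq_eval_mv_eval'] at hFx hGx
    have := congrArg (fun p => Polynomial.eval y (Polynomial.map (eval x) p)) hcAB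
    simp only [Polynomial.map_C, Polynomial.eval_C, Polynomial.map_add, Polynomial.map_mul,
      Polynomial.eval_add, Polynomial.eval_mul] at this
    rw [this]
    change _ * Polynomial.eval y (Polynomial.map (eval x) (finSuccEquiv k 3 F)) +
      _ * Polynomial.eval y (Polynomial.map (eval x) (finSuccEquiv k 3 G)) = 0
    rw [hFx, hGx]; simp
  -- homogeneity
  have hhom : ∀ {Q : MvPolynomial (Fin 4) k} {n : ℕ}, Q.IsHomogeneous n → ∀ (l : k) (x : Fin 4 → k),
      eval x Q = 0 → eval (fun i => l * x i) Q = 0 := by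
    intro Q n hQ l x hx
    have := aeval_smul_homog hQ l x
    rw [aeval_eq_eval] at this
    have h2 : eval (fun i => l * x i) Q = l ^ n * eval x Q := this
    rw [h2, hx, mul_zero]
  have h2 : ∀ (l s : k), s ∈ {s : k | {z : k | ∃ y : k, eval ![y, 1, z, s * z] F = 0 ∧
      eval ![y, 1, z, s * z] G = 0}.Infinite} → ∀ z, eval ![l, l * z, l * (s * z)] c = 0 := by
    intro l s hs z
    let f : Polynomial k := aeval ![Polynomial.C l, Polynomial.C l * Polynomial.X,
      Polynomial.C l * (Polynomial.C s * Polynomial.X)] c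
    have hf : ∀ z, Polynomial.eval z f = eval ![l, l * z, l * (s * z)] c := by
      intro z
      rw [polyEval_aeval, aeval_eq_eval]
      change eval _ c = _
      congr 2
      funext i; fin_cases i <;> simp
    rw [← hf]
    have : f = 0 := by
      apply Polynomial.eq_zero_of_infinite_isRoot
      refine Set.Infinite.mono ?_ hs
      rintro z ⟨y, hy1, hy2⟩
      change Polynomial.IsRoot _ _
      rw [Polynomial.IsRoot.def, hf]
      have e1 : (fun i => l * (![y, 1, z, s * z] : Fin 4 → k) i) =
          (Fin.cons (l * y) ![l, l * z, l * (s * z)] : Fin 4 → k) := by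
        funext i; fin_cases i <;> simp
      refine h1 (l * y) _ ?_ ?_
      · rw [← e1]; exact hhom hFh l _ hy1
      · rw [← e1]; exact hhom hGh l _ hy2
    rw [this, Polynomial.eval_zero]
  have h3 : ∀ l s z : k, eval ![l, l * z, l * (s * z)] c = 0 := by
    intro l s z
    let f : Polynomial k := aeval ![Polynomial.C l, Polynomial.C (l * z),
      Polynomial.C l * (Polynomial.X * Polynomial.C z)] c
    have hf : ∀ s, Polynomial.eval s f = eval ![l, l * z, l * (s * z)] c := by
      intro s
      rw [polyEval_aeval, aeval_eq_eval]
      change eval _ c = _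
      congr 2
      funext i; fin_cases i <;> simp <;> exact Or.inl (mul_comm _ _)
    rw [← hf]
    have : f = 0 := by
      apply Polynomial.eq_zero_of_infinite_isRoot
      refine Set.Infinite.mono ?_ hS
      intro s hs
      change Polynomial.IsRoot _ _
      rw [Polynomial.IsRoot.def, hf]
      exact h2 l s hs z
    rw [this, Polynomial.eval_zero]
  have h4 : X 0 * X 1 * c = 0 := by
    apply MvPolynomial.funext
    intro x
    rw [map_mul, map_mul, eval_X, eval_X, map_zero]
    by_cases hx0 : x 0 = 0
    · rw [hx0]; simp
    by_cases hx1 : x 1 = 0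
    · rw [hx1]; simp
    have := h3 (x 0) (x 2 / x 1) (x 1 / x 0)
    have e1 : ![x 0, x 0 * (x 1 / x 0), x 0 * (x 2 / x 1 * (x 1 / x 0))] = x := by
      funext i; fin_cases i <;> simp <;> field_simp
    rw [e1] at this
    rw [this, mul_zero]
  have h5 := (mul_eq_zero.mp h4).resolve_left (mul_ne_zero (X_ne_zero _) (X_ne_zero _))
  exact hc h5

end CubicLine
namespace CubicLine

/-- directional derivative of the cubic at `a` in direction `v` -/
def dtri {A : Type*} [CommRing A] (T : Fin 4 → Fin 4 → Fin 4 → A) (a v : Fin 4 → A) : A :=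
  tri T v a a + tri T a v a + tri T a a v

/-- the full polarisation -/
def ptri {A : Type*} [CommRing A] (T : Fin 4 → Fin 4 → Fin 4 → A) (x y z : Fin 4 → A) : A :=
  tri T x y z + tri T x z y + tri T y x z + tri T y z x + tri T z x y + tri T z y x

section
variable {A : Type*} [CommRing A] (T : Fin 4 → Fin 4 → Fin 4 → A)

lemma dtri_add (a v w : Fin 4 → A) : dtri T a (v + w) = dtri T a v + dtri T a w := by
  simp only [dtri, tri_add1, tri_add2, tri_add3]; ring
lemma dtri_smul (a v : Fin 4 → A) (t : A) : dtri T a (t • v) = t * dtri T a v := by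
  simp only [dtri, tri_smul1, tri_smul2, tri_smul3]; ring

lemma tri_expand2 (s t : A) (p q : Fin 4 → A) :
    tri T (s • p + t • q) (s • p + t • q) (s • p + t • q) =
      s ^ 3 * tri T p p p + s ^ 2 * t * dtri T p q + s * t ^ 2 * dtri T q p
        + t ^ 3 * tri T q q q := by
  simp only [dtri, tri_add1, tri_add2, tri_add3, tri_smul1, tri_smul2, tri_smul3]; ring

lemma dtri_expand (s t : A) (p q v : Fin 4 → A) :
    dtri T (s • p + t • q) v = s ^ 2 * dtri T p v + s * t * ptri T p q v + t ^ 2 * dtri T q v := by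
  simp only [dtri, ptri, tri_add1, tri_add2, tri_add3, tri_smul1, tri_smul2, tri_smul3]; ring

lemma dtri_line (s t s' t' : A) (p q : Fin 4 → A) :
    dtri T (s • p + t • q) (s' • p + t' • q) =
      3 * s ^ 2 * s' * tri T p p p + (s ^ 2 * t' + 2 * s * t * s') * dtri T p q +
      (t ^ 2 * s' + 2 * s * t * t') * dtri T q p + 3 * t ^ 2 * t' * tri T q q q := by
  simp only [dtri, tri_add1, tri_add2, tri_add3, tri_smul1, tri_smul2, tri_smul3]; ring

set_option maxHeartbeats 1000000 in
lemma tri_expand4 (y h z w : A) (e0 e1 e2 e3 : Fin 4 → A)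
    (h0 : tri T e0 e0 e0 = 0) (h1 : tri T e1 e1 e1 = 0)
    (h01 : dtri T e0 e1 = 0) (h10 : dtri T e1 e0 = 0) :
    tri T (y • e0 + h • e1 + z • e2 + w • e3) (y • e0 + h • e1 + z • e2 + w • e3)
      (y • e0 + h • e1 + z • e2 + w • e3) =
    nf ![dtri T e1 e2, ptri T e0 e1 e2, dtri T e0 e2] ![dtri T e1 e3, ptri T e0 e1 e3, dtri T e0 e3]
      ![dtri T e2 e1, ptri T e1 e2 e3, dtri T e3 e1] ![dtri T e2 e0, ptri T e0 e2 e3, dtri T e3 e0]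
      ![tri T e2 e2 e2, dtri T e2 e3, dtri T e3 e2, tri T e3 e3 e3] h y z w := by
  have : tri T (y • e0 + h • e1 + z • e2 + w • e3) (y • e0 + h • e1 + z • e2 + w • e3)
      (y • e0 + h • e1 + z • e2 + w • e3) = y ^ 3 * tri T e0 e0 e0 + h ^ 3 * tri T e1 e1 e1
      + y ^ 2 * h * dtri T e0 e1 + y * h ^ 2 * dtri T e1 e0 +
    nf ![dtri T e1 e2, ptri T e0 e1 e2, dtri T e0 e2] ![dtri T e1 e3, ptri T e0 e1 e3, dtri T e0 e3]
      ![dtri T e2 e1, ptri T e1 e2 e3, dtri T e3 e1] ![dtri T e2 e0, ptri T e0 e2 e3, dtri T e3 e0]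
      ![tri T e2 e2 e2, dtri T e2 e3, dtri T e3 e2, tri T e3 e3 e3] h y z w := by
    simp only [nf, dtri, ptri, tri_add1, tri_add2, tri_add3, tri_smul1, tri_smul2, tri_smul3]
    simp only [Matrix.cons_val]
    ring
  rw [this, h0, h1, h01, h10]; ring
end

lemma quad_zero {Ω : Type*} [Field Ω] [IsAlgClosed Ω] (A B C : Ω) :
    ∃ s t : Ω, (s ≠ 0 ∨ t ≠ 0) ∧ s ^ 2 * A + s * t * B + t ^ 2 * C = 0 := by
  by_cases hA : A = 0
  · exact ⟨1, 0, by simp, by simp [hA]⟩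
  · have hd : (Polynomial.C A * Polynomial.X ^ 2 + Polynomial.C B * Polynomial.X +
      Polynomial.C C).degree ≠ 0 := by
      rw [Polynomial.degree_quadratic hA]; decide
    obtain ⟨x, hx⟩ := IsAlgClosed.exists_root _ hd
    refine ⟨x, 1, by simp, ?_⟩
    simp [Polynomial.IsRoot.def] at hx
    linear_combination hx

lemma quad_zero2 {Ω : Type*} [Field Ω] [IsAlgClosed Ω] (a b : Fin 3 → Ω)
    (h : a 0 * b 1 = a 1 * b 0 ∧ a 0 * b 2 = a 2 * b 0 ∧ a 1 * b 2 = a 2 * b 1) :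
    ∃ s t : Ω, (s ≠ 0 ∨ t ≠ 0) ∧ s ^ 2 * a 0 + s * t * a 1 + t ^ 2 * a 2 = 0 ∧
      s ^ 2 * b 0 + s * t * b 1 + t ^ 2 * b 2 = 0 := by
  obtain ⟨h1, h2, h3⟩ := h
  by_cases ha : a 0 = 0 ∧ a 1 = 0 ∧ a 2 = 0
  · obtain ⟨s, t, hst, e⟩ := quad_zero (b 0) (b 1) (b 2)
    exact ⟨s, t, hst, by rw [ha.1, ha.2.1, ha.2.2]; ring, e⟩
  · obtain ⟨s, t, hst, e⟩ := quad_zero (a 0) (a 1) (a 2)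
    refine ⟨s, t, hst, e, ?_⟩
    by_cases a0 : a 0 = 0
    · by_cases a1 : a 1 = 0
      · have a2 : a 2 ≠ 0 := fun h => ha ⟨a0, a1, h⟩
        apply mul_left_cancel₀ a2
        rw [mul_zero]
        linear_combination b 2 * e - s ^ 2 * h2 - s * t * h3
      · apply mul_left_cancel₀ a1
        rw [mul_zero]
        linear_combination b 1 * e - s ^ 2 * h1 + t ^ 2 * h3
    · apply mul_left_cancel₀ a0
      rw [mul_zero]
      linear_combination b 0 * e + s * t * h1 + t ^ 2 * h2

/-- pairing of a covector and a vector -/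
def pair {A : Type*} [CommRing A] (c v : Fin 4 → A) : A := ∑ i, c i * v i

section
variable {A : Type*} [CommRing A] (c : Fin 4 → A)
lemma pair_add (v w : Fin 4 → A) : pair c (v + w) = pair c v + pair c w := by
  simp [pair, mul_add, Finset.sum_add_distrib]
lemma pair_sub (v w : Fin 4 → A) : pair c (v - w) = pair c v - pair c w := by
  simp [pair, mul_sub, Finset.sum_sub_distrib]
lemma pair_smul (t : A) (v : Fin 4 → A) : pair c (t • v) = t * pair c v := by
  simp only [pair, Finset.mul_sum, Pi.smul_apply, smul_eq_mul]
  exact Finset.sum_congr rfl fun i _ => by ring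
lemma pair_single (k : Fin 4) : pair c (Pi.single k 1) = c k := by
  simp [pair, Pi.single_apply]
end

lemma exists_perm (i j : Fin 4) (h : i ≠ j) : ∃ σ : Equiv.Perm (Fin 4), σ 0 = i ∧ σ 1 = j := by
  revert i j; decide

lemma decomp {Ω : Type*} [Field Ω] (p q : Fin 4 → Ω) (σ : Equiv.Perm (Fin 4))
    (hp0 : p (σ 0) = 1) (hp1 : p (σ 1) = 0) (hq0 : q (σ 0) = 0) (hq1 : q (σ 1) = 1)
    (v : Fin 4 → Ω) : ∃ s t m n : Ω,
      v = s • p + t • q + m • Pi.single (σ 2) 1 + n • Pi.single (σ 3) 1 := by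
  refine ⟨v (σ 0), v (σ 1), v (σ 2) - v (σ 0) * p (σ 2) - v (σ 1) * q (σ 2),
    v (σ 3) - v (σ 0) * p (σ 3) - v (σ 1) * q (σ 3), ?_⟩
  funext x
  obtain ⟨x, rfl⟩ := σ.surjective x
  fin_cases x <;> simp [Pi.single_apply, hp0, hp1, hq0, hq1]

lemma geom_basis {Ω : Type*} [Field Ω] (c p q : Fin 4 → Ω) (i j : Fin 4)
    (hpi : p i = 1) (hpj : p j = 0) (hqi : q i = 0) (hqj : q j = 1) (hα : pair c p ≠ 0) :
    ∃ e : Fin 4 → Fin 4 → Ω, pair c (e 0) = 0 ∧ pair c (e 1) = 1 ∧ pair c (e 2) = 0 ∧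
      pair c (e 3) = 0 ∧ (∃ s t : Ω, e 0 = s • p + t • q) ∧ (∃ s t : Ω, e 1 = s • p + t • q) ∧
      ∀ v, ∃ t : Fin 4 → Ω, v = t 0 • e 0 + t 1 • e 1 + t 2 • e 2 + t 3 • e 3 := by
  have hij : i ≠ j := by rintro rfl; rw [hpi] at hpj; exact one_ne_zero hpj
  obtain ⟨σ, rfl, rfl⟩ := exists_perm i j hij
  set α := pair c p with hαd
  set β := pair c q with hβd
  have h1 : pair c (α⁻¹ • p) = 1 := by rw [pair_smul, ← hαd, inv_mul_cancel₀ hα]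
  refine ⟨![β • p - α • q, α⁻¹ • p, Pi.single (σ 2) 1 - c (σ 2) • (α⁻¹ • p),
    Pi.single (σ 3) 1 - c (σ 3) • (α⁻¹ • p)], ?_, ?_, ?_, ?_, ?_, ?_, ?_⟩
  · simp only [Matrix.cons_val]; rw [pair_sub, pair_smul, pair_smul, ← hαd, ← hβd]; ring
  · simpa only [Matrix.cons_val] using h1
  · simp only [Matrix.cons_val]; rw [pair_sub, pair_smul, h1, pair_single]; ring
  · simp only [Matrix.cons_val]; rw [pair_sub, pair_smul, h1, pair_single]; ring
  · exact ⟨β, -α, by simp only [Matrix.cons_val]; module⟩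
  · exact ⟨α⁻¹, 0, by simp only [Matrix.cons_val]; module⟩
  · intro v
    obtain ⟨s, t, m, n, rfl⟩ := decomp p q σ hpi hpj hqi hqj v
    refine ⟨![-α⁻¹ * t, α * s + β * t + m * c (σ 2) + n * c (σ 3), m, n], ?_⟩
    simp only [Matrix.cons_val]
    funext x
    simp
    field_simp
    ring

theorem geom {Ω : Type*} [Field Ω] [IsAlgClosed Ω] [CharZero Ω]
    (T : Fin 4 → Fin 4 → Fin 4 → Ω) (c : Fin 4 → Ω) (hc : c ≠ 0)
    (hX : ∀ a, a ≠ 0 → ¬ (tri T a a a = 0 ∧ ∀ v, dtri T a v = 0))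
    (hD : ∀ a, a ≠ 0 → tri T a a a = 0 → pair c a = 0 → ∃ v, pair c v = 0 ∧ dtri T a v ≠ 0) :
    ∃ e : Fin 4 → Fin 4 → Ω, pair c (e 0) = 0 ∧ pair c (e 1) = 1 ∧ pair c (e 2) = 0 ∧
      pair c (e 3) = 0 ∧ (∀ v, ∃ t : Fin 4 → Ω, v = ∑ i, t i • e i) ∧
      tri T (e 0) (e 0) (e 0) = 0 ∧ tri T (e 1) (e 1) (e 1) = 0 ∧
      dtri T (e 0) (e 1) = 0 ∧ dtri T (e 1) (e 0) = 0 ∧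
      ¬ (dtri T (e 1) (e 2) * ptri T (e 0) (e 1) (e 3) = ptri T (e 0) (e 1) (e 2) * dtri T (e 1) (e 3)
       ∧ dtri T (e 1) (e 2) * dtri T (e 0) (e 3) = dtri T (e 0) (e 2) * dtri T (e 1) (e 3)
       ∧ ptri T (e 0) (e 1) (e 2) * dtri T (e 0) (e 3) =
          dtri T (e 0) (e 2) * ptri T (e 0) (e 1) (e 3)) := by
  obtain ⟨p, q, i, j, hpi, hpj, hqi, hqj, hline⟩ := exists_line T
  have hij : i ≠ j := by rintro rfl; rw [hpi] at hpj; exact one_ne_zero hpj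
  have two : (2 : Ω) ≠ 0 := two_ne_zero
  have hp : tri T p p p = 0 := by
    have := hline 1 0; rw [tri_expand2] at this; linear_combination this
  have hq : tri T q q q = 0 := by
    have := hline 0 1; rw [tri_expand2] at this; linear_combination this
  have hpq : dtri T p q = 0 := by
    have h1 := hline 1 1; have h2 := hline 1 (-1)
    rw [tri_expand2, hp, hq] at h1 h2
    apply mul_left_cancel₀ two; linear_combination h1 - h2
  have hqp : dtri T q p = 0 := by
    have h1 := hline 1 1; have h2 := hline 1 (-1)
    rw [tri_expand2, hp, hq] at h1 h2
    apply mul_left_cancel₀ two; linear_combination h1 + h2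
  have hdl : ∀ s t s' t' : Ω, dtri T (s • p + t • q) (s' • p + t' • q) = 0 := by
    intro s t s' t'; rw [dtri_line, hp, hq, hpq, hqp]; ring
  have hne : ∀ s t : Ω, (s ≠ 0 ∨ t ≠ 0) → s • p + t • q ≠ 0 := by
    intro s t h h0
    have h1 := congrFun h0 i
    have h2 := congrFun h0 j
    simp [hpi, hpj, hqi, hqj] at h1 h2
    tauto
  have hnot : ¬ (pair c p = 0 ∧ pair c q = 0) := by
    rintro ⟨h1, h2⟩
    obtain ⟨σ, rfl, rfl⟩ := exists_perm i j hij
    set u : Fin 4 → Ω := c (σ 3) • Pi.single (σ 2) 1 - c (σ 2) • Pi.single (σ 3) 1 with hu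
    obtain ⟨s, t, hst, hz⟩ := quad_zero (dtri T p u) (ptri T p q u) (dtri T q u)
    rw [← dtri_expand] at hz
    obtain ⟨v, hv, hne'⟩ := hD _ (hne s t hst) (hline s t)
      (by rw [pair_add, pair_smul, pair_smul, h1, h2]; ring)
    apply hne'
    obtain ⟨s', t', m, n, rfl⟩ := decomp p q σ hpi hpj hqi hqj v
    rw [pair_add, pair_add, pair_add, pair_smul, pair_smul, pair_smul, pair_smul, pair_single,
      pair_single, h1, h2] at hv
    have hmn : ∃ r : Ω, m • Pi.single (σ 2) 1 + n • Pi.single (σ 3) 1 = r • u := by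
      by_cases h3 : c (σ 3) = 0
      · by_cases h4 : c (σ 2) = 0
        · exfalso
          apply hc
          have e1 : pair c p = c (σ 0) := by
            rw [pair, ← Equiv.sum_comp σ, Fin.sum_univ_four, hpi, hpj, h3, h4]; ring
          have e2 : pair c q = c (σ 1) := by
            rw [pair, ← Equiv.sum_comp σ, Fin.sum_univ_four, hqi, hqj, h3, h4]; ring
          funext x
          obtain ⟨x, rfl⟩ := σ.surjective x
          fin_cases x
          · simpa [h1] using e1.symm
          · simpa [h2] using e2.symm
          · simpa using h4
          · simpa using h3
        · have hm : m = 0 := by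
            apply mul_left_cancel₀ h4; rw [h3] at hv; linear_combination hv
          refine ⟨- n / c (σ 2), ?_⟩
          rw [hu, h3, hm]
          funext x; simp; field_simp
      · refine ⟨m / c (σ 3), ?_⟩
        have hn : n = - m * c (σ 2) / c (σ 3) := by
          field_simp; linear_combination hv
        rw [hu, hn]
        funext x; simp; field_simp; ring
    obtain ⟨r, hr⟩ := hmn
    rw [add_assoc, hr, dtri_add, hdl, dtri_smul, hz]; ring
  have hbasis : ∃ e : Fin 4 → Fin 4 → Ω, pair c (e 0) = 0 ∧ pair c (e 1) = 1 ∧ pair c (e 2) = 0 ∧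
      pair c (e 3) = 0 ∧ (∃ s t : Ω, e 0 = s • p + t • q) ∧ (∃ s t : Ω, e 1 = s • p + t • q) ∧
      ∀ v, ∃ t : Fin 4 → Ω, v = t 0 • e 0 + t 1 • e 1 + t 2 • e 2 + t 3 • e 3 := by
    by_cases h : pair c p = 0
    · have h' : pair c q ≠ 0 := fun h' => hnot ⟨h, h'⟩
      obtain ⟨e, a1, a2, a3, a4, ⟨s, t, a5⟩, ⟨s', t', a6⟩, a7⟩ :=
        geom_basis c q p j i hqj hqi hpj hpi h'
      exact ⟨e, a1, a2, a3, a4, ⟨t, s, by rw [a5, add_comm]⟩, ⟨t', s', by rw [a6, add_comm]⟩, a7⟩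
    · exact geom_basis c p q i j hpi hpj hqi hqj h
  obtain ⟨e, a1, a2, a3, a4, ⟨s0, t0, a5⟩, ⟨s1, t1, a6⟩, a7⟩ := hbasis
  refine ⟨e, a1, a2, a3, a4, ?_, ?_, ?_, ?_, ?_, ?_⟩
  · intro v
    obtain ⟨t, ht⟩ := a7 v
    exact ⟨t, by rw [Fin.sum_univ_four]; exact ht⟩
  · rw [a5]; exact hline _ _
  · rw [a6]; exact hline _ _
  · rw [a5, a6]; exact hdl _ _ _ _
  · rw [a5, a6]; exact hdl _ _ _ _
  · intro hmin
    obtain ⟨s, t, hst, z1, z2⟩ := quad_zero2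
      ![dtri T (e 1) (e 2), ptri T (e 0) (e 1) (e 2), dtri T (e 0) (e 2)]
      ![dtri T (e 1) (e 3), ptri T (e 0) (e 1) (e 3), dtri T (e 0) (e 3)] hmin
    simp only [Matrix.cons_val] at z1 z2
    have w1 : dtri T (t • e 0 + s • e 1) (e 2) = 0 := by
      rw [dtri_expand]; linear_combination z1
    have w2 : dtri T (t • e 0 + s • e 1) (e 3) = 0 := by
      rw [dtri_expand]; linear_combination z2
    have hx : t • e 0 + s • e 1 = (t * s0 + s * s1) • p + (t * t0 + s * t1) • q := by
      rw [a5, a6]; module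
    refine hX (t • e 0 + s • e 1) ?_ ⟨by rw [hx]; exact hline _ _, ?_⟩
    · intro h0
      have hs : s = 0 := by
        have := congrArg (pair c) h0
        rw [pair_add, pair_smul, pair_smul, a1, a2] at this
        simpa [pair] using this
      subst hs
      have ht : t ≠ 0 := by simpa using hst
      have e0 : e 0 = 0 := by simpa [ht] using h0
      -- e spans a four-dimensional space
      have hsp : ⊤ ≤ Submodule.span Ω (Set.range e) := by
        intro v _
        obtain ⟨t, rfl⟩ := a7 v
        have hm : ∀ i, e i ∈ Submodule.span Ω (Set.range e) := fun i =>
          Submodule.subset_span ⟨i, rfl⟩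
        exact Submodule.add_mem _ (Submodule.add_mem _ (Submodule.add_mem _
          (Submodule.smul_mem _ _ (hm 0)) (Submodule.smul_mem _ _ (hm 1)))
          (Submodule.smul_mem _ _ (hm 2))) (Submodule.smul_mem _ _ (hm 3))
      have hli := linearIndependent_of_top_le_span_of_card_eq_finrank hsp (by simp)
      exact hli.ne_zero 0 e0
    · intro v
      obtain ⟨r, rfl⟩ := a7 v
      have w3 : dtri T (t • e 0 + s • e 1) (e 0) = 0 := by
        rw [hx, a5]; exact hdl _ _ _ _
      have w4 : dtri T (t • e 0 + s • e 1) (e 1) = 0 := by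
        rw [hx, a6]; exact hdl _ _ _ _
      simp only [dtri_add, dtri_smul, w1, w2, w3, w4]; ring

end CubicLine
namespace CubicLine

/-- linear substitution -/
noncomputable def sub {k : Type*} [Field k] (M : Matrix (Fin 4) (Fin 4) k) :
    MvPolynomial (Fin 4) k →ₐ[k] MvPolynomial (Fin 4) k :=
  aeval fun i => ∑ j, C (M i j) * X j

lemma sub_comp {k : Type*} [Field k] (M N : Matrix (Fin 4) (Fin 4) k) :
    (sub M).comp (sub N) = sub (N * M) := by
  apply MvPolynomial.algHom_ext
  intro i
  simp only [sub, AlgHom.comp_apply, aeval_X, map_sum, map_mul, algHom_C, Matrix.mul_apply,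
    Finset.mul_sum, Finset.sum_mul]
  rw [Finset.sum_comm]
  simp only [algebraMap_eq, mul_assoc]

lemma sub_one {k : Type*} [Field k] : sub (1 : Matrix (Fin 4) (Fin 4) k) = AlgHom.id k _ := by
  apply MvPolynomial.algHom_ext
  intro i
  simp [sub, Matrix.one_apply]

noncomputable def subEquiv {k : Type*} [Field k] (M N : Matrix (Fin 4) (Fin 4) k)
    (h1 : M * N = 1) (h2 : N * M = 1) :
    MvPolynomial (Fin 4) k ≃ₐ[k] MvPolynomial (Fin 4) k :=
  AlgEquiv.ofAlgHom (sub M) (sub N) (by rw [sub_comp, h2, sub_one]) (by rw [sub_comp, h1, sub_one])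

lemma sub_homog {k : Type*} [Field k] (M : Matrix (Fin 4) (Fin 4) k) {Q : MvPolynomial (Fin 4) k}
    {n : ℕ} (hQ : Q.IsHomogeneous n) : (sub M Q).IsHomogeneous n := by
  have := hQ.aeval (fun i => ∑ j, C (M i j) * X j) (n := 1) (fun i => by
    apply IsHomogeneous.sum
    intro j _
    simpa using (isHomogeneous_C (Fin 4) (M i j)).mul (isHomogeneous_X k j))
  rwa [one_mul] at this

lemma eval_sub {k : Type*} [Field k] (M : Matrix (Fin 4) (Fin 4) k) (x : Fin 4 → k)
    (Q : MvPolynomial (Fin 4) k) :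
    eval x (sub M Q) = eval (fun i => ∑ j, M i j * x j) Q := by
  have : (aeval x).comp (sub M) = aeval (R := k) (fun i => ∑ j, M i j * x j) := by
    apply MvPolynomial.algHom_ext
    intro i
    simp [sub]
  exact DFunLike.congr_fun this Q

lemma exists_S {k : Type} [Field k] [NumberField k] {ι : Type*} [Finite ι] (f : ι → k) :
    ∃ S : Finset (HeightOneSpectrum (𝓞 k)),
      ∀ i, f i ∈ (S : Set (HeightOneSpectrum (𝓞 k))).integer k := by
  have hfin : (⋃ i, HeightOneSpectrum.Support (𝓞 k) (f i)).Finite :=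
    Set.finite_iUnion fun i => HeightOneSpectrum.Support.finite (𝓞 k) (f i)
  refine ⟨hfin.toFinset, fun i v hv => ?_⟩
  by_contra hcon
  apply hv
  rw [Set.Finite.coe_toFinset]
  exact Set.mem_iUnion.mpr ⟨i, not_le.mp hcon⟩

lemma nf_map {A k : Type*} [CommRing A] [CommRing k] (φ : A →+* k) (m : k)
    (a b c d : Fin 3 → A) (e : Fin 4 → A) (a' b' c' d' : Fin 3 → k) (e' : Fin 4 → k)
    (ha : ∀ i, φ (a i) = m * a' i) (hb : ∀ i, φ (b i) = m * b' i)
    (hc : ∀ i, φ (c i) = m * c' i) (hd : ∀ i, φ (d i) = m * d' i)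
    (he : ∀ i, φ (e i) = m * e' i) (h y z w : A) :
    φ (nf a b c d e h y z w) = m * nf a' b' c' d' e' (φ h) (φ y) (φ z) (φ w) := by
  simp only [nf, map_add, map_mul, map_pow, ha, hb, hc, hd, he]; ring

theorem arith {k : Type} [Field k] [NumberField k] (I r2 : k) (hI : I ^ 2 = -1) (h2 : r2 ^ 2 = 2)
    (F H : MvPolynomial (Fin 4) k)
    (T : Fin 4 → Fin 4 → Fin 4 → k) (c : Fin 4 → k) (e : Fin 4 → Fin 4 → k)
    (hFT : F = ∑ i, ∑ j, ∑ l, C (T i j l) * (X i * X j * X l))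
    (hHc : H = ∑ i, C (c i) * X i)
    (hFh : F.IsHomogeneous 3) (hFirr : Irreducible F)
    (N : Matrix (Fin 4) (Fin 4) k) (hN : (Matrix.of fun i j => e j i) * N = 1)
    (p0 : pair c (e 0) = 0) (p1 : pair c (e 1) = 1) (p2 : pair c (e 2) = 0) (p3 : pair c (e 3) = 0)
    (t0 : tri T (e 0) (e 0) (e 0) = 0) (t1 : tri T (e 1) (e 1) (e 1) = 0)
    (d01 : dtri T (e 0) (e 1) = 0) (d10 : dtri T (e 1) (e 0) = 0)
    (hmin : ¬ (dtri T (e 1) (e 2) * ptri T (e 0) (e 1) (e 3) =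
        ptri T (e 0) (e 1) (e 2) * dtri T (e 1) (e 3)
       ∧ dtri T (e 1) (e 2) * dtri T (e 0) (e 3) = dtri T (e 0) (e 2) * dtri T (e 1) (e 3)
       ∧ ptri T (e 0) (e 1) (e 2) * dtri T (e 0) (e 3) =
          dtri T (e 0) (e 2) * ptri T (e 0) (e 1) (e 3))) :
    ∃ S : Finset (HeightOneSpectrum (𝓞 k)),
      ∀ G : MvPolynomial (Fin 4) k, (∃ n : ℕ, G.IsHomogeneous n) → ¬ F ∣ G →
        ∃ a : Fin 4 → ((S : Set (HeightOneSpectrum (𝓞 k))).integer k),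
          Ideal.span (Set.range a) = ⊤ ∧
          eval (fun i => (a i : k)) F = 0 ∧
          (∃ u : ((S : Set (HeightOneSpectrum (𝓞 k))).integer k)ˣ,
            ((u : ((S : Set (HeightOneSpectrum (𝓞 k))).integer k)) : k) =
              eval (fun i => (a i : k)) H) ∧
          eval (fun i => (a i : k)) G ≠ 0 := by
  obtain ⟨S, hS⟩ := exists_S (k := k) (Sum.elim (fun ij : Fin 4 × Fin 4 => e ij.1 ij.2) c)
  refine ⟨S, fun G ⟨n, hG⟩ hFG => ?_⟩
  set R := (S : Set (HeightOneSpectrum (𝓞 k))).integer k with hR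
  have heR : ∀ i j, e i j ∈ R := fun i j => hS (Sum.inl (i, j))
  have hcR : ∀ i, c i ∈ R := fun i => hS (Sum.inr i)
  by_contra hcon
  push Not at hcon
  -- coefficients
  let a' : Fin 3 → k := ![dtri T (e 1) (e 2), ptri T (e 0) (e 1) (e 2), dtri T (e 0) (e 2)]
  let b' : Fin 3 → k := ![dtri T (e 1) (e 3), ptri T (e 0) (e 1) (e 3), dtri T (e 0) (e 3)]
  let c' : Fin 3 → k := ![dtri T (e 2) (e 1), ptri T (e 1) (e 2) (e 3), dtri T (e 3) (e 1)]
  let d' : Fin 3 → k := ![dtri T (e 2) (e 0), ptri T (e 0) (e 2) (e 3), dtri T (e 3) (e 0)]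
  let e' : Fin 4 → k := ![tri T (e 2) (e 2) (e 2), dtri T (e 2) (e 3), dtri T (e 3) (e 2),
    tri T (e 3) (e 3) (e 3)]
  obtain ⟨m, hm⟩ := IsLocalization.exist_integer_multiples_of_finite (nonZeroDivisors (𝓞 k))
    (Sum.elim a' (Sum.elim b' (Sum.elim c' (Sum.elim d' e'))))
  choose f hf using hm
  set m' : k := algebraMap (𝓞 k) k m with hm'
  have hm0 : m' ≠ 0 := by
    rw [hm']
    exact IsLocalization.to_map_ne_zero_of_mem_nonZeroDivisors k le_rfl m.2
  have hf' : ∀ i, algebraMap (𝓞 k) k (f i) =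
      m' * (Sum.elim a' (Sum.elim b' (Sum.elim c' (Sum.elim d' e')))) i := by
    intro i; rw [hf i, Algebra.smul_def]
  have hinj : Function.Injective (algebraMap (𝓞 k) k) := IsFractionRing.injective (𝓞 k) k
  let A0 : Fin 3 → 𝓞 k := fun i => f (Sum.inl i)
  let B0 : Fin 3 → 𝓞 k := fun i => f (Sum.inr (Sum.inl i))
  let C0 : Fin 3 → 𝓞 k := fun i => f (Sum.inr (Sum.inr (Sum.inl i)))
  let D0 : Fin 3 → 𝓞 k := fun i => f (Sum.inr (Sum.inr (Sum.inr (Sum.inl i))))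
  let E0 : Fin 4 → 𝓞 k := fun i => f (Sum.inr (Sum.inr (Sum.inr (Sum.inr i))))
  have hA : ∀ i, algebraMap (𝓞 k) k (A0 i) = m' * a' i := fun i => hf' _
  have hB : ∀ i, algebraMap (𝓞 k) k (B0 i) = m' * b' i := fun i => hf' _
  have hC : ∀ i, algebraMap (𝓞 k) k (C0 i) = m' * c' i := fun i => hf' _
  have hD : ∀ i, algebraMap (𝓞 k) k (D0 i) = m' * d' i := fun i => hf' _
  have hE : ∀ i, algebraMap (𝓞 k) k (E0 i) = m' * e' i := fun i => hf' _
  have hcross : ∀ i j, A0 i * B0 j = A0 j * B0 i → a' i * b' j = a' j * b' i := by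
    intro i j h
    have := congrArg (algebraMap (𝓞 k) k) h
    rw [map_mul, map_mul, hA, hA, hB, hB] at this
    apply mul_left_cancel₀ (mul_ne_zero hm0 hm0)
    linear_combination this
  have hcore := core2 hinj (pell_infinite I r2 hI h2) A0 B0 C0 D0 E0
    (fun ⟨h1, h2, h3⟩ => hmin ⟨hcross 0 1 h1, hcross 0 2 h2, hcross 1 2 h3⟩)
  -- transported polynomials
  set M : Matrix (Fin 4) (Fin 4) k := Matrix.of fun i j => e j i with hM
  have hN' : N * M = 1 := mul_eq_one_comm.mp hN
  let φ := subEquiv M N hN hN'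
  have hφ : ∀ Q, φ Q = sub M Q := fun Q => rfl
  refine density (φ F) (φ G) ((MulEquiv.prime_iff φ).mpr hFirr.prime)
    (by rwa [map_dvd_iff]) (sub_homog M hFh) (sub_homog M hG) ?_
  refine hcore.mono ?_
  intro s hs
  refine Set.Infinite.mono ?_ hs
  rintro z ⟨y, z', w', hz, hw, hnf⟩
  refine ⟨algebraMap (𝓞 k) k y, ?_⟩
  rw [hφ, hφ, eval_sub, eval_sub]
  set pt : Fin 4 → k := fun i => ∑ j, M i j * (![algebraMap (𝓞 k) k y, 1, z, s * z] : Fin 4 → k) j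
    with hpt
  have hpt' : pt = algebraMap (𝓞 k) k y • e 0 + (1 : k) • e 1 + z • e 2 + (s * z) • e 3 := by
    funext i
    simp [hpt, hM, Fin.sum_univ_four, Algebra.smul_def]
    ring
  have hFpt : eval pt F = 0 := by
    have h1 : eval pt F = tri T pt pt pt := by
      have := eval_triPoly (A := k) T pt
      rw [← hFT, aeval_eq_eval] at this
      exact this
    rw [h1, hpt', tri_expand4 T _ _ _ _ _ _ _ _ t0 t1 d01 d10]
    have := nf_map (algebraMap (𝓞 k) k) m' A0 B0 C0 D0 E0 a' b' c' d' e' hA hB hC hD hE 1 y z' w'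
    rw [hnf, map_zero, hz, hw, map_one] at this
    exact (mul_eq_zero.mp this.symm).resolve_left hm0
  have hHpt : eval pt H = 1 := by
    have h1 : eval pt H = pair c pt := by rw [hHc]; simp [pair]
    rw [h1, hpt', pair_add, pair_add, pair_add, pair_smul, pair_smul, pair_smul, pair_smul,
      p0, p1, p2, p3]; ring
  have halg : ∀ x : 𝓞 k, algebraMap (𝓞 k) k x ∈ R := fun x => R.algebraMap_mem x
  have hptR : ∀ i, pt i ∈ R := by
    intro i
    rw [hpt', ← hw, ← hz]
    simp only [Pi.add_apply, Pi.smul_apply, smul_eq_mul]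
    exact R.add_mem (R.add_mem (R.add_mem (R.mul_mem (halg _) (heR _ _))
      (R.mul_mem R.one_mem (heR _ _))) (R.mul_mem (halg _) (heR _ _)))
      (R.mul_mem (halg _) (heR _ _))
  refine ⟨hFpt, ?_⟩
  refine hcon (fun i => ⟨pt i, hptR i⟩) ?_ hFpt ⟨1, by rw [hHpt]; rfl⟩
  rw [Ideal.eq_top_iff_one]
  have hone : (1 : R) = ∑ i, (⟨c i, hcR i⟩ : R) * ⟨pt i, hptR i⟩ := by
    apply Subtype.ext
    have h1 : eval pt H = ∑ i, c i * pt i := by rw [hHc]; simp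
    rw [hHpt] at h1
    simpa using h1
  rw [hone]
  exact Ideal.sum_mem _ fun i _ => Ideal.mul_mem_left _ _ (Ideal.subset_span ⟨i, rfl⟩)

end CubicLine
namespace CubicLine

lemma dtri_map {A B : Type*} [CommRing A] [CommRing B] (φ : A →+* B)
    (T : Fin 4 → Fin 4 → Fin 4 → A) (x y : Fin 4 → A) :
    φ (dtri T x y) = dtri (fun i j l => φ (T i j l)) (fun i => φ (x i)) (fun i => φ (y i)) := by
  simp only [dtri, map_add, tri_map]

lemma ptri_map {A B : Type*} [CommRing A] [CommRing B] (φ : A →+* B)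
    (T : Fin 4 → Fin 4 → Fin 4 → A) (x y z : Fin 4 → A) :
    φ (ptri T x y z) = ptri (fun i j l => φ (T i j l)) (fun i => φ (x i)) (fun i => φ (y i))
      (fun i => φ (z i)) := by
  simp only [ptri, map_add, tri_map]

lemma pair_map {A B : Type*} [CommRing A] [CommRing B] (φ : A →+* B)
    (c x : Fin 4 → A) : φ (pair c x) = pair (fun i => φ (c i)) (fun i => φ (x i)) := by
  simp only [pair, map_sum, map_mul]

lemma exists_subfield {K : Type} [Field K] [NumberField K] {ι : Type} [Finite ι]
    (f : ι → AlgebraicClosure K) : ∃ E : IntermediateField K (AlgebraicClosure K),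
      FiniteDimensional K E ∧ ∀ i, f i ∈ E := by
  refine ⟨IntermediateField.adjoin K (Set.range f), ?_, fun i =>
    IntermediateField.subset_adjoin K _ ⟨i, rfl⟩⟩
  have := (Set.finite_range f).to_subtype
  exact IntermediateField.finiteDimensional_adjoin fun x _ => Algebra.IsIntegral.isIntegral x

/-- The main theorem, inside the namespace of the auxiliary lemmas. -/
theorem main_aux
    (K : Type) [Field K] [NumberField K]
    (F H : MvPolynomial (Fin 4) K)
    (hF : F.IsHomogeneous 3) (hH : H.IsHomogeneous 1) (hHne : H ≠ 0)
    -- `X` is a smooth surface: over an algebraic closure, `F` and its four partial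
    -- derivatives have no common nonzero zero
    (hXsmooth : ∀ a : Fin 4 → AlgebraicClosure K, a ≠ 0 →
      ¬ (aeval a F = 0 ∧ ∀ i : Fin 4, aeval a (pderiv i F) = 0))
    -- `D = X ∩ {H = 0}` is a smooth curve: at every point of `D` over an algebraic
    -- closure the Jacobian matrix of `(F, H)` has rank two
    (hDsmooth : ∀ a : Fin 4 → AlgebraicClosure K, a ≠ 0 →
      aeval a F = 0 → aeval a H = 0 →
      ∃ i j : Fin 4,
        aeval a (pderiv i F) * aeval a (pderiv j H) ≠
          aeval a (pderiv j F) * aeval a (pderiv i H)) :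
    ∃ (K' : Type) (_ : Field K') (_ : NumberField K') (_ : Algebra K K')
      (_ : FiniteDimensional K K')
      (S : Finset (HeightOneSpectrum (𝓞 K'))),
      ∀ G : MvPolynomial (Fin 4) K', (∃ n : ℕ, G.IsHomogeneous n) →
        -- `G` does not vanish identically on `X`
        (∃ y : Fin 4 → AlgebraicClosure K',
          aeval y (MvPolynomial.map (algebraMap K K') F) = 0 ∧ aeval y G ≠ 0) →
        ∃ a : Fin 4 → ((S : Set (HeightOneSpectrum (𝓞 K'))).integer K'),
          -- the coordinates generate the unit ideal of `R`
          Ideal.span (Set.range a) = ⊤ ∧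
          -- the point lies on `X`
          eval (fun i => (a i : K')) (MvPolynomial.map (algebraMap K K') F) = 0 ∧
          -- `H` takes a unit value in `R` at the point
          (∃ u : ((S : Set (HeightOneSpectrum (𝓞 K'))).integer K')ˣ,
            ((u : ((S : Set (HeightOneSpectrum (𝓞 K'))).integer K')) : K') =
              eval (fun i => (a i : K')) (MvPolynomial.map (algebraMap K K') H)) ∧
          -- `G` does not vanish at the point
          eval (fun i => (a i : K')) G ≠ 0 := by
  obtain ⟨T, hT⟩ := exists_tri F hF
  obtain ⟨c, hc⟩ := lin_form H hH
  set TΩ : Fin 4 → Fin 4 → Fin 4 → AlgebraicClosure K := fun i j l => algebraMap K _ (T i j l)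
    with hTΩ
  set cΩ : Fin 4 → AlgebraicClosure K := fun i => algebraMap K _ (c i) with hcΩ
  have hFx : ∀ x : Fin 4 → AlgebraicClosure K, aeval x F = tri TΩ x x x := by
    intro x
    have := eval_triPoly T x
    rwa [← hT] at this
  have hdF : ∀ x v : Fin 4 → AlgebraicClosure K,
      ∑ n, v n * aeval x (pderiv n F) = dtri TΩ x v := by
    intro x v
    have := eval_pderiv_triPoly T x v
    rw [← hT] at this
    exact this
  have hHx : ∀ x : Fin 4 → AlgebraicClosure K, aeval x H = pair cΩ x := by
    intro x
    rw [hc]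
    simp [pair, hcΩ]
  have hdH : ∀ (x : Fin 4 → AlgebraicClosure K) i, aeval x (pderiv i H) = cΩ i := by
    intro x i
    rw [hc]
    simp [hcΩ, pderiv_X, Pi.single_apply]
  have hcne : cΩ ≠ 0 := by
    intro h0
    apply hHne
    rw [hc]
    refine Finset.sum_eq_zero fun i _ => ?_
    have : algebraMap K (AlgebraicClosure K) (c i) = 0 := congrFun h0 i
    rw [map_eq_zero] at this
    rw [this]; simp
  obtain ⟨e, p0, p1, p2, p3, hspan, t0, t1, d01, d10, hmin⟩ := geom TΩ cΩ hcne
    (by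
      rintro a ha ⟨h1, h2⟩
      refine hXsmooth a ha ⟨by rw [hFx, h1], fun i => ?_⟩
      have := h2 (Pi.single i 1)
      rw [← hdF] at this
      simpa [Pi.single_apply] using this)
    (by
      intro a ha h1 h2
      obtain ⟨i, j, hij⟩ := hDsmooth a ha (by rw [hFx, h1]) (by rw [hHx, h2])
      rw [hdH, hdH] at hij
      have hs : ∀ i, dtri TΩ a (Pi.single i 1) = aeval a (pderiv i F) := by
        intro i
        rw [← hdF]; simp [Pi.single_apply]
      refine ⟨cΩ j • Pi.single i 1 + (- cΩ i) • Pi.single j 1, ?_, ?_⟩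
      · rw [pair_add, pair_smul, pair_smul, pair_single, pair_single]; ring
      · rw [dtri_add, dtri_smul, dtri_smul, hs, hs]
        intro h0
        apply hij
        linear_combination h0)
  choose tt htt using fun i : Fin 4 => hspan (Pi.single i 1)
  obtain ⟨I, hI⟩ := IsAlgClosed.exists_pow_nat_eq (-1 : AlgebraicClosure K) (n := 2) (by norm_num)
  obtain ⟨r2, hr2⟩ := IsAlgClosed.exists_pow_nat_eq (2 : AlgebraicClosure K) (n := 2) (by norm_num)
  obtain ⟨E, hfin, hE⟩ := exists_subfield (K := K)
    (Sum.elim (fun ij : Fin 4 × Fin 4 => e ij.1 ij.2)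
      (Sum.elim (fun ij : Fin 4 × Fin 4 => tt ij.1 ij.2) ![I, r2]))
  have hnf : NumberField E := NumberField.of_module_finite K E
  have heE : ∀ i j, e i j ∈ E := fun i j => hE (Sum.inl (i, j))
  have htE : ∀ i j, tt i j ∈ E := fun i j => hE (Sum.inr (Sum.inl (i, j)))
  have hIE : I ∈ E := hE (Sum.inr (Sum.inr 0))
  have hrE : r2 ∈ E := hE (Sum.inr (Sum.inr 1))
  let φ : E →+* AlgebraicClosure K := algebraMap E (AlgebraicClosure K)
  have hφ : Function.Injective φ := φ.injective
  let e' : Fin 4 → Fin 4 → E := fun i j => ⟨e i j, heE i j⟩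
  let N : Matrix (Fin 4) (Fin 4) E := Matrix.of fun j i => ⟨tt i j, htE i j⟩
  let T' : Fin 4 → Fin 4 → Fin 4 → E := fun i j l => algebraMap K E (T i j l)
  let c' : Fin 4 → E := fun i => algebraMap K E (c i)
  have hT' : (fun i j l => φ (T' i j l)) = TΩ := rfl
  have hc' : (fun i => φ (c' i)) = cΩ := rfl
  have he' : ∀ i, (fun j => φ (e' i j)) = e i := fun i => rfl
  have mt : ∀ i j l, φ (tri T' (e' i) (e' j) (e' l)) = tri TΩ (e i) (e j) (e l) := by
    intro i j l; rw [tri_map]; rfl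
  have mp : ∀ i j l, φ (ptri T' (e' i) (e' j) (e' l)) = ptri TΩ (e i) (e j) (e l) := by
    intro i j l; rw [ptri_map]; rfl
  have md : ∀ i j, φ (dtri T' (e' i) (e' j)) = dtri TΩ (e i) (e j) := by
    intro i j; rw [dtri_map]; rfl
  have mc : ∀ i, φ (pair c' (e' i)) = pair cΩ (e i) := by
    intro i; rw [pair_map]; rfl
  set F' : MvPolynomial (Fin 4) E := MvPolynomial.map (algebraMap K E) F with hF'
  set H' : MvPolynomial (Fin 4) E := MvPolynomial.map (algebraMap K E) H with hH'
  have hFh' : F'.IsHomogeneous 3 := hF.map _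
  have hirr : Irreducible F' := by
    refine irred (Ω := AlgebraicClosure K) hFh' ?_
    rintro a ha ⟨h1, h2⟩
    refine hXsmooth a ha ⟨?_, fun i => ?_⟩
    · rwa [hF', aeval_map_algebraMap] at h1
    · have := h2 i
      rwa [hF', pderiv_map, aeval_map_algebraMap] at this
  obtain ⟨S, hS⟩ := arith (k := E) ⟨I, hIE⟩ ⟨r2, hrE⟩ (Subtype.ext hI) (Subtype.ext hr2) F' H' T' c' e'
    (by rw [hF', hT]; simp [T'])
    (by rw [hH', hc]; simp [c'])
    hFh' hirr N
    (by
      ext l i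
      have h1 := congrFun (htt i) l
      simp only [Finset.sum_apply, Pi.smul_apply, smul_eq_mul] at h1
      have h2 : ((((Matrix.of fun i j => e' j i) * N : Matrix (Fin 4) (Fin 4) E) l i : E) :
          AlgebraicClosure K) = ∑ j, e j l * tt i j := by
        simp [Matrix.mul_apply, e', N]
      rw [h2]
      have h3 : (((1 : Matrix (Fin 4) (Fin 4) E) l i : E) : AlgebraicClosure K) =
          (Pi.single i 1 : Fin 4 → AlgebraicClosure K) l := by
        rw [Matrix.one_apply, Pi.single_apply]
        split_ifs <;> rfl
      rw [h3, h1]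
      exact Finset.sum_congr rfl fun j _ => mul_comm _ _)
    (hφ (by rw [mc, p0, map_zero])) (hφ (by rw [mc, p1, map_one]))
    (hφ (by rw [mc, p2, map_zero])) (hφ (by rw [mc, p3, map_zero]))
    (hφ (by rw [mt, t0, map_zero])) (hφ (by rw [mt, t1, map_zero]))
    (hφ (by rw [md, d01, map_zero])) (hφ (by rw [md, d10, map_zero]))
    (by
      rintro ⟨h1, h2, h3⟩
      apply hmin
      have h1 := congrArg φ h1
      have h2 := congrArg φ h2
      have h3 := congrArg φ h3
      simp only [map_mul, mp, md] at h1 h2 h3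
      exact ⟨h1, h2, h3⟩)
  refine ⟨E, inferInstance, hnf, inferInstance, hfin, S, fun G hG hy => hS G hG ?_⟩
  obtain ⟨y, hy1, hy2⟩ := hy
  rintro ⟨Q, hQ⟩
  apply hy2
  rw [hQ, map_mul, hy1, zero_mul]

end CubicLine

/-- **Potential density of integral points on the complement of a smooth hyperplane
section of a smooth cubic surface** (degree-3 case of Theorem 7.1 of the paper,
after Beukers).

Let `K` be a number field, `F` a cubic form in four variables over `K` whose zero locus
`X ⊂ ℙ³` is a smooth surface, and `H` a nonzero linear form such that the plane cubic
curve `D = X ∩ {H = 0}` is smooth.  Then there are a finite extension `K'` of `K` and a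
finite set `S` of maximal ideals of `𝓞 K'` such that, with `R` the ring of `S`-integers
of `K'`, the `S`-integral points of `(X, D)` — points with primitive coordinates in `R`,
lying on `X`, at which `H` takes a unit value in `R` — are Zariski dense in `X`: for
every homogeneous polynomial `G` over `K'` not vanishing identically on `X` there is
such a point at which `G ≠ 0`. -/
theorem cubic_surface_hyperplane_complement_integral_points_potentially_dense
    (K : Type) [Field K] [NumberField K]
    (F H : MvPolynomial (Fin 4) K)
    (hF : F.IsHomogeneous 3) (hH : H.IsHomogeneous 1) (hHne : H ≠ 0)
    -- `X` is a smooth surface: over an algebraic closure, `F` and its four partial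
    -- derivatives have no common nonzero zero
    (hXsmooth : ∀ a : Fin 4 → AlgebraicClosure K, a ≠ 0 →
      ¬ (aeval a F = 0 ∧ ∀ i : Fin 4, aeval a (pderiv i F) = 0))
    -- `D = X ∩ {H = 0}` is a smooth curve: at every point of `D` over an algebraic
    -- closure the Jacobian matrix of `(F, H)` has rank two
    (hDsmooth : ∀ a : Fin 4 → AlgebraicClosure K, a ≠ 0 →
      aeval a F = 0 → aeval a H = 0 →
      ∃ i j : Fin 4,
        aeval a (pderiv i F) * aeval a (pderiv j H) ≠
          aeval a (pderiv j F) * aeval a (pderiv i H)) :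
    ∃ (K' : Type) (_ : Field K') (_ : NumberField K') (_ : Algebra K K')
      (_ : FiniteDimensional K K')
      (S : Finset (HeightOneSpectrum (𝓞 K'))),
      ∀ G : MvPolynomial (Fin 4) K', (∃ n : ℕ, G.IsHomogeneous n) →
        -- `G` does not vanish identically on `X`
        (∃ y : Fin 4 → AlgebraicClosure K',
          aeval y (MvPolynomial.map (algebraMap K K') F) = 0 ∧ aeval y G ≠ 0) →
        ∃ a : Fin 4 → ((S : Set (HeightOneSpectrum (𝓞 K'))).integer K'),
          -- the coordinates generate the unit ideal of `R`
          Ideal.span (Set.range a) = ⊤ ∧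
          -- the point lies on `X`
          eval (fun i => (a i : K')) (MvPolynomial.map (algebraMap K K') F) = 0 ∧
          -- `H` takes a unit value in `R` at the point
          (∃ u : ((S : Set (HeightOneSpectrum (𝓞 K'))).integer K')ˣ,
            ((u : ((S : Set (HeightOneSpectrum (𝓞 K'))).integer K')) : K') =
              eval (fun i => (a i : K')) (MvPolynomial.map (algebraMap K K') H)) ∧
          -- `G` does not vanish at the point
          eval (fun i => (a i : K')) G ≠ 0 := by
  exact CubicLine.main_aux K F H hF hH hHne hXsmooth hDsmooth
end

section
/- Let K be a number field and F ∈ K[x,y,z] a cubic form defining a smooth plane cubic curve D ⊂ P² (over an algebraic closure, F and its three partial derivatives have no common nonzero solution). Then there exist a finite extension K' of K and a finite set S of maximal ideals of O_{K'} such that, with R = O_{K',S}, the set of points (a : b : c) ∈ P²(K') admitting representatives a, b, c ∈ R with aR + bR + cR = R and F(a,b,c) ∈ R^× is Zariski dense in P², i.e., for every nonzero homogeneous polynomial G over K' there is such a point at which G ≠ 0. -/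
open MvPolynomial IsDedekindDomain NumberField


theorem exists_common_zero {k : Type*} [Field k] [IsAlgClosed k] (F H : MvPolynomial (Fin 3) k)
    (hF : eval 0 F = 0) (hH : eval 0 H = 0) :
    ∃ v : Fin 3 → k, v ≠ 0 ∧ eval v F = 0 ∧ eval v H = 0 := by
  by_contra hcon
  push Not at hcon
  let φ : (Fin 3 → Fin 2) → MvPolynomial (Fin 3) k →ₐ[k] MvPolynomial (Fin 3) k :=
    fun e => aeval (fun i => if e i = 0 then 0 else X i)
  let p : (Fin 3 → Fin 2) → Ideal (MvPolynomial (Fin 3) k) := fun e => RingHom.ker (φ e)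
  have hp : ∀ e, (p e).IsPrime := fun e => RingHom.ker_isPrime _
  have hmem : ∀ e i, X i ∈ p e ↔ e i = 0 := by
    intro e i
    simp only [p, φ, RingHom.mem_ker, aeval_X]
    split_ifs with h
    · simp [h]
    · simp [h]
  have hle : ∀ e e' : Fin 3 → Fin 2, (∀ i, e i = 0 → e' i = 0) → p e ≤ p e' := by
    intro e e' h f hf
    simp only [p, RingHom.mem_ker] at hf ⊢
    have : φ e' f = φ e' (φ e f) := by
      rw [← AlgHom.comp_apply]
      congr 1
      ext i : 1
      simp only [φ, AlgHom.comp_apply, aeval_X]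
      by_cases h1 : e i = 0
      · simp [h1, h i h1]
      · simp [h1]
    rw [this, hf, map_zero]
  have h1 := hle ![1,1,1] ![0,1,1] (by decide)
  have h2 := hle ![0,1,1] ![0,0,1] (by decide)
  have h3 := hle ![0,0,1] ![0,0,0] (by decide)
  have h1' : p ![1,1,1] < p ![0,1,1] := lt_of_le_not_ge h1 fun h => by
    simpa using (hmem ![1,1,1] 0).1 (h ((hmem ![0,1,1] 0).2 rfl))
  have h2' : p ![0,1,1] < p ![0,0,1] := lt_of_le_not_ge h2 fun h => by
    simpa using (hmem ![0,1,1] 1).1 (h ((hmem ![0,0,1] 1).2 rfl))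
  have h3' : p ![0,0,1] < p ![0,0,0] := lt_of_le_not_ge h3 fun h => by
    simpa using (hmem ![0,0,1] 2).1 (h ((hmem ![0,0,0] 2).2 rfl))
  have g1 := Ideal.height_add_one_le_of_lt_of_isPrime h1'
  have g2 := Ideal.height_add_one_le_of_lt_of_isPrime h2'
  have g3 := Ideal.height_add_one_le_of_lt_of_isPrime h3'
  have hev : ∀ f, f ∈ p ![0,0,0] ↔ eval 0 f = 0 := by
    intro f
    have : φ ![0,0,0] f = C (eval 0 f) := by
      have : φ ![0,0,0] = (Algebra.ofId k _).comp (aeval (0 : Fin 3 → k)) := by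
        ext i : 1
        fin_cases i <;> simp [φ]
      rw [this, AlgHom.comp_apply]
      simp [Algebra.ofId_apply, algebraMap_eq]
    simp [p, RingHom.mem_ker, this]
  have hmin : p ![0,0,0] ∈ (Ideal.span ({F, H} : Set (MvPolynomial (Fin 3) k))).minimalPrimes := by
    have hrad : (Ideal.span ({F, H} : Set (MvPolynomial (Fin 3) k))).radical = p ![0,0,0] := by
      rw [← vanishingIdeal_zeroLocus_eq_radical (K := k)]
      ext f
      rw [hev, mem_vanishingIdeal_iff]
      constructor
      · intro h
        have := h 0 (by
          rw [zeroLocus_span]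
          simp only [Set.mem_insert_iff, Set.mem_singleton_iff, forall_eq_or_imp, forall_eq,
            Set.mem_ofPred_eq, aeval_eq_eval]
          exact ⟨hF, hH⟩)
        simpa [aeval_eq_eval] using this
      · intro h x hx
        rw [zeroLocus_span] at hx
        simp only [Set.mem_insert_iff, Set.mem_singleton_iff, forall_eq_or_imp, forall_eq, Set.mem_ofPred_eq, aeval_eq_eval] at hx
        by_cases hx0 : x = 0
        · simpa [hx0, aeval_eq_eval] using h
        · exact absurd hx.2 (hcon x hx0 hx.1)
    rw [← Ideal.radical_minimalPrimes, hrad, Ideal.minimalPrimes_eq_subsingleton_self]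
    rfl
  have hc := Ideal.height_le_card_of_mem_minimalPrimes_span (Set.toFinite _) hmin
  have hc2 : (({F, H} : Set (MvPolynomial (Fin 3) k)).ncard) ≤ 2 := by
    refine (Set.ncard_insert_le _ _).trans ?_
    simp
  have hc3 : (p ![0,0,0]).height ≤ 2 := hc.trans (by exact_mod_cast hc2)
  have g4 : (3 : ℕ∞) ≤ (p ![0,0,0]).height := by
    refine le_trans ?_ g3
    have : (2 : ℕ∞) ≤ (p ![0,0,1]).height := by
      refine le_trans ?_ g2
      have : (1 : ℕ∞) ≤ (p ![0,1,1]).height := le_trans (by simp) g1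
      calc (2 : ℕ∞) = 1 + 1 := by norm_num
        _ ≤ _ := by gcongr
    calc (3 : ℕ∞) = 2 + 1 := by norm_num
      _ ≤ _ := by gcongr
  exact absurd (g4.trans hc3) (by decide)

/-- The symmetric trilinear form of a ternary cubic. -/
def tri {k : Type*} [Field k] (c : Fin 10 → k) (u v w : Fin 3 → k) : k :=
  c 0 * (u 0 * v 0 * w 0) + c 1 * (u 1 * v 1 * w 1) + c 2 * (u 2 * v 2 * w 2)
  + c 3 * (u 0 * v 0 * w 1 + u 0 * v 1 * w 0 + u 1 * v 0 * w 0)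
  + c 4 * (u 0 * v 0 * w 2 + u 0 * v 2 * w 0 + u 2 * v 0 * w 0)
  + c 5 * (u 1 * v 1 * w 0 + u 1 * v 0 * w 1 + u 0 * v 1 * w 1)
  + c 6 * (u 1 * v 1 * w 2 + u 1 * v 2 * w 1 + u 2 * v 1 * w 1)
  + c 7 * (u 2 * v 2 * w 0 + u 2 * v 0 * w 2 + u 0 * v 2 * w 2)
  + c 8 * (u 2 * v 2 * w 1 + u 2 * v 1 * w 2 + u 1 * v 2 * w 2)
  + c 9 * (u 0 * v 1 * w 2 + u 0 * v 2 * w 1 + u 1 * v 0 * w 2 + u 1 * v 2 * w 0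
      + u 2 * v 0 * w 1 + u 2 * v 1 * w 0)

section tri
variable {k : Type*} [Field k] (c : Fin 10 → k) (u u' v w : Fin 3 → k) (r : k)

theorem tri_swap12 : tri c u v w = tri c v u w := by simp only [tri]; ring
theorem tri_swap23 : tri c u v w = tri c u w v := by simp only [tri]; ring
theorem tri_add3 : tri c v w (u + u') = tri c v w u + tri c v w u' := by
  simp only [tri, Pi.add_apply]; ring
theorem tri_smul3 : tri c v w (r • u) = r * tri c v w u := by
  simp only [tri, Pi.smul_apply, smul_eq_mul]; ring
theorem tri_add2 : tri c v (u + u') w = tri c v u w + tri c v u' w := by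
  simp only [tri, Pi.add_apply]; ring
theorem tri_smul2 : tri c v (r • u) w = r * tri c v u w := by
  simp only [tri, Pi.smul_apply, smul_eq_mul]; ring
theorem tri_add1 : tri c (u + u') v w = tri c u v w + tri c u' v w := by
  simp only [tri, Pi.add_apply]; ring
theorem tri_smul1 : tri c (r • u) v w = r * tri c u v w := by
  simp only [tri, Pi.smul_apply, smul_eq_mul]; ring

theorem tri_single : tri c u v w = ∑ i, w i * tri c u v (Pi.single i 1) := by
  simp [Fin.sum_univ_three, tri]; ring
theorem tri_single2 : tri c u v w = ∑ i, v i * tri c u (Pi.single i 1) w := by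
  simp [Fin.sum_univ_three, tri]; ring
theorem tri_single1 : tri c u v w = ∑ i, u i * tri c (Pi.single i 1) v w := by
  simp [Fin.sum_univ_three, tri]; ring

/-- Expansion of the cubic along three vectors. -/
theorem tri_expand (N P W : Fin 3 → k) (x y z : k) :
    tri c (x • N + y • P + z • W) (x • N + y • P + z • W) (x • N + y • P + z • W) =
      x ^ 3 * tri c N N N + y ^ 3 * tri c P P P + z ^ 3 * tri c W W W
      + 3 * x ^ 2 * y * tri c P N N + 3 * x ^ 2 * z * tri c N N W
      + 3 * y ^ 2 * x * tri c P P N + 3 * y ^ 2 * z * tri c P P W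
      + 3 * z ^ 2 * x * tri c N W W + 3 * z ^ 2 * y * tri c P W W
      + 6 * x * y * z * tri c P N W := by
  simp only [tri_add1, tri_add2, tri_add3, tri_smul1, tri_smul2, tri_smul3]
  rw [tri_swap23 c N N P, tri_swap12 c N P N, tri_swap23 c N W N, tri_swap12 c W N N,
    tri_swap23 c N W N, tri_swap23 c P N P, tri_swap12 c N P P, tri_swap23 c P N P,
    tri_swap23 c P W P, tri_swap12 c W P P, tri_swap23 c P W P,
    tri_swap12 c W N W, tri_swap23 c W W N, tri_swap12 c W N W,
    tri_swap12 c W P W, tri_swap23 c W W P, tri_swap12 c W P W,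
    tri_swap23 c P W N, tri_swap12 c N P W, tri_swap23 c N W P, tri_swap12 c N P W,
    tri_swap12 c W P N, tri_swap23 c P W N, tri_swap12 c W N P, tri_swap23 c N W P,
    tri_swap12 c N P W]
  ring
end tri

theorem flex_exists {k : Type*} [Field k] [IsAlgClosed k] (c : Fin 10 → k) :
    ∃ P N : Fin 3 → k, N ≠ 0 ∧ tri c P P P = 0 ∧ P ≠ 0 ∧ ∀ w, tri c P N w = 0 := by
  classical
  let F : MvPolynomial (Fin 3) k :=
    ∑ i, ∑ j, ∑ l, C (tri c (Pi.single i 1) (Pi.single j 1) (Pi.single l 1)) * (X i * X j * X l)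
  let M : Matrix (Fin 3) (Fin 3) (MvPolynomial (Fin 3) k) :=
    Matrix.of fun i j => ∑ l, X l * C (tri c (Pi.single l 1) (Pi.single i 1) (Pi.single j 1))
  have hF : ∀ v, eval v F = tri c v v v := by
    intro v
    simp only [F, map_sum, map_mul, eval_C, eval_X]
    simp only [Fin.sum_univ_three]
    simp [tri]
    ring
  have hM : ∀ v, eval v M.det =
      Matrix.det (Matrix.of fun i j => tri c v (Pi.single i 1) (Pi.single j 1)) := by
    intro v
    rw [RingHom.map_det]
    congr 1
    ext i j
    simp only [RingHom.mapMatrix_apply, Matrix.map_apply, Matrix.of_apply, M, map_sum, map_mul, eval_C, eval_X]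
    rw [tri_single1 c v]
  obtain ⟨P, hP, h1, h2⟩ := exists_common_zero F M.det (by rw [hF]; simp [tri]) (by
    rw [hM, Matrix.det_fin_three]; simp [tri])
  rw [hF] at h1
  rw [hM] at h2
  obtain ⟨N, hN, h3⟩ := Matrix.exists_mulVec_eq_zero_iff.2 h2
  refine ⟨P, N, hN, h1, hP, fun w => ?_⟩
  rw [tri_single]
  refine Finset.sum_eq_zero fun i _ => ?_
  have := congrFun h3 i
  simp only [Matrix.mulVec, dotProduct, Pi.zero_apply, Matrix.of_apply] at this
  rw [tri_swap23, tri_single, ]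
  rw [Finset.sum_congr rfl fun j _ => mul_comm _ _, this, mul_zero]

theorem weierstrass_form {k : Type*} [Field k] [CharZero k] [IsAlgClosed k] (c : Fin 10 → k)
    (hs : ∀ v, (∀ w, tri c v v w = 0) → v = 0) :
    ∃ (T : Matrix (Fin 3) (Fin 3) k) (A B : k), T.det ≠ 0 ∧ ∀ x y z : k,
      tri c (T.mulVec ![x, y, z]) (T.mulVec ![x, y, z]) (T.mulVec ![x, y, z]) =
        x ^ 3 + A * x * z ^ 2 + B * z ^ 3 - y ^ 2 * z := by
  obtain ⟨P, N, hN, hPPP, hP, hPN⟩ := flex_exists c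
  obtain ⟨W, hW⟩ : ∃ W, tri c P P W ≠ 0 := by
    by_contra h
    push Not at h
    exact hP (hs P h)
  have hPPN : tri c P P N = 0 := by rw [tri_swap23, hPN]
  have hspan : ∀ N', N' ≠ 0 → (∀ w, tri c P N' w = 0) → ∀ W', tri c P P W' ≠ 0 → ∀ x y z : k,
      x • N' + y • P + z • W' = 0 → x = 0 ∧ y = 0 ∧ z = 0 := by
    intro N' hN' hPN' W' hW' x y z h
    have hz : z = 0 := by
      have h1 : tri c P P (x • N' + y • P + z • W') = 0 := by rw [h]; simp [tri]
      simp only [tri_add3, tri_smul3, hPPP, tri_swap23 c P P N', hPN'] at h1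
      simpa [hW'] using h1
    subst hz
    have hy : y = 0 := by
      have h1 : tri c P W' (x • N' + y • P + (0 : k) • W') = 0 := by rw [h]; simp [tri]
      simp only [tri_add3, tri_smul3, tri_swap23 c P W' N', hPN', tri_swap23 c P W' P] at h1
      simpa [hW'] using h1
    subst hy
    simpa [hN'] using h
  -- linear functionals are determined on the spanning triple
  have hgen : ∀ N', N' ≠ 0 → (∀ w, tri c P N' w = 0) → ∀ W', tri c P P W' ≠ 0 → 
      ((Matrix.of ![N', P, W']).transpose.det ≠ 0 ∧ ∀ w, ∃ x y z : k, w = x • N' + y • P + z • W') := by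
    intro N' hN' hPN' W' hW'
    have hmul : ∀ t, (Matrix.of ![N', P, W']).transpose.mulVec t = t 0 • N' + t 1 • P + t 2 • W' := by
      intro t
      ext i
      simp [Matrix.mulVec, dotProduct, Fin.sum_univ_three]
      ring
    have hdet : (Matrix.of ![N', P, W']).transpose.det ≠ 0 := by
      intro h0
      obtain ⟨t, ht, ht0⟩ := Matrix.exists_mulVec_eq_zero_iff.2 h0
      rw [hmul] at ht0
      obtain ⟨a, b, d⟩ := hspan N' hN' hPN' W' hW' _ _ _ ht0
      apply ht
      ext i
      fin_cases i <;> assumption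
    refine ⟨hdet, fun w => ?_⟩
    refine ⟨_, _, _, Eq.trans ?_ (hmul ((Matrix.of ![N', P, W']).transpose⁻¹.mulVec w))⟩
    rw [Matrix.mulVec_mulVec, Matrix.mul_nonsing_inv _ (isUnit_iff_ne_zero.2 hdet), Matrix.one_mulVec]
  have hPNN : tri c P N N = 0 := hPN N
  have hNNN : tri c N N N ≠ 0 := by
    intro h0
    obtain ⟨y, hy⟩ := IsAlgClosed.exists_pow_nat_eq (-(tri c N N W) / tri c P P W) (n := 2) (by norm_num)
    have hy' : tri c N N W + y ^ 2 * tri c P P W = 0 := by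
      rw [hy]; field_simp; ring
    have hv : N + y • P = 0 := by
      apply hs
      intro w
      obtain ⟨a, b, d, rfl⟩ := (hgen N hN hPN W hW).2 w
      simp only [tri_add1, tri_add2, tri_add3, tri_smul1, tri_smul2, tri_smul3, hPN, hPPP, hPPN,
        tri_swap12 c N P, h0, tri_swap23 c N N P]
      linear_combination d * hy'
    have := (hspan N hN hPN W hW 1 y 0 (by simpa using hv)).1
    exact one_ne_zero this
  obtain ⟨e, he⟩ := IsAlgClosed.exists_pow_nat_eq (tri c N N N) (n := 3) (by norm_num)
  have he0 : e ≠ 0 := by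
    rintro rfl
    exact hNNN (by rw [← he]; norm_num)
  set l : k := -tri c P W W / (2 * tri c P P W) with hl
  set m : k := -tri c N N W / tri c N N N with hm
  set W1 : Fin 3 → k := W + l • P + m • N with hW1
  have a1 : tri c P P W1 = tri c P P W := by
    simp only [W1, tri_add3, tri_smul3, hPPP, hPPN]; ring
  have a2 : tri c P W1 W1 = 0 := by
    simp only [W1, tri_add2, tri_add3, tri_smul3, tri_smul2, hPPP, hPN, tri_swap23 c P W P, hPPN,
      tri_swap23 c P W N]
    rw [hl]; field_simp; ring
  have a3 : tri c N N W1 = 0 := by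
    simp only [W1, tri_add3, tri_smul3, tri_swap23 c N N P, tri_swap12 c N P, hPN]
    have : m * tri c N N N = -tri c N N W := by rw [hm]; field_simp
    linear_combination this
  set f : k := -1 / (3 * tri c P P W) with hf
  have hf0 : f ≠ 0 := by exact div_ne_zero (by norm_num) (mul_ne_zero (by norm_num) hW)
  have b0 : e⁻¹ • N ≠ 0 := smul_ne_zero (inv_ne_zero he0) hN
  have b1 : ∀ w, tri c P (e⁻¹ • N) w = 0 := fun w => by rw [tri_smul2, hPN, mul_zero]
  have b2 : tri c P P (f • W1) = -1 / 3 := by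
    rw [tri_smul3, a1, hf]; field_simp
  refine ⟨(Matrix.of ![e⁻¹ • N, P, f • W1]).transpose, 3 * tri c (e⁻¹ • N) (f • W1) (f • W1),
    tri c (f • W1) (f • W1) (f • W1), (hgen _ b0 b1 _ (by rw [b2]; norm_num)).1, fun x y z => ?_⟩
  have : (Matrix.of ![e⁻¹ • N, P, f • W1]).transpose.mulVec ![x, y, z] =
      x • (e⁻¹ • N) + y • P + z • (f • W1) := by
    ext i
    simp [Matrix.mulVec, dotProduct, Fin.sum_univ_three]
    ring
  rw [this, tri_expand, b1, b1, tri_swap23 c P P (e⁻¹ • N), b1, hPPP, b2]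
  have d1 : tri c (e⁻¹ • N) (e⁻¹ • N) (e⁻¹ • N) = 1 := by
    simp only [tri_smul1, tri_smul2, tri_smul3]
    rw [← he]; field_simp
  have d2 : tri c P (f • W1) (f • W1) = 0 := by
    simp only [tri_smul2, tri_smul3, a2]; ring
  have d3 : tri c (e⁻¹ • N) (e⁻¹ • N) (f • W1) = 0 := by
    simp only [tri_smul1, tri_smul2, tri_smul3, a3]; ring
  rw [d1, d2, d3]
  ring

theorem homog_three_form {k : Type*} [Field k] [CharZero k] (F : MvPolynomial (Fin 3) k)
    (hF : F.IsHomogeneous 3) : ∃ c : Fin 10 → k, F = 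
      C (c 0) * X 0 ^ 3 + C (c 1) * X 1 ^ 3 + C (c 2) * X 2 ^ 3
      + C (c 3) * 3 * X 0 ^ 2 * X 1 + C (c 4) * 3 * X 0 ^ 2 * X 2
      + C (c 5) * 3 * X 1 ^ 2 * X 0 + C (c 6) * 3 * X 1 ^ 2 * X 2
      + C (c 7) * 3 * X 2 ^ 2 * X 0 + C (c 8) * 3 * X 2 ^ 2 * X 1
      + C (c 9) * 6 * X 0 * X 1 * X 2 := by
  let m : Fin 10 → MvPolynomial (Fin 3) k := ![X 0 ^ 3, X 1 ^ 3, X 2 ^ 3, X 0 ^ 2 * X 1,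
    X 0 ^ 2 * X 2, X 1 ^ 2 * X 0, X 1 ^ 2 * X 2, X 2 ^ 2 * X 0, X 2 ^ 2 * X 1, X 0 * X 1 * X 2]
  have hmem : F ∈ Submodule.span k (Set.range m) := by
    rw [F.as_sum]
    refine Submodule.sum_mem _ fun d hd => ?_
    have hdeg : d 0 + d 1 + d 2 = 3 := by
      have := hF (mem_support_iff.1 hd)
      rw [Finsupp.weight_apply, Finsupp.sum_fintype _ _ (by simp)] at this
      simpa [Fin.sum_univ_three] using this
    have hmon : monomial d (coeff d F) = coeff d F • (X 0 ^ d 0 * X 1 ^ d 1 * X 2 ^ d 2) := by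
      rw [monomial_eq, Finsupp.prod_fintype _ _ (by simp), Fin.prod_univ_three, smul_eq_C_mul]
    rw [hmon]
    refine Submodule.smul_mem _ _ ?_
    have key : ∃ i, m i = X 0 ^ d 0 * X 1 ^ d 1 * X 2 ^ d 2 := by
      have h0 : d 0 ≤ 3 := by omega
      have h1 : d 1 ≤ 3 := by omega
      have h2 : d 2 ≤ 3 := by omega
      generalize d 0 = a at *
      generalize d 1 = b at *
      generalize d 2 = e at *
      interval_cases a <;> interval_cases b <;> interval_cases e <;> first
        | omega
        | (refine ⟨0, ?_⟩; change (X 0 ^ 3 : MvPolynomial (Fin 3) k) = _; ring1)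
        | (refine ⟨1, ?_⟩; change (X 1 ^ 3 : MvPolynomial (Fin 3) k) = _; ring1)
        | (refine ⟨2, ?_⟩; change (X 2 ^ 3 : MvPolynomial (Fin 3) k) = _; ring1)
        | (refine ⟨3, ?_⟩; change (X 0 ^ 2 * X 1 : MvPolynomial (Fin 3) k) = _; ring1)
        | (refine ⟨4, ?_⟩; change (X 0 ^ 2 * X 2 : MvPolynomial (Fin 3) k) = _; ring1)
        | (refine ⟨5, ?_⟩; change (X 1 ^ 2 * X 0 : MvPolynomial (Fin 3) k) = _; ring1)
        | (refine ⟨6, ?_⟩; change (X 1 ^ 2 * X 2 : MvPolynomial (Fin 3) k) = _; ring1)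
        | (refine ⟨7, ?_⟩; change (X 2 ^ 2 * X 0 : MvPolynomial (Fin 3) k) = _; ring1)
        | (refine ⟨8, ?_⟩; change (X 2 ^ 2 * X 1 : MvPolynomial (Fin 3) k) = _; ring1)
        | (refine ⟨9, ?_⟩; change (X 0 * X 1 * X 2 : MvPolynomial (Fin 3) k) = _; ring1)
    obtain ⟨i, hi⟩ := key
    rw [← hi]
    exact Submodule.subset_span ⟨i, rfl⟩
  obtain ⟨c, hc⟩ := (Submodule.mem_span_range_iff_exists_fun k).1 hmem
  have h3 : (3 : MvPolynomial (Fin 3) k) = C 3 := (map_ofNat C 3).symm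
  have h6 : (6 : MvPolynomial (Fin 3) k) = C 6 := (map_ofNat C 6).symm
  have h33 : (C (3⁻¹ : k) : MvPolynomial (Fin 3) k) * C 3 = 1 := by
    rw [← C_mul, inv_mul_cancel₀ (by norm_num), C_1]
  have h66 : (C (6⁻¹ : k) : MvPolynomial (Fin 3) k) * C 6 = 1 := by
    rw [← C_mul, inv_mul_cancel₀ (by norm_num), C_1]
  refine ⟨![c 0, c 1, c 2, c 3 * 3⁻¹, c 4 * 3⁻¹, c 5 * 3⁻¹, c 6 * 3⁻¹, c 7 * 3⁻¹, c 8 * 3⁻¹,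
    c 9 * 6⁻¹], ?_⟩
  rw [← hc]
  simp only [Fin.sum_univ_succ, h3, h6]
  simp only [C_mul, smul_eq_C_mul, m, Matrix.cons_val]
  simp
  linear_combination -(C (c 9) * X 0 * X 1 * X 2) * h66
    - (C (c 3) * X 0 ^ 2 * X 1 + C (c 4) * X 0 ^ 2 * X 2 + C (c 5) * X 1 ^ 2 * X 0
      + C (c 6) * X 1 ^ 2 * X 2 + C (c 7) * X 2 ^ 2 * X 0 + C (c 8) * X 2 ^ 2 * X 1) * h33

theorem homog_three_tri {k : Type*} [Field k] [CharZero k] (F : MvPolynomial (Fin 3) k)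
    (hF : F.IsHomogeneous 3) : ∃ c : Fin 10 → k, (∀ v, eval v F = tri c v v v) ∧
      ∀ v i, eval v (pderiv i F) = 3 * tri c v v (Pi.single i 1) := by
  obtain ⟨c, rfl⟩ := homog_three_form F hF
  refine ⟨c, fun v => ?_, fun v i => ?_⟩
  · simp [tri]; ring
  · have h3 : ∀ i, pderiv i (3 : MvPolynomial (Fin 3) k) = 0 := fun i => (pderiv i).map_natCast 3
    have h6 : ∀ i, pderiv i (6 : MvPolynomial (Fin 3) k) = 0 := fun i => (pderiv i).map_natCast 6
    fin_cases i <;> simp [tri, h3, h6, pderiv_X, Derivation.leibniz_pow, Derivation.leibniz, Pi.single_apply] <;> ring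

theorem unit_pow_sub_one_dvd {L : Type*} [Field L] [NumberField L] (g : (𝓞 L)ˣ) (d : 𝓞 L)
    (hd : d ≠ 0) : ∃ n : ℕ, 0 < n ∧ ∀ j : ℕ, d ∣ ((g ^ (n * j) : (𝓞 L)ˣ) : 𝓞 L) - 1 := by
  have : Finite (𝓞 L ⧸ Ideal.span {d}) :=
    Ring.HasFiniteQuotients.finiteQuotient (by simpa using hd)
  have hfin := isOfFinOrder_of_finite
    (Units.map (Ideal.Quotient.mk (Ideal.span {d})).toMonoidHom g)
  obtain ⟨n, hn, h⟩ := isOfFinOrder_iff_pow_eq_one.1 hfin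
  refine ⟨n, hn, fun j => ?_⟩
  rw [← Ideal.mem_span_singleton, ← Ideal.Quotient.eq, map_one]
  have h2 : (Units.map (Ideal.Quotient.mk (Ideal.span {d})).toMonoidHom g) ^ (n * j) = 1 := by
    rw [pow_mul, h, one_pow]
  have h3 := congrArg Units.val h2
  simpa using h3

theorem pell_core {k L : Type*} [Field k] [Field L] [NumberField L] [Algebra k L]
    (α : k) (β : L) (hβ : β ^ 2 = algebraMap k L α) (hβ0 : β ≠ 0)
    (g : (𝓞 L)ˣ) (hg : ∀ n : ℕ, 0 < n → g ^ n ≠ 1)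
    (hdesc : ∀ (U V : L) (n : ℕ), U + β * V = (((g ^ n : (𝓞 L)ˣ) : 𝓞 L) : L) →
      U - β * V = (((g⁻¹ ^ n : (𝓞 L)ˣ) : 𝓞 L) : L) →
      U ∈ (algebraMap k L).range ∧ V ∈ (algebraMap k L).range) :
    {p : k × k | IsIntegral ℤ p.1 ∧ IsIntegral ℤ p.2 ∧ p.1 ^ 2 - α * p.2 ^ 2 = 1}.Infinite := by
  have : CharZero L := inferInstance
  obtain ⟨d, hd0, hd⟩ : ∃ d : ℤ, d ≠ 0 ∧ IsIntegral ℤ ((d : L) * β) := by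
    have hal : IsAlgebraic ℤ β := (IsFractionRing.isAlgebraic_iff ℤ ℚ L).2 (IsAlgebraic.of_finite ℚ β)
    obtain ⟨y, hy, h⟩ := hal.exists_integral_multiple
    exact ⟨y, hy, by simpa using h⟩
  let δ : 𝓞 L := ⟨(d : L) * β, hd⟩
  have hδ : (δ : L) = d * β := rfl
  have hδ0 : δ ≠ 0 := by
    intro h
    have : (δ : L) = 0 := by rw [h]; rfl
    rw [hδ] at this
    simp [hd0, hβ0] at this
  obtain ⟨n, hn, hn1⟩ := unit_pow_sub_one_dvd g (2 * δ) (mul_ne_zero two_ne_zero hδ0)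
  obtain ⟨m, hm, hm1⟩ := unit_pow_sub_one_dvd g⁻¹ (2 * δ) (mul_ne_zero two_ne_zero hδ0)
  have key : ∀ j : ℕ, ∃ p : k × k, (IsIntegral ℤ p.1 ∧ IsIntegral ℤ p.2 ∧
      p.1 ^ 2 - α * p.2 ^ 2 = 1) ∧ algebraMap k L p.1 + β * algebraMap k L p.2 =
        (((g ^ (n * m * j) : (𝓞 L)ˣ) : 𝓞 L) : L) := by
    intro j
    obtain ⟨a, ha⟩ := hn1 (m * j)
    obtain ⟨b, hb⟩ := hm1 (n * j)
    rw [← mul_assoc] at ha hb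
    rw [mul_comm m n] at hb
    have hab : ((g ^ (n * m * j) : (𝓞 L)ˣ) : 𝓞 L) * ((g⁻¹ ^ (n * m * j) : (𝓞 L)ˣ) : 𝓞 L) = 1 := by
      rw [← Units.val_mul, ← mul_pow, mul_inv_cancel, one_pow, Units.val_one]
    set G : 𝓞 L := ((g ^ (n * m * j) : (𝓞 L)ˣ) : 𝓞 L) with hG
    set H : 𝓞 L := ((g⁻¹ ^ (n * m * j) : (𝓞 L)ˣ) : 𝓞 L) with hH
    have h1 : ((1 + δ * (a + b) : 𝓞 L) : L) + β * ((d * (a - b) : 𝓞 L) : L) = (G : L) := by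
      have : G = 1 + δ * (a + b) + δ * (a - b) := by linear_combination ha
      rw [this]
      simp only [map_add, map_mul, map_sub, map_one, map_intCast, hδ]
      ring
    have h2 : ((1 + δ * (a + b) : 𝓞 L) : L) - β * ((d * (a - b) : 𝓞 L) : L) = (H : L) := by
      have : H = 1 + δ * (a + b) - δ * (a - b) := by linear_combination hb
      rw [this]
      simp only [map_add, map_mul, map_sub, map_one, map_intCast, hδ]
      ring
    obtain ⟨⟨u, hu⟩, ⟨v, hv⟩⟩ := hdesc _ _ _ h1 h2
    have hinj := (algebraMap k L).injective
    rw [← hu, ← hv] at h1 h2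
    refine ⟨(u, v), ⟨?_, ?_, ?_⟩, h1⟩
    · rw [← isIntegral_algebraMap_iff hinj, hu]
      exact RingOfIntegers.isIntegral_coe _
    · rw [← isIntegral_algebraMap_iff hinj, hv]
      exact RingOfIntegers.isIntegral_coe _
    · apply hinj
      have hab' : (G : L) * (H : L) = 1 := by rw [← map_mul, hab, map_one]
      rw [← h1, ← h2] at hab'
      simp only [map_sub, map_pow, map_mul, map_one, ← hβ]
      linear_combination hab'
  choose p hp1 hp2 using key
  refine Set.infinite_of_injective_forall_mem (f := p) ?_ hp1
  intro i j hij
  have h := hp2 i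
  rw [hij, hp2 j] at h
  have h' : g ^ (n * m * j) = g ^ (n * m * i) := Units.ext (RingOfIntegers.ext h)
  have hinj : Function.Injective (fun n : ℕ => g ^ n) := by
    rw [injective_pow_iff_not_isOfFinOrder, isOfFinOrder_iff_pow_eq_one]
    rintro ⟨n, hn, h⟩
    exact hg n hn h
  have h3 := hinj h'
  exact (Nat.eq_of_mul_eq_mul_left (Nat.mul_pos hn hm) h3).symm

theorem exists_unit_conj {L : Type*} [Field L] [NumberField L] (σ : L →+* L)
    (hσ : ∀ x, σ (σ x) = x) (I : L) (hI : I ^ 2 = -1) (hσI : σ I = I) (β : L) (hβ : σ β ≠ β) :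
    ∃ g : (𝓞 L)ˣ, (∀ n : ℕ, 0 < n → g ^ n ≠ 1) ∧ σ g = ((g⁻¹ : (𝓞 L)ˣ) : 𝓞 L) := by
  obtain ⟨φ⟩ : Nonempty (L →+* ℂ) := inferInstance
  let w₁ := InfinitePlace.mk φ
  let w₂ := InfinitePlace.mk (φ.comp σ)
  have hne : w₂ ≠ w₁ := by
    intro h
    rcases InfinitePlace.mk_eq_iff.1 h with h | h
    · apply hβ
      apply φ.injective
      exact RingHom.congr_fun h β
    · have h1 := RingHom.congr_fun h I
      simp only [ComplexEmbedding.conjugate_coe_eq, RingHom.comp_apply, hσI] at h1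
      have h2 : (φ I) ^ 2 = -1 := by rw [← map_pow, hI]; simp
      have h3 : (φ I).im = 0 := Complex.conj_eq_iff_im.1 h1
      have h4 := congrArg Complex.re h2
      simp [pow_two, h3] at h4
      nlinarith
  obtain ⟨u, hu⟩ := NumberField.Units.dirichletUnitTheorem.exists_unit L w₁
  have hu2 := hu w₂ hne
  have hu1 : 0 < Real.log (w₁ u) := by
    by_contra hcon
    push Not at hcon
    have hsum := NumberField.Units.sum_mult_mul_log u
    have : ∑ w : InfinitePlace L, w.mult * Real.log (w u) < ∑ w : InfinitePlace L, 0 := by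
      refine Finset.sum_lt_sum (fun w _ => ?_) ⟨w₂, Finset.mem_univ _, ?_⟩
      · refine mul_nonpos_of_nonneg_of_nonpos (Nat.cast_nonneg _) ?_
        by_cases hw : w = w₁
        · rw [hw]; exact hcon
        · exact (hu w hw).le
      · exact mul_neg_of_pos_of_neg (by exact_mod_cast InfinitePlace.mult_pos) hu2
    rw [hsum] at this
    simp at this
  let τ : (𝓞 L) →+* (𝓞 L) := RingOfIntegers.mapRingHom σ
  have hτ : ∀ x : 𝓞 L, ((τ x : 𝓞 L) : L) = σ x := fun x => rfl
  let v : (𝓞 L)ˣ := Units.map τ.toMonoidHom u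
  have hv : (v : L) = σ (u : L) := rfl
  refine ⟨u * v⁻¹, fun n hn h => ?_, ?_⟩
  · have h1 : (u : 𝓞 L) ^ n = (v : 𝓞 L) ^ n := by
      rw [mul_pow, inv_pow, mul_inv_eq_one] at h
      exact_mod_cast congrArg Units.val h
    have h2 : w₁ (u : L) ^ n = w₁ (v : L) ^ n := by
      rw [← map_pow, ← map_pow, ← map_pow, ← map_pow, h1]
    have h3 : w₁ (u : L) = w₁ (v : L) :=
      (pow_left_inj₀ (apply_nonneg _ _) (apply_nonneg _ _) hn.ne').1 h2
    have h4 : w₁ (v : L) = w₂ (u : L) := by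
      rw [hv]; rfl
    rw [h3, h4] at hu1
    exact lt_asymm hu1 hu2
  · obtain ⟨V, hV⟩ : ∃ V : 𝓞 L, V = (v : 𝓞 L) := ⟨_, rfl⟩
    obtain ⟨V', hV'⟩ : ∃ V : 𝓞 L, V = ((v⁻¹ : (𝓞 L)ˣ) : 𝓞 L) := ⟨_, rfl⟩
    obtain ⟨U, hU⟩ : ∃ V : 𝓞 L, V = (u : 𝓞 L) := ⟨_, rfl⟩
    obtain ⟨U', hU'⟩ : ∃ V : 𝓞 L, V = ((u⁻¹ : (𝓞 L)ˣ) : 𝓞 L) := ⟨_, rfl⟩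
    have hvU : algebraMap (𝓞 L) L V = σ (algebraMap (𝓞 L) L U) := by rw [hV, hU]; rfl
    have hvu : σ (algebraMap (𝓞 L) L V) = algebraMap (𝓞 L) L U := by rw [hvU, hσ]
    have e1 : V * V' = 1 := by rw [hV, hV', Units.mul_inv]
    have e2 : U * U' = 1 := by rw [hU, hU', Units.mul_inv]
    have e1' : algebraMap (𝓞 L) L V * algebraMap (𝓞 L) L V' = 1 := by rw [← map_mul, e1, map_one]
    have e2' : algebraMap (𝓞 L) L U * algebraMap (𝓞 L) L U' = 1 := by rw [← map_mul, e2, map_one]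
    have e3 : algebraMap (𝓞 L) L U * σ (algebraMap (𝓞 L) L V') = 1 := by
      rw [← hvu, ← map_mul, e1', map_one]
    have hu0 : algebraMap (𝓞 L) L U ≠ 0 := fun h => by
      rw [h, zero_mul] at e2'; exact zero_ne_one e2'
    have e4 : σ (algebraMap (𝓞 L) L V') = algebraMap (𝓞 L) L U' :=
      mul_left_cancel₀ hu0 (e3.trans e2'.symm)
    have goal : σ (algebraMap (𝓞 L) L (U * V')) = algebraMap (𝓞 L) L (V * U') := by
      rw [map_mul, map_mul, map_mul, e4, hvU]
    rw [mul_inv_rev, inv_inv, Units.val_mul, Units.val_mul, ← hV, ← hV', ← hU, ← hU']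
    exact goal

theorem quad_ext_exists {k : Type*} [Field k] [NumberField k] (α : k) (hsq : ∀ β : k, β ^ 2 ≠ α)
    (hF : Fact (∀ r : k, r ^ 2 ≠ α + 0 * r)) :
    CharZero (QuadraticAlgebra k α 0) ∧
    (∀ x : QuadraticAlgebra k α 0, star x = x → x ∈ (algebraMap k (QuadraticAlgebra k α 0)).range) ∧
    star (QuadraticAlgebra.omega : QuadraticAlgebra k α 0) = - QuadraticAlgebra.omega ∧
    (QuadraticAlgebra.omega : QuadraticAlgebra k α 0) ^ 2 = algebraMap k _ α ∧
    (QuadraticAlgebra.omega : QuadraticAlgebra k α 0) ≠ 0 ∧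
    ∀ c : k, star (algebraMap k (QuadraticAlgebra k α 0) c) = algebraMap k _ c := by
  refine ⟨charZero_of_injective_algebraMap
    (algebraMap k (QuadraticAlgebra k α 0)).injective, ?_, ?_, ?_, ?_, ?_⟩
  · intro x hx
    refine ⟨x.re, ?_⟩
    have h1 := congrArg QuadraticAlgebra.im hx
    rw [QuadraticAlgebra.im_star] at h1
    have h2 : x.im = 0 := by
      have : (2 : k) * x.im = 0 := by linear_combination -h1
      simpa using this
    ext
    · simp
    · simp [h2]
  · ext <;> simp
  · rw [pow_two]; ext <;> simp
  · intro h
    have := congrArg QuadraticAlgebra.im h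
    simp at this
  · intro c; ext <;> simp

theorem pell_quad_aux {k : Type*} [Field k] [NumberField k] (I : k) (hI : I ^ 2 = -1) (α : k)
    (L : Type*) [Field L] [NumberField L] [Algebra k L] (σ : L →+* L) (hσσ : ∀ x, σ (σ x) = x)
    (hfix : ∀ x, σ x = x → x ∈ (algebraMap k L).range) (ω : L) (hωσ : σ ω = -ω)
    (hω2 : ω ^ 2 = algebraMap k L α) (hω0 : ω ≠ 0)
    (hc : ∀ c, σ (algebraMap k L c) = algebraMap k L c) :
    {p : k × k | IsIntegral ℤ p.1 ∧ IsIntegral ℤ p.2 ∧ p.1 ^ 2 - α * p.2 ^ 2 = 1}.Infinite := by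
  obtain ⟨g, hg, hgσ⟩ := exists_unit_conj σ hσσ (algebraMap k L I)
    (by rw [← map_pow, hI]; simp) (hc I) ω (by
      rw [hωσ]
      exact fun h => hω0 (self_eq_neg.1 h.symm))
  refine pell_core (L := L) α ω hω2 hω0 g hg ?_
  intro U V n h1 h2
  have hgn : σ (((g ^ n : (𝓞 L)ˣ) : 𝓞 L) : L) = (((g⁻¹ ^ n : (𝓞 L)ˣ) : 𝓞 L) : L) := by
    simp only [Units.val_pow_eq_pow_val, map_pow, hgσ]
  have hgn' : σ (((g⁻¹ ^ n : (𝓞 L)ˣ) : 𝓞 L) : L) = (((g ^ n : (𝓞 L)ˣ) : 𝓞 L) : L) := by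
    rw [← hgn, hσσ]
  rw [← h1, ← h2, map_add, map_mul, hωσ] at hgn
  rw [← h1, ← h2, map_sub, map_mul, hωσ] at hgn'
  constructor
  · apply hfix
    have : (2 : L) * (σ U - U) = 0 := by linear_combination hgn + hgn'
    simpa [sub_eq_zero] using this
  · apply hfix
    have : (2 : L) * ω * (σ V - V) = 0 := by linear_combination hgn' - hgn
    simpa [sub_eq_zero, hω0] using this

theorem pell_infinite {k : Type*} [Field k] [NumberField k] (I r : k) (hI : I ^ 2 = -1)
    (hr : r ^ 2 = 2) (α : k) (hα : α ≠ 0) :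
    {p : k × k | IsIntegral ℤ p.1 ∧ IsIntegral ℤ p.2 ∧ p.1 ^ 2 - α * p.2 ^ 2 = 1}.Infinite := by
  by_cases hsq : ∃ β : k, β ^ 2 = α
  · obtain ⟨β, hβ⟩ := hsq
    have hint : IsIntegral ℤ r := by
      refine IsIntegral.of_pow (n := 2) (by norm_num) ?_
      rw [hr]; simpa using isIntegral_algebraMap (R := ℤ) (A := k) (x := 2)
    let ρ : 𝓞 k := ⟨r, hint⟩
    have hρv : algebraMap (𝓞 k) k ρ = r := rfl
    have hρ : ρ ^ 2 = 2 := by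
      apply RingOfIntegers.coe_injective
      rw [map_pow, hρv, hr, map_ofNat]
    let g : (𝓞 k)ˣ := ⟨1 + ρ, ρ - 1, by linear_combination hρ, by linear_combination hρ⟩
    refine pell_core (L := k) α β (by simpa using hβ) (by rintro rfl; apply hα; rw [← hβ]; norm_num)
      g ?_ (fun U V n _ _ => ⟨⟨U, rfl⟩, ⟨V, rfl⟩⟩)
    intro n hn h
    obtain ⟨φ⟩ : Nonempty (k →+* ℂ) := inferInstance
    have h1 : (1 + r) ^ n = 1 := by
      have h0 : (1 + ρ) ^ n = 1 := by
        have := congrArg (fun x : (𝓞 k)ˣ => (x : 𝓞 k)) h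
        simpa [g] using this
      have := congrArg (algebraMap (𝓞 k) k) h0
      rwa [map_pow, map_add, map_one, hρv] at this
    have h2 : ‖φ (1 + r)‖ = 1 := by
      refine (pow_eq_one_iff_of_nonneg (norm_nonneg _) hn.ne').1 ?_
      rw [← norm_pow, ← map_pow, h1]; simp
    have h3 : (φ r) ^ 2 = ((√2 : ℝ) : ℂ) ^ 2 := by
      rw [← map_pow, hr, ← Complex.ofReal_pow, Real.sq_sqrt (by norm_num), map_ofNat]; simp
    have hs : (1 : ℝ) < √2 := Real.lt_sqrt_of_sq_lt (by norm_num)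
    have hs2 : √2 ^ 2 = 2 := Real.sq_sqrt (by norm_num)
    rcases sq_eq_sq_iff_eq_or_eq_neg.1 h3 with h4 | h4
    · rw [map_add, map_one, h4, ← Complex.ofReal_one, ← Complex.ofReal_add, Complex.norm_real,
        Real.norm_of_nonneg (by positivity)] at h2
      linarith
    · rw [map_add, map_one, h4, ← Complex.ofReal_one, ← Complex.ofReal_neg, ← Complex.ofReal_add,
        Complex.norm_real, Real.norm_eq_abs, abs_of_neg (by linarith)] at h2
      nlinarith
  · push Not at hsq
    have : Fact (∀ r : k, r ^ 2 ≠ α + 0 * r) := ⟨fun r => by simpa using hsq r⟩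
    obtain ⟨h1, h2, h3, h4, h5, h6⟩ := quad_ext_exists α hsq this
    have hNF : NumberField (QuadraticAlgebra k α 0) := NumberField.of_module_finite k _
    obtain ⟨σ, hσ⟩ : ∃ σ : QuadraticAlgebra k α 0 →+* QuadraticAlgebra k α 0, ∀ x, σ x = star x :=
      ⟨starRingEnd _, fun x => rfl⟩
    have hσσ : ∀ x, σ (σ x) = x := fun x => by rw [hσ, hσ, star_star]
    refine pell_quad_aux I hI α _ σ hσσ (fun x hx => h2 x (by rw [← hσ, hx])) _ (by rw [hσ, h3]) h4 h5
      (fun c => by rw [hσ, h6])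

theorem parity_split {L : Type*} [CommRing L] (G : MvPolynomial (Fin 3) L) :
    ∃ E O : MvPolynomial (Fin 3) L, ∀ x y z : L,
      eval ![x, y, z] G = eval ![x, y ^ 2, z] E + y * eval ![x, y ^ 2, z] O := by
  induction G using MvPolynomial.induction_on with
  | C a => exact ⟨C a, 0, fun x y z => by simp⟩
  | add p q hp hq =>
    obtain ⟨E, O, h⟩ := hp
    obtain ⟨E', O', h'⟩ := hq
    refine ⟨E + E', O + O', fun x y z => ?_⟩
    rw [map_add, map_add, map_add, h, h']; ring
  | mul_X p i hp =>
    obtain ⟨E, O, h⟩ := hp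
    fin_cases i
    · refine ⟨E * X 0, O * X 0, fun x y z => ?_⟩
      simp only [map_mul, h, eval_X]; simp; ring
    · refine ⟨O * X 1, E, fun x y z => ?_⟩
      simp only [map_mul, h, eval_X]; simp; ring
    · refine ⟨E * X 2, O * X 2, fun x y z => ?_⟩
      simp only [map_mul, h, eval_X]; simp; ring

theorem bipoly_eq_zero {L : Type*} [Field L] (p : Polynomial (Polynomial L)) (M : Set L)
    (hM : M.Infinite) (h : ∀ m ∈ M, {z | p.evalEval m z = 0}.Infinite) : p = 0 := by
  have h1 : ∀ m ∈ M, p.map (Polynomial.evalRingHom m) = 0 := by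
    intro m hm
    apply Polynomial.eq_zero_of_infinite_isRoot
    refine (h m hm).mono ?_
    intro z hz
    simp only [Set.mem_ofPred_eq] at hz ⊢
    rw [Polynomial.IsRoot, ← hz, Polynomial.map_evalRingHom_eval]
  ext1 n
  rw [Polynomial.coeff_zero]
  apply Polynomial.eq_zero_of_infinite_isRoot
  refine hM.mono fun m hm => ?_
  have := congrArg (fun q => q.coeff n) (h1 m hm)
  simpa using this

theorem density_aux {L : Type*} [Field L] [IsAlgClosed L] [CharZero L]
    (G : MvPolynomial (Fin 3) L) (n : ℕ) (hG : G.IsHomogeneous n) (A B : L)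
    (M : Set L) (hM : M.Infinite)
    (h : ∀ m ∈ M, {z : L | ∃ y, y ^ 2 = (m ^ 3 + A * m + B) * z ^ 2 + (3 * m ^ 2 + A) * z + 3 * m ∧
      eval ![1 + m * z, y, z] G = 0}.Infinite) : G = 0 := by
  obtain ⟨E, O, hEO⟩ := parity_split G
  let N : MvPolynomial (Fin 3) L := E ^ 2 - X 1 * O ^ 2
  have hN : ∀ x y z : L, eval ![x, y ^ 2, z] N = eval ![x, y, z] G * eval ![x, -y, z] G := by
    intro x y z
    rw [hEO x y z, hEO x (-y) z, neg_sq]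
    simp [N]; ring
  let X' : Polynomial (Polynomial L) := Polynomial.C Polynomial.X
  let Y' : Polynomial (Polynomial L) := Polynomial.X
  let c : L → Polynomial (Polynomial L) := fun a => Polynomial.C (Polynomial.C a)
  let f : Fin 3 → Polynomial (Polynomial L) := ![1 + X' * Y',
    (X' ^ 3 + c A * X' + c B) * Y' ^ 2 + (3 * X' ^ 2 + c A) * Y' + 3 * X', Y']
  let p : Polynomial (Polynomial L) := eval₂ (Polynomial.C.comp Polynomial.C) f N
  have hp : ∀ m z, p.evalEval m z = eval ![1 + m * z,
      (m ^ 3 + A * m + B) * z ^ 2 + (3 * m ^ 2 + A) * z + 3 * m, z] N := by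
    intro m z
    rw [← Polynomial.coe_evalEvalRingHom]
    simp only [p]
    rw [← MvPolynomial.coe_eval₂Hom, ← RingHom.comp_apply, MvPolynomial.comp_eval₂Hom]
    rw [← eval₂_id, ← coe_eval₂Hom]
    congr 1
    congr 1
    · ext a; simp
    · funext i
      fin_cases i
      · simp [f, X', Y', c]; try ring
      · simp [f, X', Y', c]; try ring
      · simp [f, X', Y', c]
  have hp0 : p = 0 := by
    refine bipoly_eq_zero p M hM fun m hm => (h m hm).mono ?_
    rintro z ⟨y, hy, hy0⟩
    change p.evalEval m z = 0
    rw [hp, ← hy, hN, hy0, zero_mul]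
  have key : ∀ x y z : L, z ≠ 0 → x ^ 3 + A * x * z ^ 2 + B * z ^ 3 - y ^ 2 * z = 1 →
      eval ![x, y, z] G * eval ![x, -y, z] G = 0 := by
    intro x y z hz hf
    have h1 := hp ((x - 1) / z) z
    have hx : 1 + (x - 1) / z * z = x := by field_simp; ring
    have hy : ((((x - 1) / z) ^ 3 + A * ((x - 1) / z) + B) * z ^ 2 + (3 * ((x - 1) / z) ^ 2 + A) * z
        + 3 * ((x - 1) / z)) = y ^ 2 := by
      field_simp
      linear_combination hf
    rw [hx, hy, hN, hp0] at h1
    rw [← h1]; simp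
  have hsc : ∀ (t x y z : L), eval ![t * x, t * y, t * z] G = t ^ n * eval ![x, y, z] G := by
    intro t x y z
    rw [eval_eq', eval_eq', Finset.mul_sum]
    refine Finset.sum_congr rfl fun d hd => ?_
    have hdn : d 0 + d 1 + d 2 = n := by
      have := hG (mem_support_iff.1 hd)
      change Finsupp.weight (fun _ => 1) d = n at this
      rw [← Finsupp.degree_eq_weight_one, Finsupp.degree_eq_sum, Fin.sum_univ_three] at this
      exact this
    simp only [Fin.prod_univ_three, Matrix.cons_val_zero, Matrix.cons_val_one, Matrix.cons_val]
    rw [← hdn]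
    ring
  have key2 : ∀ x y z : L, z * (x ^ 3 + A * x * z ^ 2 + B * z ^ 3 - y ^ 2 * z) *
      (eval ![x, y, z] G * eval ![x, -y, z] G) = 0 := by
    intro x y z
    by_cases hz : z = 0
    · rw [hz]; ring
    by_cases hf : x ^ 3 + A * x * z ^ 2 + B * z ^ 3 - y ^ 2 * z = 0
    · rw [hf]; ring
    obtain ⟨t, ht⟩ := IsAlgClosed.exists_pow_nat_eq
      (x ^ 3 + A * x * z ^ 2 + B * z ^ 3 - y ^ 2 * z)⁻¹ (n := 3) (by norm_num)
    have ht0 : t ≠ 0 := by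
      rintro rfl
      apply inv_ne_zero hf
      rw [← ht]; norm_num
    have := key (t * x) (t * y) (t * z) (mul_ne_zero ht0 hz) (by
      have : t ^ 3 * (x ^ 3 + A * x * z ^ 2 + B * z ^ 3 - y ^ 2 * z) = 1 := by
        rw [ht, inv_mul_cancel₀ hf]
      linear_combination this)
    rw [← mul_neg, hsc, hsc] at this
    have h2 : (t ^ n * t ^ n) * (eval ![x, y, z] G * eval ![x, -y, z] G) = 0 := by
      linear_combination this
    rcases mul_eq_zero.1 h2 with h3 | h3
    · exact absurd h3 (mul_ne_zero (pow_ne_zero _ ht0) (pow_ne_zero _ ht0))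
    · rw [h3, mul_zero]
  let G' : MvPolynomial (Fin 3) L := aeval ![X 0, -X 1, X 2] G
  have hG' : ∀ x y z : L, eval ![x, y, z] G' = eval ![x, -y, z] G := by
    intro x y z
    simp only [G']
    rw [aeval_def, ← coe_eval₂Hom, ← RingHom.comp_apply, MvPolynomial.comp_eval₂Hom]
    rw [← eval₂_id, ← coe_eval₂Hom]
    congr 1
    congr 1
    · ext a; simp
    · funext i
      fin_cases i <;> simp
  have hvec : ∀ v : Fin 3 → L, v = ![v 0, v 1, v 2] := fun v => by
    funext i; fin_cases i <;> rfl
  let f' : MvPolynomial (Fin 3) L := X 0 ^ 3 + C A * X 0 * X 2 ^ 2 + C B * X 2 ^ 3 - X 1 ^ 2 * X 2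
  have hprod : X 2 * f' * (G * G') = 0 := by
    apply MvPolynomial.funext
    intro v
    rw [hvec v, map_mul, map_mul, map_mul, hG', map_zero, ← key2 (v 0) (v 1) (v 2)]
    simp [f']
  have hX : (X 2 : MvPolynomial (Fin 3) L) ≠ 0 := X_ne_zero _
  have hf' : f' ≠ 0 := by
    intro h0
    have := congrArg (eval ![1, 0, 0]) h0
    simp [f'] at this
  rcases mul_eq_zero.1 ((mul_eq_zero.1 hprod).resolve_left (mul_ne_zero hX hf')) with h0 | h0
  · exact h0
  · apply MvPolynomial.funext
    intro v
    have := hG' (v 0) (- v 1) (v 2)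
    rw [h0, neg_neg, ← hvec] at this
    rw [← this, map_zero, map_zero]

theorem sq_fin {k : Type*} [Field k] (a : k) : {y : k | y ^ 2 = a}.Finite := by
  by_contra hinf
  have h : (Polynomial.X ^ 2 - Polynomial.C a : Polynomial k) = 0 := by
    apply Polynomial.eq_zero_of_infinite_isRoot
    refine Set.Infinite.mono ?_ hinf
    intro y hy
    change y ^ 2 = a at hy
    change Polynomial.eval y _ = 0
    simp [hy]
  exact Polynomial.X_pow_sub_C_ne_zero (by norm_num) a h

theorem hom_eval₂_aux {k l : Type*} [Field k] [Field l] (φ : k →+* l) (g : Fin 3 → k)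
    (G : MvPolynomial (Fin 3) k) : φ (eval g G) = eval₂ φ (fun i => φ (g i)) G := by
  rw [← coe_eval₂Hom, ← eval₂_id, ← coe_eval₂Hom, ← RingHom.comp_apply, comp_eval₂Hom,
    RingHom.comp_id]

theorem weier_points {k : Type*} [Field k] [CharZero k] (O : Subring k) (A B : k) (hA : A ∈ O)
    (hB : B ∈ O) (hO : ∀ x : k, IsIntegral ℤ x → x ∈ O)
    (hpell : ∀ α : k, α ≠ 0 →
      {p : k × k | IsIntegral ℤ p.1 ∧ IsIntegral ℤ p.2 ∧ p.1 ^ 2 - α * p.2 ^ 2 = 1}.Infinite)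
    (G : MvPolynomial (Fin 3) k) (hG0 : G ≠ 0) (n : ℕ) (hG : G.IsHomogeneous n) :
    ∃ x ∈ O, ∃ y ∈ O, ∃ z ∈ O, x ^ 3 + A * x * z ^ 2 + B * z ^ 3 - y ^ 2 * z = 1 ∧
      eval ![x, y, z] G ≠ 0 := by
  by_contra hcon
  push Not at hcon
  apply hG0
  let φ := algebraMap k (AlgebraicClosure k)
  have hφ : Function.Injective φ := φ.injective
  suffices h : G.map φ = 0 from (map_eq_zero_iff _ (map_injective φ hφ)).1 h
  let P : Polynomial k := (Polynomial.X ^ 3 + Polynomial.C A * Polynomial.X + Polynomial.C B) *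
    (3 * Polynomial.X ^ 4 + 6 * Polynomial.C A * Polynomial.X ^ 2 +
      12 * Polynomial.C B * Polynomial.X - Polynomial.C A ^ 2)
  have hP : P ≠ 0 := by
    apply mul_ne_zero
    · intro h
      have := congrArg (fun q => Polynomial.coeff q 3) h
      simp [Polynomial.coeff_X, Polynomial.coeff_C] at this
    · intro h
      have := congrArg (fun q => Polynomial.coeff q 4) h
      have h6 : (6 : Polynomial k) * Polynomial.C A * Polynomial.X ^ 2 =
        Polynomial.C (6 * A) * Polynomial.X ^ 2 := by simp [map_ofNat]
      have h12 : (12 : Polynomial k) * Polynomial.C B * Polynomial.X =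
        Polynomial.C (12 * B) * Polynomial.X := by simp [map_ofNat]
      have h3 : (3 : Polynomial k) * Polynomial.X ^ 4 = Polynomial.C 3 * Polynomial.X ^ 4 := by simp [map_ofNat]
      have hc : Polynomial.C A ^ 2 = Polynomial.C (A ^ 2) := by simp
      rw [h6, h12, h3, hc] at this
      simp [Polynomial.coeff_X, Polynomial.coeff_C, -map_mul, -map_pow,
        Polynomial.coeff_X_pow, Polynomial.coeff_C_mul] at this
  let M₀ : Set k := {m | (∃ s : ℕ, m = 3 * (s : k) ^ 2) ∧ P.eval m ≠ 0}
  have hM₀ : M₀.Infinite := by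
    have h1 : {m : k | ∃ s : ℕ, m = 3 * (s : k) ^ 2}.Infinite := by
      refine Set.infinite_of_injective_forall_mem (f := fun s : ℕ => 3 * (s : k) ^ 2) ?_
        (fun s => ⟨s, rfl⟩)
      intro a b hab
      simp only at hab
      have : (3 * a ^ 2 : ℕ) = 3 * b ^ 2 := by exact_mod_cast hab
      have h2 : a ^ 2 = b ^ 2 := by omega
      exact Nat.pow_left_injective two_ne_zero h2
    have h2 : {m : k | P.eval m = 0}.Finite := by
      by_contra hinf
      exact hP (Polynomial.eq_zero_of_infinite_isRoot P hinf)
    refine (h1.sdiff h2).mono ?_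
    rintro m ⟨hm, hm'⟩
    exact ⟨hm, hm'⟩
  refine density_aux (G.map φ) n (hG.map φ) (φ A) (φ B) (φ '' M₀)
    (hM₀.image hφ.injOn) ?_
  rintro _ ⟨m, ⟨⟨s, hs⟩, hm⟩, rfl⟩
  simp only [P, Polynomial.eval_mul, Polynomial.eval_add, Polynomial.eval_sub, Polynomial.eval_pow,
    Polynomial.eval_X, Polynomial.eval_C, Polynomial.eval_ofNat] at hm
  have hα : m ^ 3 + A * m + B ≠ 0 := left_ne_zero_of_mul hm
  have hdet : 3 * m ^ 4 + 6 * A * m ^ 2 + 12 * B * m - A ^ 2 ≠ 0 := right_ne_zero_of_mul hm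
  obtain ⟨α, hαd⟩ : ∃ α, α = m ^ 3 + A * m + B := ⟨_, rfl⟩
  obtain ⟨β, hβd⟩ : ∃ β, β = 3 * m ^ 2 + A := ⟨_, rfl⟩
  have hdet' : 36 * (s : k) ^ 2 * α - β ^ 2 ≠ 0 := by
    convert hdet using 1
    rw [hαd, hβd]
    linear_combination (-12 * (m ^ 3 + A * m + B)) * hs
  have hZ : {z : k | ∃ y, y ^ 2 = α * z ^ 2 + β * z + 3 * m ∧ eval ![1 + m * z, y, z] G = 0}.Infinite := by
    have hpi := hpell α (hαd ▸ hα)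
    have hsO : (s : k) ∈ O := natCast_mem O s
    have hmO : m ∈ O := by
      rw [hs]; exact O.mul_mem (ofNat_mem O 3) (O.pow_mem hsO 2)
    have hαO : α ∈ O := hαd ▸ O.add_mem (O.add_mem (O.pow_mem hmO 3) (O.mul_mem hA hmO)) hB
    have hβO : β ∈ O := hβd ▸ O.add_mem (O.mul_mem (ofNat_mem O 3) (O.pow_mem hmO 2)) hA
    by_contra hfin
    rw [Set.not_infinite] at hfin
    apply hpi
    have hQ : {q : k × k | q.2 ∈ {z : k | ∃ y, y ^ 2 = α * z ^ 2 + β * z + 3 * m ∧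
        eval ![1 + m * z, y, z] G = 0} ∧ q.1 ^ 2 = α * q.2 ^ 2 + β * q.2 + 3 * m}.Finite := by
      refine Set.Finite.subset (hfin.biUnion (t := fun z =>
        (fun y => (y, z)) '' {y : k | y ^ 2 = α * z ^ 2 + β * z + 3 * m}) fun z _ => ?_) ?_
      · apply Set.Finite.image
        exact sq_fin _
      · rintro ⟨y, z⟩ ⟨h1, h2⟩
        exact Set.mem_biUnion h1 ⟨y, h2, rfl⟩
    let ψ : k × k → k × k := fun q => (3 * s * (1 + 2 * α * q.2 ^ 2) + β * q.1 * q.2,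
      β * q.2 ^ 2 + 6 * s * q.1 * q.2)
    refine Set.Finite.subset (hQ.biUnion (t := fun q =>
      {p : k × k | p.1 ^ 2 - α * p.2 ^ 2 = 1 ∧ ψ p = q}) fun q _ => ?_) ?_
    · have hf1 : {v : k | v ^ 2 = (6 * s * (q.1 - 3 * s) - β * q.2) / (36 * (s : k) ^ 2 * α - β ^ 2)}.Finite :=
        sq_fin _
      have hf2 : {u : k | u ^ 2 = 1 + α *
        ((6 * s * (q.1 - 3 * s) - β * q.2) / (36 * (s : k) ^ 2 * α - β ^ 2))}.Finite := sq_fin _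
      refine (hf2.prod hf1).subset ?_
      rintro ⟨u, v⟩ ⟨h1, h2⟩
      simp only at h1
      have hv : v ^ 2 = (6 * s * (q.1 - 3 * s) - β * q.2) / (36 * (s : k) ^ 2 * α - β ^ 2) := by
        rw [eq_div_iff hdet', ← h2]
        simp only [ψ]; ring
      refine ⟨?_, hv⟩
      change u ^ 2 = _
      rw [← hv]; linear_combination h1
    · rintro ⟨u, v⟩ ⟨h1, h2, h3⟩
      simp only at h1 h2 h3
      have huO := hO u h1
      have hvO := hO v h2
      have hyO : (ψ (u, v)).1 ∈ O := by
        simp only [ψ]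
        exact O.add_mem (O.mul_mem (O.mul_mem (ofNat_mem O 3) hsO) (O.add_mem O.one_mem
          (O.mul_mem (O.mul_mem (ofNat_mem O 2) hαO) (O.pow_mem hvO 2))))
          (O.mul_mem (O.mul_mem hβO huO) hvO)
      have hzO : (ψ (u, v)).2 ∈ O := by
        simp only [ψ]
        exact O.add_mem (O.mul_mem hβO (O.pow_mem hvO 2))
          (O.mul_mem (O.mul_mem (O.mul_mem (ofNat_mem O 6) hsO) huO) hvO)
      have hcurve : (ψ (u, v)).1 ^ 2 = α * (ψ (u, v)).2 ^ 2 + β * (ψ (u, v)).2 + 3 * m := by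
        simp only [ψ]
        rw [hs]
        linear_combination (β ^ 2 * v ^ 2 - 36 * s ^ 2 * α * v ^ 2) * h3
      refine Set.mem_biUnion (x := ψ (u, v)) ⟨⟨_, hcurve, ?_⟩, hcurve⟩ ⟨h3, rfl⟩
      refine hcon _ (O.add_mem O.one_mem (O.mul_mem hmO hzO)) _ hyO _ hzO ?_
      rw [hcurve, hαd, hβd]
      ring
  refine (hZ.image (f := φ) hφ.injOn).mono ?_
  rintro _ ⟨z, ⟨y, hy, hy0⟩, rfl⟩
  refine ⟨φ y, ?_, ?_⟩
  · rw [← map_pow, hy, hαd, hβd]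
    simp [map_ofNat]
  · have : ![1 + φ m * φ z, φ y, φ z] = fun i => φ (![1 + m * z, y, z] i) := by
      funext i; fin_cases i <;> simp
    rw [this, eval_map, ← hom_eval₂_aux, hy0, map_zero]

theorem span_top_aux {k R : Type*} [Field k] [CommRing R] [Algebra R k] {O : Subalgebra R k}
    (T' : Matrix (Fin 3) (Fin 3) k) (t : Fin 3 → Fin 3 → O) (ht : ∀ i j, (t i j : k) = T' i j)
    (a : Fin 3 → O) (A B x y z : O)
    (h : T'.mulVec (fun i => (a i : k)) = ![(x : k), (y : k), (z : k)])
    (hf : (x : k) ^ 3 + A * x * z ^ 2 + B * z ^ 3 - y ^ 2 * z = 1) :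
    Ideal.span (Set.range a) = ⊤ := by
  have hin : ∀ (w : O) (i : Fin 3), (w : k) = ![(x : k), (y : k), (z : k)] i →
      w ∈ Ideal.span (Set.range a) := by
    intro w i hw
    have : w = ∑ j, t i j * a j := by
      apply Subtype.ext
      rw [hw, ← h, AddSubmonoidClass.coe_finsetSum]
      simp [Matrix.mulVec, dotProduct, ht]
    rw [this]
    exact Ideal.sum_mem _ fun j _ => Ideal.mul_mem_left _ _ (Ideal.subset_span ⟨j, rfl⟩)
  have h0 := hin x 0 (by simp)
  have h2 := hin z 2 (by simp)
  rw [Ideal.eq_top_iff_one]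
  have h1 : (1 : O) = x ^ 2 * x + (A * x * z + B * z ^ 2 - y ^ 2) * z := by
    apply Subtype.ext
    push_cast
    rw [← hf]; ring
  rw [h1]
  exact Ideal.add_mem _ (Ideal.mul_mem_left _ _ h0) (Ideal.mul_mem_left _ _ h2)

theorem final_aux {k : Type*} [Field k] [NumberField k] (T T' : Matrix (Fin 3) (Fin 3) k)
    (hT : T * T' = 1) (A B I r : k) (hI : I ^ 2 = -1) (hr : r ^ 2 = 2)
    (F : MvPolynomial (Fin 3) k)
    (hF : ∀ x y z : k, eval (T.mulVec ![x, y, z]) F =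
      x ^ 3 + A * x * z ^ 2 + B * z ^ 3 - y ^ 2 * z) :
    ∃ S : Finset (HeightOneSpectrum (𝓞 k)),
      ∀ G : MvPolynomial (Fin 3) k, G ≠ 0 → (∃ n : ℕ, G.IsHomogeneous n) →
        ∃ a : Fin 3 → ((S : Set (HeightOneSpectrum (𝓞 k))).integer k),
          Ideal.span (Set.range a) = ⊤ ∧
          (∃ u : ((S : Set (HeightOneSpectrum (𝓞 k))).integer k)ˣ,
            ((u : ((S : Set (HeightOneSpectrum (𝓞 k))).integer k)) : k) =
              eval (fun i => (a i : k)) F) ∧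
          eval (fun i => (a i : k)) G ≠ 0 := by
  classical
  have hT' : T' * T = 1 := mul_eq_one_comm.1 hT
  let bad : Set (HeightOneSpectrum (𝓞 k)) :=
    (HeightOneSpectrum.Support (𝓞 k) A ∪ HeightOneSpectrum.Support (𝓞 k) B) ∪
      ((⋃ i, ⋃ j, HeightOneSpectrum.Support (𝓞 k) (T i j)) ∪
       (⋃ i, ⋃ j, HeightOneSpectrum.Support (𝓞 k) (T' i j)))
  have hbad : bad.Finite := by
    refine Set.Finite.union (Set.Finite.union (HeightOneSpectrum.Support.finite _ _)
      (HeightOneSpectrum.Support.finite _ _)) (Set.Finite.union ?_ ?_)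
    · exact Set.finite_iUnion fun i => Set.finite_iUnion fun j => HeightOneSpectrum.Support.finite _ _
    · exact Set.finite_iUnion fun i => Set.finite_iUnion fun j => HeightOneSpectrum.Support.finite _ _
  refine ⟨hbad.toFinset, ?_⟩
  obtain ⟨S, hS⟩ : ∃ S : Set (HeightOneSpectrum (𝓞 k)), S = (hbad.toFinset : Set _) := ⟨_, rfl⟩
  rw [← hS]
  have hmem : ∀ x : k, HeightOneSpectrum.Support (𝓞 k) x ⊆ bad → x ∈ S.integer k := by
    intro x hx v hv
    by_contra hcon
    apply hv
    rw [hS, Set.Finite.coe_toFinset]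
    exact hx (lt_of_not_ge hcon)
  have hA : A ∈ S.integer k := hmem A fun v hv => Or.inl (Or.inl hv)
  have hB : B ∈ S.integer k := hmem B fun v hv => Or.inl (Or.inr hv)
  have hTm : ∀ i j, T i j ∈ S.integer k := fun i j => hmem _ fun v hv =>
    Or.inr (Or.inl (Set.mem_iUnion.2 ⟨i, Set.mem_iUnion.2 ⟨j, hv⟩⟩))
  have hTm' : ∀ i j, T' i j ∈ S.integer k := fun i j => hmem _ fun v hv =>
    Or.inr (Or.inr (Set.mem_iUnion.2 ⟨i, Set.mem_iUnion.2 ⟨j, hv⟩⟩))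
  have hO : ∀ x : k, IsIntegral ℤ x → x ∈ (S.integer k).toSubring := fun x hx =>
    (S.integer k).algebraMap_mem (⟨x, hx⟩ : 𝓞 k)
  rintro G hG0 ⟨n, hGn⟩
  let G' : MvPolynomial (Fin 3) k := aeval (fun i => ∑ j, C (T i j) * X j) G
  have hG' : ∀ v : Fin 3 → k, eval v G' = eval (T.mulVec v) G := by
    intro v
    simp only [G']
    rw [aeval_def, ← coe_eval₂Hom, ← RingHom.comp_apply, MvPolynomial.comp_eval₂Hom]
    rw [← eval₂_id, ← coe_eval₂Hom]
    congr 1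
    congr 1
    · ext a; simp
    · funext i
      simp [Matrix.mulVec, dotProduct]
  have hG'0 : G' ≠ 0 := by
    intro h
    apply hG0
    apply MvPolynomial.funext
    intro v
    have := hG' (T'.mulVec v)
    rw [Matrix.mulVec_mulVec, hT, Matrix.one_mulVec, h] at this
    rw [← this, map_zero, map_zero]
  have hG'n : G'.IsHomogeneous (1 * n) := by
    refine hGn.aeval _ fun i => ?_
    refine IsHomogeneous.sum _ _ _ fun j _ => ?_
    simpa using (isHomogeneous_C (Fin 3) (T i j)).mul (isHomogeneous_X k j)
  obtain ⟨x, hx, y, hy, z, hz, hf, hne⟩ := weier_points (S.integer k).toSubring A B hA hB hO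
    (fun α hα => pell_infinite I r hI hr α hα) G' hG'0 _ hG'n
  have hvm : ∀ i, ![x, y, z] i ∈ S.integer k := by
    rw [Fin.forall_fin_succ, Fin.forall_fin_two]
    exact ⟨hx, hy, hz⟩
  have ham : ∀ i, T.mulVec ![x, y, z] i ∈ S.integer k := by
    intro i
    have he : T.mulVec ![x, y, z] i = ∑ j, T i j * ![x, y, z] j := rfl
    rw [he]
    exact Subalgebra.sum_mem _ fun j _ => Subalgebra.mul_mem _ (hTm i j) (hvm j)
  let a : Fin 3 → S.integer k := fun i => ⟨T.mulVec ![x, y, z] i, ham i⟩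
  have ha : (fun i => (a i : k)) = T.mulVec ![x, y, z] := rfl
  refine ⟨a, ?_, ⟨1, ?_⟩, ?_⟩
  · refine span_top_aux T' (fun i j => ⟨T' i j, hTm' i j⟩) (fun _ _ => rfl) a ⟨A, hA⟩ ⟨B, hB⟩ ⟨x, hx⟩
      ⟨y, hy⟩ ⟨z, hz⟩ ?_ hf
    rw [ha, Matrix.mulVec_mulVec, hT', Matrix.one_mulVec]
  · rw [ha, hF, hf]; rfl
  · rw [ha, ← hG']; exact hne

/-- **Potential density of integral points on the complement of a smooth plane cubic**
(the case `X = ℙ²`, `D` a smooth plane cubic, of Theorem 7.1 of the paper; a theorem of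
Beukers answering a question of Silverman).

Let `K` be a number field and `F` a cubic form in three variables over `K` defining a
smooth plane cubic curve `D ⊂ ℙ²`.  Then there are a finite extension `K'` of `K` and a
finite set `S` of maximal ideals of `𝓞 K'` such that, with `R` the ring of `S`-integers
of `K'`, the set of points `(a : b : c) ∈ ℙ²(K')` admitting representatives `a, b, c ∈ R`
with `aR + bR + cR = R` and `F(a,b,c) ∈ Rˣ` is Zariski dense in `ℙ²`: for every nonzero
homogeneous polynomial `G` over `K'` there is such a point at which `G ≠ 0`. -/
theorem plane_cubic_complement_integral_points_potentially_dense
    (K : Type) [Field K] [NumberField K]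
    (F : MvPolynomial (Fin 3) K) (hF : F.IsHomogeneous 3)
    -- `D` is a smooth plane cubic: over an algebraic closure, `F` and its three partial
    -- derivatives have no common nonzero zero
    (hDsmooth : ∀ a : Fin 3 → AlgebraicClosure K, a ≠ 0 →
      ¬ (aeval a F = 0 ∧ ∀ i : Fin 3, aeval a (pderiv i F) = 0)) :
    ∃ (K' : Type) (_ : Field K') (_ : NumberField K') (_ : Algebra K K')
      (_ : FiniteDimensional K K')
      (S : Finset (HeightOneSpectrum (𝓞 K'))),
      ∀ G : MvPolynomial (Fin 3) K', G ≠ 0 → (∃ n : ℕ, G.IsHomogeneous n) →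
        ∃ a : Fin 3 → ((S : Set (HeightOneSpectrum (𝓞 K'))).integer K'),
          -- the coordinates generate the unit ideal of `R`
          Ideal.span (Set.range a) = ⊤ ∧
          -- `F` takes a unit value in `R` at the point
          (∃ u : ((S : Set (HeightOneSpectrum (𝓞 K'))).integer K')ˣ,
            ((u : ((S : Set (HeightOneSpectrum (𝓞 K'))).integer K')) : K') =
              eval (fun i => (a i : K')) (MvPolynomial.map (algebraMap K K') F)) ∧
          -- `G` does not vanish at the point
          eval (fun i => (a i : K')) G ≠ 0 := by
  classical
  let Kb := AlgebraicClosure K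
  let φ := algebraMap K (AlgebraicClosure K)
  obtain ⟨c, hc1, hc2⟩ := homog_three_tri (MvPolynomial.map φ F) (hF.map φ)
  obtain ⟨T, A, B, hdet, hW⟩ := weierstrass_form c (by
    intro v hv
    by_contra hv0
    refine hDsmooth v hv0 ⟨?_, fun i => ?_⟩
    · have := hc1 v
      rw [hv, eval_map] at this
      exact this
    · have := hc2 v i
      rw [hv, mul_zero, pderiv_map, eval_map] at this
      exact this)
  obtain ⟨I, hI⟩ := IsAlgClosed.exists_pow_nat_eq (-1 : AlgebraicClosure K) (n := 2) (by norm_num)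
  obtain ⟨r, hr⟩ := IsAlgClosed.exists_pow_nat_eq (2 : AlgebraicClosure K) (n := 2) (by norm_num)
  let s : Set (AlgebraicClosure K) := {A, B, I, r} ∪ Set.range (fun p : Fin 3 × Fin 3 => T p.1 p.2)
  have hs : s.Finite := Set.Finite.union (Set.toFinite _) (Set.finite_range _)
  obtain ⟨E, hE⟩ : ∃ E : IntermediateField K (AlgebraicClosure K), E = IntermediateField.adjoin K s :=
    ⟨_, rfl⟩
  have hsub : ∀ x ∈ s, x ∈ E := fun x hx => hE ▸ IntermediateField.subset_adjoin K s hx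
  have : Finite s := hs
  have hfd : FiniteDimensional K E := by
    rw [hE]
    exact IntermediateField.finiteDimensional_adjoin fun x _ =>
      (Algebra.IsAlgebraic.isAlgebraic x).isIntegral
  have hNF : NumberField E := NumberField.of_module_finite K E
  have hA : A ∈ E := hsub A (by simp [s])
  have hB : B ∈ E := hsub B (by simp [s])
  have hIE : I ∈ E := hsub I (by simp [s])
  have hrE : r ∈ E := hsub r (by simp [s])
  have hTE : ∀ i j, T i j ∈ E := fun i j => hsub _ (Or.inr ⟨(i, j), rfl⟩)
  let TE : Matrix (Fin 3) (Fin 3) E := Matrix.of fun i j => ⟨T i j, hTE i j⟩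
  let ψ : E →+* AlgebraicClosure K := algebraMap E (AlgebraicClosure K)
  have hψ : Function.Injective ψ := ψ.injective
  have hTT : TE.map ψ = T := by ext i j; rfl
  have hdetE : TE.det ≠ 0 := by
    intro h
    apply hdet
    rw [← hTT, ← RingHom.mapMatrix_apply, ← RingHom.map_det, h, map_zero]
  have hinv : TE * TE⁻¹ = 1 := Matrix.mul_nonsing_inv _ (isUnit_iff_ne_zero.2 hdetE)
  have hFE : ∀ x y z : E, eval (TE.mulVec ![x, y, z]) (MvPolynomial.map (algebraMap K E) F) =
      x ^ 3 + ⟨A, hA⟩ * x * z ^ 2 + ⟨B, hB⟩ * z ^ 3 - y ^ 2 * z := by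
    intro x y z
    apply hψ
    have hv : (fun i => ψ (TE.mulVec ![x, y, z] i)) = T.mulVec ![ψ x, ψ y, ψ z] := by
      funext i
      simp only [Matrix.mulVec, dotProduct, Fin.sum_univ_three, map_add, map_mul]
      rfl
    have h1 := hW (ψ x) (ψ y) (ψ z)
    rw [← hc1, ← hv] at h1
    have h2 : MvPolynomial.map φ F = MvPolynomial.map ψ (MvPolynomial.map (algebraMap K E) F) := by
      rw [MvPolynomial.map_map]; rfl
    rw [h2, eval_map, ← hom_eval₂_aux] at h1
    rw [h1]
    rfl
  obtain ⟨S, hS⟩ := final_aux TE TE⁻¹ hinv ⟨A, hA⟩ ⟨B, hB⟩ ⟨I, hIE⟩ ⟨r, hrE⟩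
    (hψ (by rw [map_pow, map_neg, map_one]; exact hI))
    (hψ (by rw [map_pow, map_ofNat]; exact hr)) _ hFE
  exact ⟨E, inferInstance, hNF, inferInstance, hfd, S, hS⟩
end
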